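/- arXiv:1506.08169 — 3 statements merged into one kernel-verified Lean document; each statement's English description precedes it below -/
import Mathlib

section
/- Let G be a finite solvable group. For any chief series 1 = N_0 < N_1 < ... < N_r = G of G, the number r of factors in the series is at most the number of nonprincipal Q_pp-valued irreducible characters of G. -/
open scoped Classical

noncomputable section

/-- `Qfield p` is the subfield of `ℂ` obtained by adjoining to `ℚ` all `p^a`-th
roots of unity for all positive integers `a` (any subfield of `ℂ` contains `ℚ`). -/
def Qfield (p : ℕ) : Subfield ℂ :=
  Subfield.closure {x : ℂ | ∃ a : ℕ, 0 < a ∧ x ^ p ^ a = 1}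

/-- `χ : G → ℂ` is an irreducible (ordinary, complex) character of `G` if it is the
character of some simple finite-dimensional complex representation of `G`. -/
def IsIrreducibleCharacter (G : Type) [Group G] (χ : G → ℂ) : Prop :=
  ∃ V : FDRep ℂ G, CategoryTheory.Simple V ∧ χ = fun g => V.character g

open Representation Module

section Characters

variable {G H : Type} [Group G] [Group H] [Finite G] [Finite H]
variable {V W V' W' : Type} [AddCommGroup V] [Module ℂ V] [FiniteDimensional ℂ V]
  [AddCommGroup W] [Module ℂ W] [FiniteDimensional ℂ W]
  [AddCommGroup V'] [Module ℂ V'] [FiniteDimensional ℂ V']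
  [AddCommGroup W'] [Module ℂ W'] [FiniteDimensional ℂ W']

theorem finrank_intertwiningMap_eq [Fintype G] (ρ : Representation ℂ G V)
    (σ : Representation ℂ G W) :
    (finrank ℂ (IntertwiningMap ρ σ) : ℂ) =
      (Nat.card G : ℂ)⁻¹ * ∑ g : G, σ.character g * ρ.character g⁻¹ := by
  have : Invertible (Nat.card G : ℂ) :=
    invertibleOfNonzero (Nat.cast_ne_zero.mpr Nat.card_pos.ne')
  exact (card_inv_mul_sum_char_mul_char_eq_finrank ρ σ).symm

/-- Dimensions of spaces of intertwining maps are unchanged by field automorphisms and by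
relabelling the group. -/
theorem finrank_intertwiningMap_congr (s : ℂ ≃+* ℂ) (e : G ≃* H)
    (ρ : Representation ℂ H V) (σ : Representation ℂ H W)
    (ρ' : Representation ℂ G V') (σ' : Representation ℂ G W')
    (hρ : ∀ g, ρ'.character g = s (ρ.character (e g)))
    (hσ : ∀ g, σ'.character g = s (σ.character (e g))) :
    finrank ℂ (IntertwiningMap ρ' σ') = finrank ℂ (IntertwiningMap ρ σ) := by
  cases nonempty_fintype G
  cases nonempty_fintype H
  have h : (finrank ℂ (IntertwiningMap ρ' σ') : ℂ) = s (finrank ℂ (IntertwiningMap ρ σ)) := by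
    rw [finrank_intertwiningMap_eq, finrank_intertwiningMap_eq, map_mul, map_inv₀, map_natCast,
      Nat.card_congr e.toEquiv, _root_.map_sum]
    congr 1
    refine Fintype.sum_equiv e.toEquiv _ _ fun g => ?_
    simp [hρ, hσ]
  rw [map_natCast] at h
  exact_mod_cast h

theorem finrank_intertwiningMap_symm (ρ : Representation ℂ G V) (σ : Representation ℂ G W) :
    finrank ℂ (IntertwiningMap ρ σ) = finrank ℂ (IntertwiningMap σ ρ) := by
  cases nonempty_fintype G
  have h : (finrank ℂ (IntertwiningMap ρ σ) : ℂ) = finrank ℂ (IntertwiningMap σ ρ) := by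
    rw [finrank_intertwiningMap_eq, finrank_intertwiningMap_eq]
    congr 1
    refine Fintype.sum_equiv (Equiv.inv G) _ _ fun g => ?_
    simp [mul_comm]
  exact_mod_cast h

omit [Finite G] in
theorem finrank_intertwiningMap_pos {ρ : Representation ℂ G V} {σ : Representation ℂ G W} :
    0 < finrank ℂ (IntertwiningMap ρ σ) ↔ ∃ f : IntertwiningMap ρ σ, f ≠ 0 := by
  have : FiniteDimensional ℂ (IntertwiningMap ρ σ) :=
    Module.Finite.equiv (invariantsEquivIntertwiningMap ρ σ)
  rw [finrank_pos_iff, nontrivial_iff_exists_ne 0]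

theorem isIrreducible_iff_finrank_end (ρ : Representation ℂ G V) :
    IsIrreducible ρ ↔ finrank ℂ (IntertwiningMap ρ ρ) = 1 := by
  refine ⟨fun _ => IsIrreducible.finrank_intertwiningMap_self ρ, fun h => ?_⟩
  rw [irreducible_iff_isSimpleModule_asModule]
  have : IsSemisimpleModule (MonoidAlgebra ℂ G) ρ.asModule := inferInstance
  have hscal : ∀ f : Module.End (MonoidAlgebra ℂ G) ρ.asModule, ∃ c : ℂ, ∀ v, f v = c • v := by
    intro f
    have h1 : finrank ℂ (Module.End (MonoidAlgebra ℂ G) ρ.asModule) = 1 := by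
      rw [← h]; exact (IntertwiningMap.equivAlgEnd (ρ := ρ)).toLinearEquiv.finrank_eq.symm
    have hne : (1 : Module.End (MonoidAlgebra ℂ G) ρ.asModule) ≠ 0 := by
      intro h0
      have := subsingleton_of_zero_eq_one h0.symm
      simp [finrank_zero_of_subsingleton] at h1
    obtain ⟨c, hc⟩ := (finrank_eq_one_iff_of_nonzero' _ hne).1 h1 f
    exact ⟨c, fun v => by rw [← hc]; rfl⟩
  have hnt : Nontrivial ρ.asModule := by
    by_contra hs
    rw [not_nontrivial_iff_subsingleton] at hs
    have : Subsingleton V := hs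
    have : Subsingleton (IntertwiningMap ρ ρ) :=
      ⟨fun f g => IntertwiningMap.ext (LinearMap.ext fun v => Subsingleton.elim _ _)⟩
    simp [finrank_zero_of_subsingleton] at h
  refine { toNontrivial := inferInstance, eq_bot_or_eq_top := fun U => ?_ }
  obtain ⟨U', hU⟩ := exists_isCompl U
  obtain ⟨c, hc⟩ := hscal (U.projection U' hU)
  by_cases hc0 : c = 0
  · left
    refine (Submodule.eq_bot_iff _).2 fun x hx => ?_
    have := hc x
    rw [Submodule.projection_apply_left hU ⟨x, hx⟩] at this
    simpa [hc0] using this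
  · right
    refine eq_top_iff.2 fun x _ => ?_
    have h1 := hc x
    have h2 : c • x ∈ U := h1 ▸ Submodule.projection_apply_mem hU x
    have h3 : x = (algebraMap ℂ (MonoidAlgebra ℂ G) c⁻¹) • (c • x) := by
      rw [algebraMap_smul, inv_smul_smul₀ hc0]
    rw [h3]
    exact U.smul_mem _ h2

theorem IsIrreducible.of_character (s : ℂ ≃+* ℂ) (e : G ≃* H) {ρ : Representation ℂ H V}
    (hρ : IsIrreducible ρ) (ρ' : Representation ℂ G V')
    (h : ∀ g, ρ'.character g = s (ρ.character (e g))) : IsIrreducible ρ' := by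
  rw [isIrreducible_iff_finrank_end] at hρ ⊢
  rw [← hρ]
  exact finrank_intertwiningMap_congr s e _ _ _ _ h h

omit [Finite G] [FiniteDimensional ℂ V] [FiniteDimensional ℂ W] in
theorem nonempty_equiv_of_intertwiningMap {ρ : Representation ℂ G V} {σ : Representation ℂ G W}
    (hρ : IsIrreducible ρ) (hσ : IsIrreducible σ) (f : IntertwiningMap ρ σ) (hf : f ≠ 0) :
    Nonempty (Representation.Equiv ρ σ) :=
  ⟨f.ofBijective ((IsIrreducible.bijective_or_eq_zero f).resolve_right hf)⟩

theorem nonempty_equiv_of_character_eq {ρ : Representation ℂ G V} {σ : Representation ℂ G W}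
    (hρ : IsIrreducible ρ) (hσ : IsIrreducible σ) (h : ∀ g, ρ.character g = σ.character g) :
    Nonempty (Representation.Equiv ρ σ) := by
  have h1 := finrank_intertwiningMap_congr (RingEquiv.refl ℂ) (MulEquiv.refl G) ρ ρ ρ σ
    (by simp) (by simp [h])
  rw [(isIrreducible_iff_finrank_end ρ).1 hρ] at h1
  obtain ⟨f, hf⟩ := finrank_intertwiningMap_pos.1 (h1 ▸ Nat.one_pos)
  exact nonempty_equiv_of_intertwiningMap hρ hσ f hf

omit [Finite G] [FiniteDimensional ℂ V] in
theorem exists_equiv_fin (ρ : Representation ℂ G V) (n : ℕ) (b : V ≃ₗ[ℂ] (Fin n → ℂ)) :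
    ∃ τ : Representation ℂ G (Fin n → ℂ), ∀ g v, τ g (b v) = b (ρ g v) :=
  ⟨(b.conjAlgEquiv ℂ : _ →* _).comp ρ, fun g v => by simp [LinearEquiv.conjAlgEquiv_apply]⟩

/-- If a linear map does not vanish on a representation, it does not vanish on the image of some
irreducible representation. -/
theorem exists_isIrreducible_comp_ne_zero {Z : Type} [AddCommGroup Z] [Module ℂ Z]
    (ρ : Representation ℂ G V) (φ : V →ₗ[ℂ] Z) (hφ : φ ≠ 0) :
    ∃ (d : ℕ) (τ : Representation ℂ G (Fin d → ℂ)) (f : IntertwiningMap τ ρ),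
      IsIrreducible τ ∧ φ ∘ₗ f.toLinearMap ≠ 0 := by
  have hex : ∃ d : ℕ, ∃ (τ : Representation ℂ G (Fin d → ℂ)) (f : IntertwiningMap τ ρ),
      φ ∘ₗ f.toLinearMap ≠ 0 := by
    let b := (finBasis ℂ V).equivFun
    obtain ⟨τ, hτ⟩ := exists_equiv_fin ρ _ b
    refine ⟨_, τ, ⟨b.symm.toLinearMap, fun g => ?_⟩, fun h => hφ ?_⟩
    · refine LinearMap.ext fun v => ?_
      obtain ⟨u, rfl⟩ := b.surjective v
      simp [hτ]
    · ext v
      simpa using LinearMap.congr_fun h (b v)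
  obtain ⟨τ, f, hf⟩ := Nat.find_spec hex
  refine ⟨_, τ, f, ?_, hf⟩
  have key : ∀ U : Subrepresentation τ, (∃ u ∈ U.toSubmodule, φ (f u) ≠ 0) → U = ⊤ := by
    rintro U ⟨u, huU, hu⟩
    let b := (finBasis ℂ U.toSubmodule).equivFun
    obtain ⟨τ', hτ'⟩ := exists_equiv_fin U.toRepresentation _ b
    have hle := Nat.find_min' hex (m := finrank ℂ U.toSubmodule)
      ⟨τ', ⟨f.toLinearMap ∘ₗ U.toSubmodule.subtype ∘ₗ b.symm.toLinearMap, fun g => ?_⟩,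
        fun h => hu ?_⟩
    · have h1 : finrank ℂ U.toSubmodule = finrank ℂ (Fin (Nat.find hex) → ℂ) :=
        le_antisymm (Submodule.finrank_le _) (by simpa using hle)
      exact Subrepresentation.toSubmodule_injective (Submodule.eq_top_of_finrank_eq h1)
    · refine LinearMap.ext fun v => ?_
      obtain ⟨u', rfl⟩ := b.surjective v
      have h2 : (b.symm (τ' g (b u')) : Fin _ → ℂ) = τ g u' := by
        rw [hτ', b.symm_apply_apply]; rfl
      simp [h2, f.isIntertwining]
    · simpa using LinearMap.congr_fun h (b ⟨u, huU⟩)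
  have hne : ∃ u, φ (f u) ≠ 0 := by
    by_contra! h
    exact hf (LinearMap.ext h)
  obtain ⟨u, hu⟩ := hne
  have : Nontrivial (Subrepresentation τ) := by
    refine ⟨⊥, ⊤, fun h => hu ?_⟩
    have : u ∈ (⊥ : Subrepresentation τ).toSubmodule := by rw [h]; trivial
    rw [(Submodule.mem_bot ℂ).1 this]; simp
  refine { eq_bot_or_eq_top := fun U => ?_ }
  obtain ⟨U', hU⟩ := exists_isCompl U
  have hu' : u ∈ (U ⊔ U').toSubmodule := by rw [hU.sup_eq_top]; trivial
  obtain ⟨x, hx, y, hy, rfl⟩ := Submodule.mem_sup.1 hu'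
  by_cases h : φ (f x) = 0
  · left
    have := key U' ⟨y, hy, by simpa [h] using hu⟩
    simpa [this] using hU.inf_eq_bot
  · exact Or.inr (key U ⟨x, hx, h⟩)

end Characters

section Twist

variable {G : Type} [Group G]

/-- Applying a field automorphism to the matrix entries of a representation. -/
def Representation.twist {d : ℕ} (s : ℂ ≃+* ℂ) (ρ : Representation ℂ G (Fin d → ℂ)) :
    Representation ℂ G (Fin d → ℂ) where
  toFun g := Matrix.toLin' ((s : ℂ →+* ℂ).mapMatrix (LinearMap.toMatrix' (ρ g)))
  map_one' := by
    rw [map_one, Module.End.one_eq_id, LinearMap.toMatrix'_id, map_one, Matrix.toLin'_one]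
  map_mul' g h := by
    rw [map_mul, Module.End.mul_eq_comp, LinearMap.toMatrix'_comp, map_mul, Matrix.toLin'_mul]
    rfl

theorem Representation.twist_apply {d : ℕ} (s : ℂ ≃+* ℂ) (ρ : Representation ℂ G (Fin d → ℂ))
    (g : G) : ρ.twist s g = Matrix.toLin' ((s : ℂ →+* ℂ).mapMatrix (LinearMap.toMatrix' (ρ g))) :=
  rfl

theorem Representation.character_twist {d : ℕ} (s : ℂ ≃+* ℂ)
    (ρ : Representation ℂ G (Fin d → ℂ)) (g : G) :
    (ρ.twist s).character g = s (ρ.character g) := by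
  rw [character, twist_apply, Matrix.trace_toLin'_eq, character,
    ← LinearMap.toMatrix'_toLin' (LinearMap.toMatrix' (ρ g)),
    Matrix.toLin'_toMatrix', LinearMap.trace_eq_matrix_trace ℂ (Pi.basisFun ℂ (Fin d)) (ρ g)]
  simp [Matrix.trace, LinearMap.toMatrix_eq_toMatrix']

theorem Representation.det_twist {d : ℕ} (s : ℂ ≃+* ℂ)
    (ρ : Representation ℂ G (Fin d → ℂ)) (g : G) :
    LinearMap.det (ρ.twist s g) = s (LinearMap.det (ρ g)) := by
  rw [twist_apply, LinearMap.det_toLin', ← RingHom.map_det, LinearMap.det_toMatrix']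
  rfl

end Twist

section FiniteOrder

variable {V : Type} [AddCommGroup V] [Module ℂ V] [FiniteDimensional ℂ V]

/-- The trace of an endomorphism of finite order is a sum of roots of unity. -/
theorem trace_mem_of_pow_eq_one {S : Type} [SetLike S ℂ] [AddSubmonoidClass S ℂ] (A : S)
    (f : V →ₗ[ℂ] V) (n : ℕ) (hf : f ^ n = 1) (hA : ∀ x : ℂ, x ^ n = 1 → x ∈ A) :
    LinearMap.trace ℂ V f ∈ A := by
  rw [Module.End.trace_eq_sum_roots_charpoly_of_splits (IsAlgClosed.splits _)]
  refine multiset_sum_mem _ fun x hx => hA x ?_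
  have hx' : Module.End.HasEigenvalue f x := by
    rw [Module.End.hasEigenvalue_iff_isRoot_charpoly]
    exact (Polynomial.mem_roots'.1 hx).2
  obtain ⟨v, hv⟩ := hx'.exists_hasEigenvector
  have h1 := hv.pow_apply n
  rw [hf] at h1
  have h2 : (x ^ n - 1) • v = 0 := by rw [sub_smul, ← h1]; simp
  exact sub_eq_zero.1 ((smul_eq_zero.1 h2).resolve_right hv.2)

variable {G : Type} [Group G]

theorem pow_eq_one_mem_Qfield {p : ℕ} {k : ℕ} {x : ℂ} (hx : x ^ p ^ k = 1) : x ∈ Qfield p := by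
  refine Subfield.subset_closure ⟨k + 1, k.succ_pos, ?_⟩
  rw [pow_succ, pow_mul, hx, one_pow]

theorem character_mem_Qfield {p : ℕ} (ρ : Representation ℂ G V) {g : G} {k : ℕ}
    (hg : g ^ p ^ k = 1) : ρ.character g ∈ Qfield p :=
  trace_mem_of_pow_eq_one (Qfield p) (ρ g) (p ^ k) (by rw [← map_pow, hg, map_one])
    fun _ hx => pow_eq_one_mem_Qfield hx

theorem isIntegral_character [Finite G] (ρ : Representation ℂ G V) (g : G) :
    IsIntegral ℤ (ρ.character g) :=
  trace_mem_of_pow_eq_one (integralClosure ℤ ℂ) (ρ g) (orderOf g)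
    (by rw [← map_pow, pow_orderOf_eq_one, map_one])
    fun x hx => IsIntegral.of_pow (orderOf_pos g) (by rw [hx]; exact isIntegral_one)

end FiniteOrder

section Galois

/-- An algebraic number fixed by all automorphisms of `ℂ` over a subfield lies in that subfield. -/
theorem mem_of_fixed (F : Subfield ℂ) (x : ℂ) (hx : IsIntegral ℤ x)
    (h : ∀ s : ℂ ≃+* ℂ, (∀ y ∈ F, s y = y) → s x = x) : x ∈ F := by
  let Ω := algebraicClosure F ℂ
  have hxΩ : x ∈ Ω := by
    rw [mem_algebraicClosure_iff]
    have : IsIntegral F x := hx.tower_top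
    exact this.isAlgebraic
  have : IsAlgClosure F Ω := inferInstance
  have : IsGalois F Ω := inferInstance
  have hbot : (⟨x, hxΩ⟩ : Ω) ∈ (⊥ : IntermediateField F Ω) := by
    rw [InfiniteGalois.mem_bot_iff_fixed]
    intro τ
    obtain ⟨ι, v, hv⟩ := exists_isTranscendenceBasis' Ω ℂ
    have := IsAlgClosed.isAlgClosure_of_transcendence_basis v hv
    let e : Algebra.adjoin Ω (Set.range v) ≃+* Algebra.adjoin Ω (Set.range v) :=
      hv.1.aevalEquiv.symm.toRingEquiv.trans
        ((MvPolynomial.mapEquiv ι τ.toRingEquiv).trans hv.1.aevalEquiv.toRingEquiv)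
    have he : ∀ y : Ω, e (algebraMap Ω _ y) = algebraMap Ω _ (τ y) := by
      intro y
      have h1 : hv.1.aevalEquiv.symm (algebraMap Ω _ y) = MvPolynomial.C y := by
        rw [AlgEquiv.commutes]; rfl
      have h2 : hv.1.aevalEquiv (MvPolynomial.C (τ y)) = algebraMap Ω _ (τ y) := by
        rw [← MvPolynomial.algebraMap_eq, AlgEquiv.commutes]
      change hv.1.aevalEquiv (MvPolynomial.map _ (hv.1.aevalEquiv.symm (algebraMap Ω _ y))) = _
      rw [h1, MvPolynomial.map_C]
      exact h2
    let s := IsAlgClosure.equivOfEquiv ℂ ℂ e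
    have hs : ∀ y : Ω, s y = τ y := fun y => by
      have := IsAlgClosure.equivOfEquiv_algebraMap ℂ ℂ e (algebraMap Ω _ y)
      rw [he] at this
      exact this
    have h3 := h s fun y hy => by
      have := hs (algebraMap F Ω ⟨y, hy⟩)
      rw [AlgEquiv.commutes] at this
      exact this
    exact Subtype.ext ((hs ⟨x, hxΩ⟩).symm.trans h3)
  obtain ⟨y, hy⟩ := IntermediateField.mem_bot.1 hbot
  have h2 : (y : ℂ) = x := congrArg Subtype.val hy
  exact h2 ▸ y.2

end Galois

section Schur

variable {G : Type} [Group G] {V : Type} [AddCommGroup V] [Module ℂ V] [FiniteDimensional ℂ V]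
  {ρ : Representation ℂ G V}

theorem exists_eq_smul_of_commute (hρ : IsIrreducible ρ) (A : V →ₗ[ℂ] V)
    (h : ∀ g v, A (ρ g v) = ρ g (A v)) : ∃ c : ℂ, ∀ v, A v = c • v := by
  obtain ⟨c, hc⟩ := (IsIrreducible.algebraMap_intertwiningMap_bijective_of_isAlgClosed
    (ρ := ρ)).2 ⟨A, fun g => LinearMap.ext (h g)⟩
  exact ⟨c, fun v => (congrArg (fun f : IntertwiningMap ρ ρ => f v) hc).symm⟩

/-- Burnside's density theorem. -/
theorem exists_eq_sum_smul [Fintype G] (hρ : IsIrreducible ρ) (A : V →ₗ[ℂ] V) :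
    ∃ c : G → ℂ, A = ∑ g, c g • ρ g := by
  have : IsSimpleModule (MonoidAlgebra ℂ G) ρ.asModule :=
    (irreducible_iff_isSimpleModule_asModule ρ).1 hρ
  have : FiniteDimensional ℂ ρ.asModule := inferInstanceAs (FiniteDimensional ℂ V)
  let A' : Module.End (Module.End (MonoidAlgebra ℂ G) ρ.asModule) ρ.asModule :=
    { toFun := A
      map_add' := fun x y => A.map_add x y
      map_smul' := fun f x => by
        obtain ⟨c, rfl⟩ := (IsSimpleModule.algebraMap_end_bijective_of_isAlgClosed
          (A := MonoidAlgebra ℂ G) (V := ρ.asModule) ℂ).2 f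
        exact A.map_smul c x }
  let b := finBasis ℂ V
  obtain ⟨r, hr⟩ := jacobson_density A' (Finset.image (fun i => (b i : ρ.asModule)) Finset.univ)
  refine ⟨fun g => MonoidAlgebra.coeff r g, b.ext fun i => ?_⟩
  have h1 : A (b i) = ρ.asAlgebraHom r (b i) := hr (b i) (Finset.mem_image_of_mem _ (Finset.mem_univ i))
  rw [h1, asAlgebraHom_def, MonoidAlgebra.lift_apply, Finsupp.sum_fintype _ _ (by simp)]

end Schur

section Degree

variable {G : Type} [Group G] [Finite G] {V : Type} [AddCommGroup V] [Module ℂ V]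
  [FiniteDimensional ℂ V] {ρ : Representation ℂ G V}

/-- The degree of an irreducible representation divides the order of the group. -/
theorem finrank_dvd_card (hρ : IsIrreducible ρ) : finrank ℂ V ∣ Nat.card G := by
  cases nonempty_fintype G
  let O := integralClosure ℤ ℂ
  let z : MonoidAlgebra O G :=
    ∑ g : G, MonoidAlgebra.single g ⟨ρ.character g⁻¹, isIntegral_character ρ g⁻¹⟩
  let φ : MonoidAlgebra O G →+* Module.End ℂ V :=
    (ρ.asAlgebraHom : _ →+* _).comp (MonoidAlgebra.mapRingHom G (algebraMap O ℂ))
  have hz : φ z = ∑ g : G, ρ.character g⁻¹ • ρ g := by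
    simp [φ, z, map_sum, asAlgebraHom_single]
  have hint : IsIntegral ℤ (φ z) := by
    have h1 : IsIntegral O z := IsIntegral.of_finite O z
    have h2 : IsIntegral ℤ z := isIntegral_trans z h1
    exact h2.map φ.toIntAlgHom
  obtain ⟨c, hc⟩ := exists_eq_smul_of_commute hρ (φ z) (by
    intro g v
    rw [hz]
    simp only [LinearMap.sum_apply, LinearMap.smul_apply, map_sum, map_smul]
    refine Fintype.sum_equiv (MulAut.conj g⁻¹).toEquiv _ _ fun x => ?_
    have h1 : ρ.character (g⁻¹ * x * g)⁻¹ = ρ.character x⁻¹ := by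
      have := char_conj ρ x⁻¹ g⁻¹
      simpa [mul_assoc] using this
    simp only [MulEquiv.toEquiv_eq_coe, MulEquiv.coe_toEquiv, MulAut.conj_apply, inv_inv, h1,
      ← Module.End.mul_apply, ← map_mul]
    group)
  have hc' : φ z = algebraMap ℂ (Module.End ℂ V) c := LinearMap.ext fun v => by
    rw [hc, Module.algebraMap_end_apply]
  have : Nontrivial V := by
    have := (irreducible_iff_isSimpleModule_asModule ρ).1 hρ
    exact IsSimpleModule.nontrivial (MonoidAlgebra ℂ G) ρ.asModule
  have hci : IsIntegral ℤ c := by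
    rw [hc'] at hint
    exact (isIntegral_algebraMap_iff (algebraMap ℂ (Module.End ℂ V)).injective).1 hint
  have htr : c * finrank ℂ V = Nat.card G := by
    have h1 := finrank_intertwiningMap_eq ρ ρ
    rw [(isIrreducible_iff_finrank_end ρ).1 hρ] at h1
    have hG : (Nat.card G : ℂ) ≠ 0 := Nat.cast_ne_zero.mpr Nat.card_pos.ne'
    have h2 : LinearMap.trace ℂ V (φ z) = Nat.card G := by
      rw [hz, map_sum]
      field_simp at h1
      rw [Nat.cast_one, one_mul] at h1
      rw [h1]
      refine Finset.sum_congr rfl fun g _ => ?_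
      rw [map_smul, smul_eq_mul, mul_comm]; rfl
    rw [← h2, hc', Algebra.algebraMap_eq_smul_one, map_smul, LinearMap.trace_one, smul_eq_mul]
  have hd : (finrank ℂ V : ℂ) ≠ 0 := Nat.cast_ne_zero.mpr finrank_pos.ne'
  have hq : c = algebraMap ℚ ℂ ((Nat.card G : ℚ) / finrank ℂ V) := by
    rw [eq_div_of_mul_eq hd htr]; simp
  rw [hq, isIntegral_algebraMap_iff (algebraMap ℚ ℂ).injective] at hci
  obtain ⟨m, hm⟩ := IsIntegrallyClosed.isIntegral_iff.1 hci
  have hd' : (finrank ℂ V : ℚ) ≠ 0 := Nat.cast_ne_zero.mpr finrank_pos.ne'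
  rw [eq_div_iff hd'] at hm
  have h3 : (Nat.card G : ℤ) = finrank ℂ V * m := by
    have : (m : ℚ) * finrank ℂ V = Nat.card G := hm
    rw [mul_comm]
    exact_mod_cast this.symm
  exact Int.natCast_dvd_natCast.1 ⟨m, h3⟩

end Degree

section Solvable

variable {G : Type} [Group G] [Finite G]

/-- A nontrivial normal subgroup of a solvable group contains a nontrivial normal subgroup of
prime power order. -/
theorem exists_normal_isPGroup_le [Group.IsSolvable G] (K : Subgroup G) [K.Normal] (hK : K ≠ ⊥) :
    ∃ q : ℕ, q.Prime ∧ ∃ Q : Subgroup G, Q.Normal ∧ Q ≠ ⊥ ∧ Q ≤ K ∧ IsPGroup q Q := by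
  let D : ℕ → Subgroup G := Nat.rec (motive := fun _ => Subgroup G) K fun _ H => ⁅H, H⁆
  have hD : ∀ n, (D n).Normal ∧ D n ≤ K ∧ D n ≤ derivedSeries G n := by
    intro n
    induction n with
    | zero => exact ⟨‹K.Normal›, le_rfl, le_top⟩
    | succ n ih =>
      obtain ⟨h1, h2, h3⟩ := ih
      exact ⟨Subgroup.commutator_normal _ _, (Subgroup.commutator_le_left _ _).trans h2,
        Subgroup.commutator_mono h3 h3⟩
  have hex : ∃ n, D n = ⊥ := by
    obtain ⟨n, hn⟩ := Group.IsSolvable.solvable (G := G)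
    exact ⟨n, le_bot_iff.1 (hn ▸ (hD n).2.2)⟩
  obtain ⟨n, hA0, hA1⟩ : ∃ n, D n ≠ ⊥ ∧ ⁅D n, D n⁆ = ⊥ := by
    by_contra! h
    obtain ⟨n, hn⟩ := hex
    exact Nat.rec (motive := fun n => D n ≠ ⊥) hK h n hn
  have hcomm : ∀ x ∈ D n, ∀ y ∈ D n, x * y = y * x := fun x hx y hy =>
    (Subgroup.mem_centralizer_iff.1 (Subgroup.commutator_eq_bot_iff_le_centralizer.1 hA1 hx) y hy).symm
  have hAn := (hD n).1
  have hnt : Nontrivial ↥(D n) := (Subgroup.nontrivial_iff_ne_bot _).2 hA0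
  obtain ⟨q, hq, hqd⟩ := Nat.exists_prime_and_dvd (Finite.one_lt_card_iff_nontrivial.2 hnt).ne'
  have := Fact.mk hq
  obtain ⟨x, hx⟩ := exists_prime_orderOf_dvd_card' q hqd
  let Q : Subgroup G :=
    { carrier := {x | x ∈ D n ∧ x ^ q = 1}
      one_mem' := ⟨one_mem _, one_pow _⟩
      mul_mem' := fun {a b} ha hb => ⟨mul_mem ha.1 hb.1, by
        rw [Commute.mul_pow (hcomm a ha.1 b hb.1), ha.2, hb.2, one_mul]⟩
      inv_mem' := fun {a} ha => ⟨inv_mem ha.1, by rw [inv_pow, ha.2, inv_one]⟩ }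
  refine ⟨q, hq, Q, ⟨fun a ha g => ⟨hAn.conj_mem a ha.1 g, ?_⟩⟩, fun h => ?_,
    fun a ha => (hD n).2.1 ha.1, fun a => ⟨1, ?_⟩⟩
  · rw [conj_pow, ha.2, mul_one, mul_inv_cancel]
  · have h1 : (x : G) ∈ Q := ⟨x.2, by
      rw [← hx]
      exact congrArg Subtype.val (pow_orderOf_eq_one x)⟩
    rw [h, Subgroup.mem_bot] at h1
    have h2 : x = 1 := OneMemClass.coe_eq_one.1 h1
    rw [h2, orderOf_one] at hx
    exact hq.one_lt.ne hx
  · rw [pow_one]; exact Subtype.ext a.2.2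

end Solvable

section Clifford

variable {N M T : Type} [Group N] [Group M] [Group T] [Finite N] [Finite M] [Finite T]
variable {V W X Z : Type} [AddCommGroup V] [Module ℂ V] [FiniteDimensional ℂ V]
  [AddCommGroup W] [Module ℂ W] [FiniteDimensional ℂ W]
  [AddCommGroup X] [Module ℂ X] [FiniteDimensional ℂ X]
  [AddCommGroup Z] [Module ℂ Z]

/-- `Over ι ρ σ` says that the irreducible representation `ρ` occurs in the restriction of `σ`
along `ι`. -/
def Over (ι : N →* M) (ρ : Representation ℂ N V) (σ : Representation ℂ M W) : Prop :=
  ∃ f : IntertwiningMap ρ (σ.comp ι), f ≠ 0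

omit [Finite N] [Finite M] [Finite T] [FiniteDimensional ℂ V] [FiniteDimensional ℂ W]
  [FiniteDimensional ℂ X] in
theorem Over.trans {j : N →* M} {κ : M →* T} {ρ : Representation ℂ N V}
    {σ : Representation ℂ M W} {τ : Representation ℂ T X} (hσ : IsIrreducible σ)
    (h : Over j ρ σ) (h' : Over κ σ τ) : Over (κ.comp j) ρ τ := by
  obtain ⟨f, hf⟩ := h
  obtain ⟨g, hg⟩ := h'
  have hinj := (IsIrreducible.injective_or_eq_zero g).resolve_right hg
  refine ⟨⟨g.toLinearMap ∘ₗ f.toLinearMap, fun n => LinearMap.ext fun v => ?_⟩, fun h => hf ?_⟩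
  · have h1 := IntertwiningMap.isIntertwining _ _ f n v
    have h2 := IntertwiningMap.isIntertwining _ _ g (j n) (f v)
    exact (congrArg g h1).trans h2
  · refine IntertwiningMap.ext (LinearMap.ext fun v => hinj ?_)
    have := congrArg (fun k : IntertwiningMap ρ (τ.comp (κ.comp j)) => k v) h
    exact this.trans (map_zero g).symm

omit [Finite N] [Finite M] in
theorem Over.symm {ι : N →* M} {ρ : Representation ℂ N V} {σ : Representation ℂ M W} [Finite N]
    (h : Over ι ρ σ) : ∃ f : IntertwiningMap (σ.comp ι) ρ, f ≠ 0 := by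
  have h1 := finrank_intertwiningMap_pos.2 h
  rw [finrank_intertwiningMap_symm] at h1
  exact finrank_intertwiningMap_pos.1 h1

omit [Finite N] [FiniteDimensional ℂ V] in
theorem IsIrreducible.nontrivial_space {ρ : Representation ℂ N V} (hρ : IsIrreducible ρ) :
    Nontrivial V := by
  have := (irreducible_iff_isSimpleModule_asModule ρ).1 hρ
  exact IsSimpleModule.nontrivial (MonoidAlgebra ℂ N) ρ.asModule

/-- The representation of `T` on functions `T → V` by left translation. -/
def translationRep (T V : Type) [Group T] [AddCommGroup V] [Module ℂ V] :
    Representation ℂ T (T → V) where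
  toFun t := LinearMap.funLeft ℂ V fun x => t⁻¹ * x
  map_one' := by ext; simp [LinearMap.funLeft]
  map_mul' s t := by ext; simp [LinearMap.funLeft, mul_assoc]

theorem exists_over (ι : N →* T) (hι : Function.Injective ι) {ρ : Representation ℂ N V}
    (hρ : IsIrreducible ρ) :
    ∃ (d : ℕ) (τ : Representation ℂ T (Fin d → ℂ)), IsIrreducible τ ∧ Over ι ρ τ := by
  cases nonempty_fintype N
  have := IsIrreducible.nontrivial_space hρ
  let φ : (T → V) →ₗ[ℂ] V := ∑ n : N, ρ n ∘ₗ LinearMap.proj (ι n)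
  have hφ : φ ≠ 0 := by
    obtain ⟨v, hv⟩ := exists_ne (0 : V)
    intro h
    have h1 := LinearMap.congr_fun h (Pi.single 1 v)
    simp only [φ, LinearMap.sum_apply, LinearMap.comp_apply, LinearMap.proj_apply,
      LinearMap.zero_apply] at h1
    rw [Finset.sum_eq_single 1] at h1
    · simp [hv] at h1
    · intro n _ hn
      rw [Pi.single_eq_of_ne, map_zero]
      exact fun h => hn (hι (h.trans (map_one ι).symm))
    · simp
  obtain ⟨d, τ, f, hτ, hf⟩ := exists_isIrreducible_comp_ne_zero (translationRep T V) φ hφ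
  refine ⟨d, τ, hτ, ?_⟩
  have hφm : ∀ (m : N) (u : T → V), φ (translationRep T V (ι m) u) = ρ m (φ u) := by
    intro m u
    simp only [φ, LinearMap.sum_apply, LinearMap.comp_apply, LinearMap.proj_apply, map_sum]
    refine Fintype.sum_equiv (Equiv.mulLeft m⁻¹) _ _ fun n => ?_
    rw [Equiv.coe_mulLeft, ← Module.End.mul_apply, ← map_mul, mul_inv_cancel_left, map_mul,
      map_inv]
    rfl
  let g : IntertwiningMap (τ.comp ι) ρ := ⟨φ ∘ₗ f.toLinearMap, fun n => LinearMap.ext fun v =>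
    (congrArg φ (IntertwiningMap.isIntertwining _ _ f (ι n) v)).trans (hφm n (f v))⟩
  have hg : g ≠ 0 := fun h => hf (congrArg IntertwiningMap.toLinearMap h)
  have h1 := finrank_intertwiningMap_pos.2 ⟨g, hg⟩
  rw [finrank_intertwiningMap_symm] at h1
  exact finrank_intertwiningMap_pos.1 h1

omit [Finite N] [Finite M] in
theorem exists_conj_equiv (ι : N →* M) (hι : Function.Injective ι) (hn : ι.range.Normal) (m : M) :
    ∃ α : N ≃* N, ∀ n, ι (α n) = m * ι n * m⁻¹ := by
  let e := MonoidHom.ofInjective hι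
  refine ⟨(e.trans (MulAut.conjNormal m)).trans e.symm, fun n => ?_⟩
  have : (e (e.symm (MulAut.conjNormal m (e n))) : M) = m * ι n * m⁻¹ := by
    rw [MulEquiv.apply_symm_apply, MulAut.conjNormal_apply]; rfl
  exact this

omit [Finite M] [FiniteDimensional ℂ W] in
theorem iSup_range_eq_top (ι : N →* M) (hι : Function.Injective ι) (hn : ι.range.Normal)
    {ρ : Representation ℂ N V} (hρ : IsIrreducible ρ)
    (hinv : ∀ m n n', ι n' = m * ι n * m⁻¹ → ρ.character n' = ρ.character n)
    {σ : Representation ℂ M W} (hσ : IsIrreducible σ) (h : Over ι ρ σ) :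
    ⨆ f : IntertwiningMap ρ (σ.comp ι), LinearMap.range f.toLinearMap = ⊤ := by
  have hstable : ∀ m (f : IntertwiningMap ρ (σ.comp ι)), LinearMap.range f.toLinearMap ≤
      Submodule.comap (σ m) (⨆ f : IntertwiningMap ρ (σ.comp ι), LinearMap.range f.toLinearMap) := by
    intro m f
    obtain ⟨α, hα⟩ := exists_conj_equiv ι hι hn m⁻¹
    have hα' : ∀ n, ρ.character (α n) = ρ.character n := fun n => hinv m⁻¹ n (α n) (hα n)
    have hρ' : IsIrreducible (ρ.comp (α : N →* N)) :=
      IsIrreducible.of_character (RingEquiv.refl ℂ) α hρ _ fun n => rfl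
    obtain ⟨β⟩ := nonempty_equiv_of_character_eq hρ hρ' fun n => (hα' n).symm
    have hβ : ∀ n v, β (ρ n v) = ρ (α n) (β v) := fun n v =>
      IntertwiningMap.isIntertwining _ _ β.toIntertwiningMap n v
    have hf : ∀ n v, f (ρ n v) = σ (ι n) (f v) := IntertwiningMap.isIntertwining _ _ f
    let f' : IntertwiningMap ρ (σ.comp ι) :=
      ⟨σ m ∘ₗ f.toLinearMap ∘ₗ β.toLinearEquiv.toLinearMap, fun n => LinearMap.ext fun v => by
        change σ m (f (β (ρ n v))) = σ (ι n) (σ m (f (β v)))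
        rw [hβ, hf, hα, ← Module.End.mul_apply, ← Module.End.mul_apply, ← map_mul, ← map_mul]
        congr 2
        group⟩
    rintro _ ⟨v, rfl⟩
    refine Submodule.mem_iSup_of_mem f' ⟨β.toLinearEquiv.symm v, ?_⟩
    change σ m (f (β.toLinearEquiv (β.toLinearEquiv.symm v))) = σ m (f v)
    rw [LinearEquiv.apply_symm_apply]
  let U : Subrepresentation σ :=
    { toSubmodule := ⨆ f : IntertwiningMap ρ (σ.comp ι), LinearMap.range f.toLinearMap
      apply_mem_toSubmodule := fun m w hw => iSup_le (hstable m) hw }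
  obtain hU | hU := IsSimpleOrder.eq_bot_or_eq_top (self := hσ) U
  · obtain ⟨f, hf⟩ := h
    refine absurd (IntertwiningMap.ext (LinearMap.ext fun v => ?_)) hf
    have h1 : f v ∈ U.toSubmodule := Submodule.mem_iSup_of_mem f ⟨v, rfl⟩
    rw [hU] at h1
    exact (Submodule.mem_bot ℂ).1 h1
  · exact congrArg Subrepresentation.toSubmodule hU

omit [Finite M] in
theorem exists_linearEquiv_pi (ι : N →* M) (hι : Function.Injective ι) (hn : ι.range.Normal)
    {ρ : Representation ℂ N V} (hρ : IsIrreducible ρ)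
    (hinv : ∀ m n n', ι n' = m * ι n * m⁻¹ → ρ.character n' = ρ.character n)
    {σ : Representation ℂ M W} (hσ : IsIrreducible σ) (h : Over ι ρ σ) :
    ∃ (e : ℕ) (Φ : W ≃ₗ[ℂ] (Fin e → V)), ∀ n w i, Φ (σ (ι n) w) i = ρ n (Φ w i) := by
  have htop := iSup_range_eq_top ι hι hn hρ hinv hσ h
  let σ' : Representation ℂ N W := σ.comp ι
  have : IsSimpleModule (MonoidAlgebra ℂ N) ρ.asModule :=
    (irreducible_iff_isSimpleModule_asModule ρ).1 hρ
  have hiso : IsIsotypicOfType (MonoidAlgebra ℂ N) σ'.asModule ρ.asModule := by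
    intro m hm
    obtain ⟨m', hm'⟩ := exists_isCompl m
    let p := m.projectionOnto m' hm'
    have hp : ∃ f : IntertwiningMap ρ σ', p ∘ₗ IntertwiningMap.equivLinearMapAsModule _ _ f ≠ 0 := by
      by_contra! h0
      have h1 : ⨆ f : IntertwiningMap ρ σ', LinearMap.range f.toLinearMap ≤
          LinearMap.ker (p.restrictScalars ℂ) := by
        refine iSup_le fun f => ?_
        rintro _ ⟨v, rfl⟩
        exact LinearMap.congr_fun (h0 f) v
      have h2 : ∀ w, p w = 0 := fun w => h1 (htop.ge (Submodule.mem_top (x := w)))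
      obtain ⟨x, hx⟩ := @exists_ne m (IsSimpleModule.nontrivial (MonoidAlgebra ℂ N) m) 0
      exact hx ((Submodule.projectionOnto_apply_left hm' x).symm.trans (h2 x))
    obtain ⟨f, hf⟩ := hp
    exact ⟨(LinearEquiv.ofBijective _ (LinearMap.bijective_of_ne_zero hf)).symm⟩
  have : Module.Finite (MonoidAlgebra ℂ N) σ'.asModule :=
    have : Module.Finite ℂ σ'.asModule := inferInstanceAs (Module.Finite ℂ W)
    Module.Finite.of_restrictScalars_finite ℂ _ _
  obtain ⟨e, ⟨Φ⟩⟩ := hiso.linearEquiv_fun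
  refine ⟨e, Φ.restrictScalars ℂ, fun n w i => ?_⟩
  let w' : σ'.asModule := w
  have h1 := congrFun (Φ.map_smul (MonoidAlgebra.single n 1) w') i
  have h2 : (MonoidAlgebra.single n (1 : ℂ) • w' : σ'.asModule) = σ (ι n) w :=
    (single_smul σ' 1 n w).trans (one_smul ℂ _)
  have h3 : (MonoidAlgebra.single n (1 : ℂ) • Φ w' i : ρ.asModule) = ρ n (Φ w i) :=
    (single_smul ρ 1 n _).trans (one_smul ℂ _)
  rw [h2] at h1
  exact h1.trans h3

omit [FiniteDimensional ℂ X] in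
/-- Uniqueness in Clifford's correspondence. -/
theorem nonempty_equiv_of_over_stabilizer {I : Subgroup T} (j : N →* I)
    (hj : Function.Injective j) (hn : (I.subtype.comp j).range.Normal)
    {ρ : Representation ℂ N V} (hρ : IsIrreducible ρ)
    (hI : ∀ t, t ∈ I ↔ ∀ n n', (j n' : T) = t * j n * t⁻¹ → ρ.character n' = ρ.character n)
    {σ : Representation ℂ I W} (hσ : IsIrreducible σ) (hρσ : Over j ρ σ)
    {τ : Representation ℂ T X} (hτ : IsIrreducible τ) (h : Over I.subtype σ τ)
    {Y : Type} [AddCommGroup Y] [Module ℂ Y] [FiniteDimensional ℂ Y]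
    {τ' : Representation ℂ T Y} (hτ' : IsIrreducible τ') (h' : Over I.subtype σ τ') :
    Nonempty (Representation.Equiv τ τ') := by
  cases nonempty_fintype T
  have hnj : j.range.Normal := by
    refine ⟨?_⟩
    rintro _ ⟨n, rfl⟩ x
    obtain ⟨n', hn'⟩ := hn.conj_mem _ ⟨n, rfl⟩ (x : T)
    exact ⟨n', Subtype.ext hn'⟩
  obtain ⟨e, Φ, hΦ⟩ := exists_linearEquiv_pi j hj hnj hρ
    (fun m n n' hm => (hI m).1 m.2 n n' (congrArg Subtype.val hm)) hσ hρσ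
  obtain ⟨f, hf0⟩ := h
  obtain ⟨f', hf0'⟩ := h'
  have hfinj := (IsIrreducible.injective_or_eq_zero f).resolve_right hf0
  obtain ⟨r, hr⟩ : ∃ r : IntertwiningMap (τ.comp I.subtype) σ, ∀ w, r (f w) = w := by
    obtain ⟨r, hr⟩ := IsSemisimpleModule.extension_property
      (IntertwiningMap.equivLinearMapAsModule _ _ f) hfinj LinearMap.id
    refine ⟨(IntertwiningMap.equivLinearMapAsModule _ _).symm r, fun w => LinearMap.congr_fun hr w⟩
  have hf : ∀ (x : I) w, f (σ x w) = τ x (f w) := IntertwiningMap.isIntertwining _ _ f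
  have hf' : ∀ (x : I) w, f' (σ x w) = τ' x (f' w) := IntertwiningMap.isIntertwining _ _ f'
  have hrI : ∀ (x : I) w, r (τ x w) = σ x (r w) := IntertwiningMap.isIntertwining _ _ r
  have hzero : ∀ t ∉ I, ∀ w, r (τ t⁻¹ (f w)) = 0 := by
    intro t ht w
    by_contra hw
    obtain ⟨α, hα⟩ := exists_conj_equiv (I.subtype.comp j)
      (Subtype.val_injective.comp hj) hn t⁻¹
    have hα' : ∀ n, (j (α n) : T) = t⁻¹ * j n * t := fun n => by simpa using hα n
    let A : W →ₗ[ℂ] W := r.toLinearMap ∘ₗ τ t⁻¹ ∘ₗ f.toLinearMap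
    have hA : ∀ n w, A (σ (j n) w) = σ (j (α n)) (A w) := by
      intro n w
      change r (τ t⁻¹ (f (σ (j n) w))) = σ (j (α n)) (r (τ t⁻¹ (f w)))
      rw [hf, ← hrI, hα', ← Module.End.mul_apply, ← Module.End.mul_apply, ← map_mul, ← map_mul]
      group
    let B : ∀ i k : Fin e, V →ₗ[ℂ] V := fun i k =>
      LinearMap.proj k ∘ₗ Φ.toLinearMap ∘ₗ A ∘ₗ Φ.symm.toLinearMap ∘ₗ LinearMap.single ℂ (fun _ => V) i
    have hB : ∀ i k n v, B i k (ρ n v) = ρ (α n) (B i k v) := by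
      intro i k n v
      have h1 : Φ.symm (Pi.single i (ρ n v)) = σ (j n) (Φ.symm (Pi.single i v)) := by
        rw [LinearEquiv.symm_apply_eq]
        funext l
        rw [hΦ, LinearEquiv.apply_symm_apply]
        by_cases hl : l = i
        · subst hl; simp
        · simp [hl]
      change Φ (A (Φ.symm (Pi.single i (ρ n v)))) k = ρ (α n) (Φ (A (Φ.symm (Pi.single i v))) k)
      rw [h1, hA, hΦ]
    have hB0 : ∃ i k, B i k ≠ 0 := by
      by_contra! h0
      have hA0 : A ∘ₗ Φ.symm.toLinearMap = 0 := by
        refine LinearMap.pi_ext' fun i => LinearMap.ext fun v => Φ.injective (funext fun k => ?_)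
        have := LinearMap.congr_fun (h0 i k) v
        simpa [B] using this
      exact hw (by simpa [A] using LinearMap.congr_fun hA0 (Φ w))
    obtain ⟨i, k, hik⟩ := hB0
    have hρ' : IsIrreducible (ρ.comp (α : N →* N)) :=
      IsIrreducible.of_character (RingEquiv.refl ℂ) α hρ _ fun n => rfl
    obtain ⟨β⟩ := nonempty_equiv_of_intertwiningMap (σ := ρ.comp (α : N →* N)) hρ hρ'
      ⟨B i k, fun n => LinearMap.ext (hB i k n)⟩
      fun h0 => hik (congrArg IntertwiningMap.toLinearMap h0)
    have hchar : ∀ n, ρ.character n = ρ.character (α n) := fun n => congrFun (char_iso β) n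
    refine ht (inv_inv t ▸ I.inv_mem ((hI t⁻¹).2 fun n n' hnn => ?_))
    rw [inv_inv, ← hα'] at hnn
    rw [hj (Subtype.ext hnn), hchar n]
  let F : X →ₗ[ℂ] Y := ∑ t : T, τ' t ∘ₗ f'.toLinearMap ∘ₗ r.toLinearMap ∘ₗ τ t⁻¹
  have hF : ∀ x, F x = ∑ t : T, τ' t (f' (r (τ t⁻¹ x))) := fun x => by
    simp only [F, LinearMap.sum_apply]; rfl
  have hFT : ∀ s x, F (τ s x) = τ' s (F x) := by
    intro s x
    rw [hF, hF, map_sum]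
    refine Fintype.sum_equiv (Equiv.mulLeft s⁻¹) _ _ fun t => ?_
    rw [Equiv.coe_mulLeft, ← Module.End.mul_apply, ← Module.End.mul_apply, ← map_mul, ← map_mul,
      mul_inv_cancel_left, mul_inv_rev, inv_inv]
  have hFf : ∀ w, F (f w) = Nat.card I • f' w := by
    intro w
    have h1 : ∀ t : T, τ' t (f' (r (τ t⁻¹ (f w)))) = if t ∈ I then f' w else 0 := by
      intro t
      split_ifs with ht
      · have h2 := hf (⟨t, ht⟩⁻¹ : I) w
        rw [Subgroup.coe_inv] at h2
        rw [← h2, hr]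
        have h3 := hf' ⟨t, ht⟩ (σ (⟨t, ht⟩⁻¹ : I) w)
        rw [← Module.End.mul_apply, ← map_mul, mul_inv_cancel, map_one] at h3
        exact h3.symm
      · rw [hzero t ht, map_zero, map_zero]
    rw [hF, Finset.sum_congr rfl fun t _ => h1 t, ← Finset.sum_filter, Finset.sum_const,
      ← Fintype.card_subtype, Nat.card_eq_fintype_card]
  refine nonempty_equiv_of_intertwiningMap hτ hτ' ⟨F, fun s => LinearMap.ext (hFT s)⟩ fun h0 => ?_
  refine hf0' (IntertwiningMap.ext (LinearMap.ext fun w => ?_))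
  have h1 : F (f w) = 0 := LinearMap.congr_fun (congrArg IntertwiningMap.toLinearMap h0) (f w)
  rw [hFf, ← Nat.cast_smul_eq_nsmul ℂ] at h1
  exact (smul_eq_zero.1 h1).resolve_left (Nat.cast_ne_zero.2 Nat.card_pos.ne')

end Clifford

section SylowComplement

variable {M : Type} [Group M] [Finite M]

theorem sup_sylow_eq_top {q : ℕ} [Fact q.Prime] (K : Subgroup M) [K.Normal]
    (hK : ∀ m : M, ∃ j : ℕ, m ^ q ^ j ∈ K) (S : Sylow q M) : K ⊔ S = ⊤ := by
  have hsurj := QuotientGroup.mk'_surjective K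
  have hp : IsPGroup q (⊤ : Subgroup (M ⧸ K)) := by
    rintro ⟨x, -⟩
    obtain ⟨m, rfl⟩ := hsurj x
    obtain ⟨j, hj⟩ := hK m
    exact ⟨j, Subtype.ext ((map_pow (QuotientGroup.mk' K) m (q ^ j)).symm.trans
      ((QuotientGroup.eq_one_iff _).2 hj))⟩
  have h := (S.mapSurjective hsurj).is_maximal' hp le_top
  rw [sup_comm, ← QuotientGroup.ker_mk' K, ← Subgroup.comap_map_eq, eq_top_iff]
  intro m _
  have : QuotientGroup.mk' K m ∈ (⊤ : Subgroup (M ⧸ K)) := trivial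
  rw [h] at this
  exact this

/-- A central extension by a `p`-group that splits over a normal subgroup whose quotient is a
`q`-group, `q ≠ p`, splits compatibly. -/
theorem exists_section_of_central {N Γ : Type} [Group N] [Group Γ] [Finite Γ] {p q : ℕ}
    (hp : p.Prime) (hq : q.Prime) (hpq : p ≠ q) (π : Γ →* M) (hπ : Function.Surjective π)
    (ν : N →* Γ) (hinj : Function.Injective (π.comp ν)) [hn : ν.range.Normal]
    (hcent : ∀ x ∈ π.ker, ∀ y, x * y = y * x) (hker : ∀ x ∈ π.ker, ∃ k : ℕ, x ^ p ^ k = 1)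
    (hquot : ∀ m : M, ∃ (j : ℕ) (n : N), π (ν n) = m ^ q ^ j) :
    ∃ s : M →* Γ, (∀ m, π (s m) = m) ∧ ∀ n, s (π (ν n)) = ν n := by
  have := Fact.mk hq
  obtain ⟨Q⟩ : Nonempty (Sylow q Γ) := inferInstance
  have hcop : ∀ i j, Nat.Coprime (p ^ i) (q ^ j) := fun i j =>
    Nat.Coprime.pow _ _ ((Nat.coprime_primes hp hq).2 hpq)
  have hker_range : ∀ x, x ∈ π.ker → x ∈ ν.range → x = 1 := by
    rintro _ hx ⟨n, rfl⟩
    rw [(injective_iff_map_eq_one (π.comp ν)).1 hinj n hx, map_one]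
  let C : Subgroup Γ := ν.range ⊔ Q
  have hKer : ∀ x ∈ C, π x = 1 → x = 1 := by
    intro x hx hx1
    obtain ⟨n', hn', y, hy, rfl⟩ := Subgroup.mem_sup_of_normal_left.1 hx
    refine hker_range _ hx1 (mul_mem hn' ?_)
    obtain ⟨i, hi⟩ := Q.2 ⟨y, hy⟩
    replace hi : y ^ q ^ i = 1 := congrArg Subtype.val hi
    obtain ⟨k, hk⟩ := hker _ hx1
    have hz : ∀ z, n' * y * z = z * (n' * y) := hcent _ hx1
    have hy' : y = n'⁻¹ * (n' * y) := by group
    have hmem : y ^ p ^ k ∈ ν.range := by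
      have hc : Commute n'⁻¹ (n' * y) := (hz _).symm
      rw [hy', hc.mul_pow, hk, mul_one]
      exact pow_mem (inv_mem hn') _
    have hmem' : y ^ q ^ i ∈ ν.range := by rw [hi]; exact one_mem _
    have hg : y ^ ((p ^ k : ℕ) : ℤ) ∈ ν.range := by rwa [zpow_natCast]
    have hg' : y ^ ((q ^ i : ℕ) : ℤ) ∈ ν.range := by rwa [zpow_natCast]
    have hb := Nat.gcd_eq_gcd_ab (p ^ k) (q ^ i)
    rw [(hcop k i).gcd_eq_one] at hb
    have : y ^ (((1 : ℕ)) : ℤ) ∈ ν.range := by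
      rw [hb, zpow_add, zpow_mul, zpow_mul]
      exact mul_mem (zpow_mem hg _) (zpow_mem hg' _)
    simpa using this
  have hsurj : ∀ m, ∃ x ∈ C, π x = m := by
    intro m
    have hr : (π.comp ν).range = ν.range.map π := MonoidHom.range_comp _ _
    have : (π.comp ν).range.Normal := hr ▸ hn.map π hπ
    have htop := sup_sylow_eq_top (q := q) (π.comp ν).range
      (fun m => by obtain ⟨j, n, h⟩ := hquot m; exact ⟨j, n, h⟩) (Q.mapSurjective hπ)
    have hm : m ∈ C.map π := by
      rw [Subgroup.map_sup, ← hr]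
      rw [Sylow.coe_mapSurjective] at htop
      rw [htop]; trivial
    exact hm
  let πC : C →* M := π.comp C.subtype
  have hbij : Function.Bijective πC := by
    refine ⟨(injective_iff_map_eq_one πC).2 fun x hx => Subtype.ext (hKer x x.2 hx), fun m => ?_⟩
    obtain ⟨x, hx, h⟩ := hsurj m
    exact ⟨⟨x, hx⟩, h⟩
  let e := MulEquiv.ofBijective πC hbij
  refine ⟨C.subtype.comp e.symm.toMonoidHom, fun m => e.apply_symm_apply m, fun n => ?_⟩
  have hmem : ν n ∈ C := Subgroup.mem_sup_left ⟨n, rfl⟩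
  exact congrArg Subtype.val (e.symm_apply_apply ⟨ν n, hmem⟩)

end SylowComplement

section Special

variable {N M : Type} [Group N] [Group M] [Finite N] [Finite M]

/-- A class function fixed by every automorphism of `ℂ` over `Qfield p`. -/
def FixedBy (p : ℕ) {G : Type} (χ : G → ℂ) : Prop :=
  ∀ s : ℂ ≃+* ℂ, (∀ x ∈ Qfield p, s x = x) → ∀ g, s (χ g) = χ g

/-- An irreducible representation whose restriction to some `p`-subgroup is irreducible, whose
determinant has `p`-power order, and whose character is fixed by the automorphisms of `ℂ` over
`Qfield p`. -/
structure Special (p : ℕ) {d : ℕ} (ρ : Representation ℂ N (Fin d → ℂ)) : Prop where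
  irreducible : IsIrreducible ρ
  det : ∃ k : ℕ, ∀ n, LinearMap.det (ρ n) ^ p ^ k = 1
  sub : ∃ P : Subgroup N, IsPGroup p P ∧ IsIrreducible (ρ.comp P.subtype)
  fixed : FixedBy p ρ.character

theorem exists_forall_pow_eq_one {p : ℕ} {A R : Type} [Finite A] [Monoid R] (f : A → R)
    (h : ∀ a, ∃ k : ℕ, f a ^ p ^ k = 1) : ∃ k : ℕ, ∀ a, f a ^ p ^ k = 1 := by
  cases nonempty_fintype A
  choose k hk using h
  refine ⟨∑ a, k a, fun a => ?_⟩
  rw [← Finset.add_sum_erase _ _ (Finset.mem_univ a), pow_add, pow_mul, hk, one_pow]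

omit [Finite M] in
theorem Over.twist {d d' : ℕ} {ι : N →* M} {ρ : Representation ℂ N (Fin d → ℂ)}
    {ψ : Representation ℂ M (Fin d' → ℂ)} (h : Over ι ρ ψ) (s : ℂ ≃+* ℂ)
    (hs : ∀ n, s (ρ.character n) = ρ.character n) : Over ι ρ (ψ.twist s) := by
  have h1 := finrank_intertwiningMap_pos.2 h
  have h2 := finrank_intertwiningMap_congr s (MulEquiv.refl N) ρ (ψ.comp ι) ρ ((ψ.twist s).comp ι)
    (fun n => (hs n).symm) (fun n => character_twist s ψ (ι n))
  exact finrank_intertwiningMap_pos.1 (h2 ▸ h1)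

theorem IsIrreducible.twist {d : ℕ} {ψ : Representation ℂ M (Fin d → ℂ)} (h : IsIrreducible ψ)
    (s : ℂ ≃+* ℂ) : IsIrreducible (ψ.twist s) :=
  IsIrreducible.of_character s (MulEquiv.refl M) h _ fun m => character_twist s ψ m

theorem Special.exists_of_pow {p : ℕ} (hp : p.Prime) (ι : N →* M) (hι : Function.Injective ι)
    (hn : ι.range.Normal) {d : ℕ} {ρ : Representation ℂ N (Fin d → ℂ)} (hρ : Special p ρ)
    (hinv : ∀ m n n', ι n' = m * ι n * m⁻¹ → ρ.character n' = ρ.character n)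
    (hquot : ∀ m : M, ∃ (j : ℕ) (n : N), ι n = m ^ p ^ j) :
    ∃ (d' : ℕ) (ψ : Representation ℂ M (Fin d' → ℂ)), Special p ψ ∧ Over ι ρ ψ := by
  have := Fact.mk hp
  cases nonempty_fintype N
  obtain ⟨d', ψ, hψ, hover⟩ := exists_over ι hι hρ.irreducible
  obtain ⟨P, hP, hPirr⟩ := hρ.sub
  obtain ⟨S, hS⟩ := (hP.map ι).exists_le_sylow
  have hfactor : ∀ m, ∃ n, ∃ x : S, m = ι n * x := by
    intro m
    have htop := sup_sylow_eq_top (q := p) ι.range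
      (fun m => by obtain ⟨j, n, h⟩ := hquot m; exact ⟨j, n, h⟩) S
    have hm : m ∈ ι.range ⊔ (S : Subgroup M) := htop ▸ trivial
    obtain ⟨_, ⟨n, rfl⟩, y, hy, rfl⟩ := Subgroup.mem_sup_of_normal_left.1 hm
    exact ⟨n, ⟨y, hy⟩, rfl⟩
  have hsum : ∀ n, ∃ c : P → ℂ, ∀ ψ' : Representation ℂ M (Fin d' → ℂ), IsIrreducible ψ' →
      Over ι ρ ψ' → ∀ w, ψ' (ι n) w = ∑ x : P, c x • ψ' (ι x) w := by
    intro n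
    obtain ⟨c, hc⟩ := exists_eq_sum_smul hPirr (ρ n)
    refine ⟨c, fun ψ' hψ' hover' w => ?_⟩
    obtain ⟨e, Φ, hΦ⟩ := exists_linearEquiv_pi ι hι hn hρ.irreducible hinv hψ' hover'
    apply Φ.injective
    funext i
    rw [hΦ, hc, map_sum, Finset.sum_apply, LinearMap.sum_apply]
    refine Finset.sum_congr rfl fun x _ => ?_
    rw [map_smul, Pi.smul_apply, hΦ]
    rfl
  have hPS : ∀ x : P, ι x ∈ S := fun x => hS ⟨x, x.2, rfl⟩
  have hirr : ∀ ψ' : Representation ℂ M (Fin d' → ℂ), IsIrreducible ψ' → Over ι ρ ψ' →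
      IsIrreducible (ψ'.comp (S : Subgroup M).subtype) := by
    intro ψ' hψ' hover'
    have hnt := IsIrreducible.nontrivial_space hψ'
    refine { exists_pair_ne := ⟨⊥, ⊤, fun h => ?_⟩, eq_bot_or_eq_top := fun U => ?_ }
    · exact bot_ne_top (congrArg Subrepresentation.toSubmodule h)
    · have hU : ∀ (x : S) {w}, w ∈ U.toSubmodule → ψ' x w ∈ U.toSubmodule := fun x w hw =>
        U.apply_mem_toSubmodule x hw
      let U' : Subrepresentation ψ' := ⟨U.toSubmodule, fun m w hw => by
        obtain ⟨n, x, rfl⟩ := hfactor m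
        obtain ⟨c, hc⟩ := hsum n
        rw [map_mul, Module.End.mul_apply, hc ψ' hψ' hover']
        exact Submodule.sum_mem _ fun y _ => Submodule.smul_mem _ _
          (hU ⟨_, hPS y⟩ (hU x hw))⟩
      rcases IsSimpleOrder.eq_bot_or_eq_top (self := hψ') U' with h | h
      · have h' : U'.toSubmodule = ⊥ := congrArg Subrepresentation.toSubmodule h
        exact .inl (Subrepresentation.toSubmodule_injective h')
      · have h' : U'.toSubmodule = ⊤ := congrArg Subrepresentation.toSubmodule h
        exact .inr (Subrepresentation.toSubmodule_injective h')
  refine ⟨d', ψ, ⟨hψ, ?_, ⟨S, S.2, hirr ψ hψ hover⟩, ?_⟩, hover⟩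
  · refine exists_forall_pow_eq_one _ fun m => ?_
    obtain ⟨n, x, rfl⟩ := hfactor m
    obtain ⟨k, hk⟩ := hρ.det
    obtain ⟨l, hl⟩ := S.2 x
    obtain ⟨e, Φ, hΦ⟩ := exists_linearEquiv_pi ι hι hn hρ.irreducible hinv hψ hover
    have hdet : LinearMap.det (ψ (ι n)) = LinearMap.det (ρ n) ^ e := by
      have : ψ (ι n) = (Φ.symm : _ →ₗ[ℂ] _) ∘ₗ
          (LinearMap.pi fun i : Fin e => ρ n ∘ₗ LinearMap.proj i) ∘ₗ (Φ.symm.symm : _ →ₗ[ℂ] _) := by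
        refine LinearMap.ext fun w => Φ.injective (funext fun i => ?_)
        simp [hΦ]
      rw [this, LinearMap.det_conj, LinearMap.det_pi]
      simp
    have hl' : (x : M) ^ p ^ l = 1 := congrArg Subtype.val hl
    refine ⟨k + l, ?_⟩
    rw [map_mul, map_mul, mul_pow, hdet, ← pow_mul, mul_comm e, pow_add, mul_assoc, pow_mul, hk,
      one_pow, one_mul, ← map_pow, ← map_pow, mul_comm, pow_mul, hl', one_pow, map_one, map_one]
  · intro s hs m
    have hover' := hover.twist s (hρ.fixed s hs)
    have hψ' := IsIrreducible.twist hψ s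
    obtain ⟨β⟩ := nonempty_equiv_of_character_eq (hirr ψ hψ hover) (hirr _ hψ' hover') fun x => by
      obtain ⟨l, hl⟩ := S.2 x
      have hl' : (x : M) ^ p ^ l = 1 := congrArg Subtype.val hl
      exact ((character_twist s ψ x).trans (hs _ (character_mem_Qfield ψ hl'))).symm
    have hβ : ∀ (x : S) w, β.toLinearEquiv (ψ x w) = ψ.twist s x (β.toLinearEquiv w) := fun x w =>
      IntertwiningMap.isIntertwining _ _ β.toIntertwiningMap x w
    have hall : ∀ m w, β.toLinearEquiv (ψ m w) = ψ.twist s m (β.toLinearEquiv w) := by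
      intro m w
      obtain ⟨n, x, rfl⟩ := hfactor m
      obtain ⟨c, hc⟩ := hsum n
      rw [map_mul, map_mul, Module.End.mul_apply, Module.End.mul_apply, hc ψ hψ hover,
        hc _ hψ' hover', map_sum, ← hβ]
      refine Finset.sum_congr rfl fun y _ => ?_
      rw [map_smul, ← hβ ⟨_, hPS y⟩]
    have hconj : ψ.twist s m = β.toLinearEquiv.conj (ψ m) := LinearMap.ext fun w => by
      rw [LinearEquiv.conj_apply_apply, hall, LinearEquiv.apply_symm_apply]
    rw [← character_twist]
    exact (congrArg _ hconj).trans (LinearMap.trace_conj' _ _)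

end Special

section Extension

variable {N M : Type} [Group N] [Group M] [Finite N] [Finite M]
variable {V : Type} [AddCommGroup V] [Module ℂ V] [FiniteDimensional ℂ V]

omit [Finite N] [Finite M] [FiniteDimensional ℂ V] in
theorem IsIrreducible.of_comp {ψ : Representation ℂ M V} (ι : N →* M)
    (h : IsIrreducible (ψ.comp ι)) : IsIrreducible ψ := by
  have hnt := IsIrreducible.nontrivial_space h
  refine { exists_pair_ne := ⟨⊥, ⊤, fun h => ?_⟩, eq_bot_or_eq_top := fun U => ?_ }
  · exact bot_ne_top (congrArg Subrepresentation.toSubmodule h)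
  · let U' : Subrepresentation (ψ.comp ι) :=
      ⟨U.toSubmodule, fun n w hw => U.apply_mem_toSubmodule (ι n) hw⟩
    rcases IsSimpleOrder.eq_bot_or_eq_top (self := h) U' with h | h
    · have h' : U'.toSubmodule = ⊥ := congrArg Subrepresentation.toSubmodule h
      exact .inl (Subrepresentation.toSubmodule_injective h')
    · have h' : U'.toSubmodule = ⊤ := congrArg Subrepresentation.toSubmodule h
      exact .inr (Subrepresentation.toSubmodule_injective h')

/-- Pairs of an element `m` of `M` and an operator of bounded `p`-power determinant that intertwines
`ρ` with its conjugate by `m`. -/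
def extensionGroup (ι : N →* M) (hι : Function.Injective ι) (hn : ι.range.Normal)
    (ρ : Representation ℂ N V) (L : ℕ) : Subgroup (M × (Module.End ℂ V)ˣ) where
  carrier := {x | (∀ n n', ι n' = x.1 * ι n * x.1⁻¹ →
    (x.2 : Module.End ℂ V) * ρ n = ρ n' * x.2) ∧ LinearMap.det (x.2 : Module.End ℂ V) ^ L = 1}
  one_mem' := by
    refine ⟨fun n n' h => ?_, by simp⟩
    have : n' = n := hι (by simpa using h)
    simp [this]
  mul_mem' := by
    rintro x y ⟨hx, hx'⟩ ⟨hy, hy'⟩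
    refine ⟨fun n n' h => ?_, by simp [mul_pow, hx', hy']⟩
    obtain ⟨n₁, h₁⟩ := hn.conj_mem (ι n) ⟨n, rfl⟩ y.1
    have h₂ : ι n' = x.1 * ι n₁ * x.1⁻¹ := by
      rw [h, h₁]; simp [mul_assoc]
    rw [Prod.snd_mul, Units.val_mul, mul_assoc, hy n n₁ h₁, ← mul_assoc, hx n₁ n' h₂, mul_assoc]
  inv_mem' := by
    rintro x ⟨hx, hx'⟩
    refine ⟨fun n n' h => ?_, ?_⟩
    · have h₁ : ι n = x.1 * ι n' * x.1⁻¹ := by rw [h]; simp [mul_assoc]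
      have h₂ := hx n' n h₁
      rw [Prod.snd_inv, Units.inv_mul_eq_iff_eq_mul, ← mul_assoc, h₂, mul_assoc,
        Units.mul_inv, mul_one]
    · have h1 : LinearMap.det (x.2 : Module.End ℂ V) *
          LinearMap.det ((x.2⁻¹ : (Module.End ℂ V)ˣ) : Module.End ℂ V) = 1 := by
        rw [← map_mul, Units.mul_inv, map_one]
      have := congrArg (· ^ L) h1
      simp only [mul_pow, hx', one_mul, one_pow] at this
      exact this

omit [Finite M] in
theorem exists_mem_extensionGroup (ι : N →* M) (hι : Function.Injective ι) (hn : ι.range.Normal)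
    {ρ : Representation ℂ N V} (hρ : IsIrreducible ρ)
    (hinv : ∀ m n n', ι n' = m * ι n * m⁻¹ → ρ.character n' = ρ.character n) (L : ℕ) (m : M) :
    ∃ x ∈ extensionGroup ι hι hn ρ L, x.1 = m := by
  have := IsIrreducible.nontrivial_space hρ
  obtain ⟨α, hα⟩ := exists_conj_equiv ι hι hn m
  have hirr : IsIrreducible (ρ.comp (α : N →* N)) :=
    IsIrreducible.of_character (RingEquiv.refl ℂ) α hρ _ fun n => rfl
  obtain ⟨β⟩ := nonempty_equiv_of_character_eq hρ hirr fun n => (hinv m n (α n) (hα n)).symm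
  have hβ : ∀ n v, β.toLinearEquiv (ρ n v) = ρ (α n) (β.toLinearEquiv v) := fun n v =>
    IntertwiningMap.isIntertwining _ _ β.toIntertwiningMap n v
  obtain ⟨c, hc⟩ := IsAlgClosed.exists_pow_nat_eq
    (LinearMap.det (β.toLinearEquiv : V →ₗ[ℂ] V))⁻¹ (finrank_pos (R := ℂ) (M := V))
  let A : Module.End ℂ V := c • (β.toLinearEquiv : V →ₗ[ℂ] V)
  have hdet : LinearMap.det A = 1 := by
    rw [LinearMap.det_smul, hc, inv_mul_cancel₀]
    exact (LinearEquiv.isUnit_det' β.toLinearEquiv).ne_zero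
  obtain ⟨u, hu⟩ : IsUnit A := (LinearMap.isUnit_iff_isUnit_det A).2 (hdet ▸ isUnit_one)
  refine ⟨(m, u), ⟨fun n n' h => ?_, ?_⟩, rfl⟩
  · obtain rfl : n' = α n := hι (h.trans (hα n).symm)
    refine LinearMap.ext fun v => ?_
    have h1 : (u : Module.End ℂ V) (ρ n v) = c • β.toLinearEquiv (ρ n v) := by rw [hu]; rfl
    have h2 : (u : Module.End ℂ V) v = c • β.toLinearEquiv v := by rw [hu]; rfl
    rw [Module.End.mul_apply, Module.End.mul_apply, h1, h2, hβ, map_smul]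
  · simp only [hu, hdet, one_pow]

omit [Finite N] [Finite M] in
theorem exists_scalar_of_mem_extensionGroup (ι : N →* M) (hι : Function.Injective ι)
    (hn : ι.range.Normal) {ρ : Representation ℂ N V} (hρ : IsIrreducible ρ) {L : ℕ}
    {x : M × (Module.End ℂ V)ˣ} (hx : x ∈ extensionGroup ι hι hn ρ L) (h1 : x.1 = 1) :
    ∃ c : ℂ, (x.2 : Module.End ℂ V) = c • (1 : Module.End ℂ V) ∧ c ^ (finrank ℂ V * L) = 1 := by
  obtain ⟨c, hc⟩ := exists_eq_smul_of_commute hρ (x.2 : Module.End ℂ V) fun g v =>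
    LinearMap.congr_fun (hx.1 g g (by simp [h1])) v
  have hx2 : (x.2 : Module.End ℂ V) = c • (1 : Module.End ℂ V) := LinearMap.ext hc
  refine ⟨c, hx2, ?_⟩
  have := hx.2
  rwa [hx2, LinearMap.det_smul, map_one, mul_one, ← pow_mul] at this

omit [Finite N] in
theorem finite_extensionGroup (ι : N →* M) (hι : Function.Injective ι)
    (hn : ι.range.Normal) {ρ : Representation ℂ N V} (hρ : IsIrreducible ρ) {L : ℕ} (hL : L ≠ 0) :
    Finite (extensionGroup ι hι hn ρ L) := by
  have := IsIrreducible.nontrivial_space hρ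
  have hL' : 0 < finrank ℂ V * L := Nat.mul_pos finrank_pos (Nat.pos_of_ne_zero hL)
  let π : extensionGroup ι hι hn ρ L →* M := (MonoidHom.fst _ _).comp (Subgroup.subtype _)
  refine MonoidHom.finite_iff_finite_ker_range π |>.2 ⟨?_, inferInstance⟩
  choose c hc hc' using fun x : π.ker =>
    exists_scalar_of_mem_extensionGroup ι hι hn hρ x.1.2 x.2
  let R := (Polynomial.nthRoots (finrank ℂ V * L) (1 : ℂ)).toFinset
  refine Finite.of_injective (fun x => (⟨c x, Multiset.mem_toFinset.2
    ((Polynomial.mem_nthRoots hL').2 (hc' x))⟩ : R)) fun x y h => ?_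
  have h' : c x = c y := congrArg Subtype.val h
  refine Subtype.ext (Subtype.ext (Prod.ext (x.2.trans y.2.symm) (Units.ext ?_)))
  rw [hc, hc, h']

/-- A special representation that is invariant in `M` extends to `M` when the quotient is a
`q`-group for a prime `q ≠ p`. -/
theorem Special.exists_extension {p q : ℕ} (hp : p.Prime) (hq : q.Prime) (hpq : p ≠ q) (ι : N →* M)
    (hι : Function.Injective ι) (hn : ι.range.Normal) {d : ℕ}
    {ρ : Representation ℂ N (Fin d → ℂ)} (hρ : Special p ρ)
    (hinv : ∀ m n n', ι n' = m * ι n * m⁻¹ → ρ.character n' = ρ.character n)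
    (hquot : ∀ m : M, ∃ (j : ℕ) (n : N), ι n = m ^ q ^ j) :
    ∃ ψ : Representation ℂ M (Fin d → ℂ), Special p ψ ∧ Over ι ρ ψ := by
  have hirr := hρ.irreducible
  have hnt := IsIrreducible.nontrivial_space hirr
  obtain ⟨k, hk⟩ := hρ.det
  obtain ⟨P, hP, hPirr⟩ := hρ.sub
  have := Fact.mk hp
  obtain ⟨a, ha⟩ : ∃ a, finrank ℂ (Fin d → ℂ) = p ^ a := by
    obtain ⟨n, hn⟩ := IsPGroup.iff_card.1 hP
    obtain ⟨a, -, ha⟩ := (Nat.dvd_prime_pow hp).1 (hn ▸ finrank_dvd_card hPirr)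
    exact ⟨a, ha⟩
  let Γ := extensionGroup ι hι hn ρ (p ^ k)
  have : Finite Γ := finite_extensionGroup ι hι hn hirr (pow_ne_zero _ hp.ne_zero)
  let π : Γ →* M := (MonoidHom.fst _ _).comp Γ.subtype
  have hπ : Function.Surjective π := fun m => by
    obtain ⟨x, hx, h⟩ := exists_mem_extensionGroup ι hι hn hirr hinv (p ^ k) m
    exact ⟨⟨x, hx⟩, h⟩
  let ν : N →* Γ := (ι.prod ρ.toHomUnits).codRestrict Γ fun n => by
    refine ⟨fun n₁ n₂ h => ?_, hk n⟩
    have : n₂ = n * n₁ * n⁻¹ := hι (by simpa using h)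
    change ρ n * ρ n₁ = ρ n₂ * ρ n
    rw [← map_mul, ← map_mul, this, inv_mul_cancel_right]
  have hνn : ν.range.Normal := ⟨by
    rintro _ ⟨n, rfl⟩ x
    obtain ⟨n', hn'⟩ := hn.conj_mem (ι n) ⟨n, rfl⟩ x.1.1
    refine ⟨n', Subtype.ext (Prod.ext hn' (Units.ext ?_))⟩
    have h := x.2.1 n n' hn'
    change ρ n' = x.1.2 * ρ n * _
    rw [h, mul_assoc]
    exact ((congrArg (ρ n' * ·) (Units.mul_inv _)).trans (mul_one _)).symm⟩
  have hcent : ∀ x ∈ π.ker, ∀ y, x * y = y * x := by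
    intro x hx y
    obtain ⟨c, hc, -⟩ := exists_scalar_of_mem_extensionGroup ι hι hn hirr x.2 hx
    have hx1 : x.1.1 = 1 := hx
    refine Subtype.ext (Prod.ext ?_ (Units.ext ?_))
    · change x.1.1 * y.1.1 = y.1.1 * x.1.1
      rw [hx1, one_mul, mul_one]
    · change (x.1.2 : Module.End ℂ (Fin d → ℂ)) * y.1.2 =
        y.1.2 * x.1.2
      rw [hc, smul_mul_assoc, one_mul, mul_smul_comm, mul_one]
  have hker : ∀ x ∈ π.ker, ∃ k : ℕ, x ^ p ^ k = 1 := by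
    intro x hx
    obtain ⟨c, hc, hc'⟩ := exists_scalar_of_mem_extensionGroup ι hι hn hirr x.2 hx
    have hx1 : x.1.1 = 1 := hx
    rw [ha, ← pow_add] at hc'
    refine ⟨a + k, Subtype.ext (Prod.ext ?_ (Units.ext ?_))⟩
    · change x.1.1 ^ _ = 1
      rw [hx1, one_pow]
    · change (x.1.2 : Module.End ℂ (Fin d → ℂ)) ^ _ = 1
      rw [hc, smul_pow, hc', one_pow, one_smul]
  obtain ⟨s, hs, hs'⟩ := exists_section_of_central hp hq hpq π hπ ν hι hcent hker fun m => by
    obtain ⟨j, n, h⟩ := hquot m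
    exact ⟨j, n, h⟩
  let ψ : Representation ℂ M (Fin d → ℂ) :=
    (Units.coeHom _).comp ((MonoidHom.snd _ _).comp (Γ.subtype.comp s))
  have hψι : ∀ n, ψ (ι n) = ρ n := fun n =>
    congrArg (fun x : Γ => ((x : M × (Module.End ℂ (Fin d → ℂ))ˣ).2 : Module.End ℂ (Fin d → ℂ)))
      (hs' n)
  have hcomp : ψ.comp ι = ρ := MonoidHom.ext hψι
  have hdet : ∀ m, LinearMap.det (ψ m) ^ p ^ k = 1 := fun m => (s m).2.2
  refine ⟨ψ, ⟨IsIrreducible.of_comp ι (hcomp ▸ hirr), ⟨k, hdet⟩, ⟨P.map ι, hP.map ι, ?_⟩, ?_⟩, ?_⟩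
  · refine IsIrreducible.of_comp (ι.subgroupMap P) ?_
    have : (ψ.comp (P.map ι).subtype).comp (ι.subgroupMap P) = ρ.comp P.subtype :=
      MonoidHom.ext fun x => hψι x
    exact this ▸ hPirr
  · intro σ hσ m
    obtain ⟨β⟩ := nonempty_equiv_of_character_eq hirr (IsIrreducible.twist hirr σ) fun n =>
      ((character_twist σ ρ n).trans (hρ.fixed σ hσ n)).symm
    have hβ : ∀ n v, β.toLinearEquiv (ρ n v) = ρ.twist σ n (β.toLinearEquiv v) := fun n v =>
      IntertwiningMap.isIntertwining _ _ β.toIntertwiningMap n v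
    have htw : ∀ n, ψ.twist σ (ι n) = ρ.twist σ n := fun n => by
      rw [twist_apply, twist_apply, hψι]
    let B : Module.End ℂ (Fin d → ℂ) := β.toLinearEquiv.symm.conj (ψ.twist σ m) * ψ m⁻¹
    obtain ⟨c, hc⟩ := exists_eq_smul_of_commute hirr B fun n v => by
      obtain ⟨n', hn'⟩ := hn.conj_mem (ι n) ⟨n, rfl⟩ m⁻¹
      rw [inv_inv] at hn'
      have h1 : ψ m⁻¹ * ρ n = ρ n' * ψ m⁻¹ := by
        rw [← hψι, ← hψι, ← map_mul, ← map_mul, hn']; group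
      have h2 : ψ.twist σ m * ρ.twist σ n' = ρ.twist σ n * ψ.twist σ m := by
        rw [← htw, ← htw, ← map_mul, ← map_mul, hn']; group
      apply β.toLinearEquiv.injective
      have h1' := LinearMap.congr_fun h1 v
      have h2' := LinearMap.congr_fun h2 (β.toLinearEquiv (ψ m⁻¹ v))
      simp only [Module.End.mul_apply] at h1' h2'
      simp only [B, Module.End.mul_apply, LinearEquiv.conj_apply_apply, LinearEquiv.symm_symm, hβ,
        LinearEquiv.apply_symm_apply, h1', h2']
    have hcomm : ∀ v, ψ.twist σ m (β.toLinearEquiv v) = c • β.toLinearEquiv (ψ m v) := by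
      intro v
      have h := congrArg β.toLinearEquiv (hc (ψ m v))
      have h1 : ψ m⁻¹ (ψ m v) = v := by
        rw [← Module.End.mul_apply, ← map_mul, inv_mul_cancel, map_one, Module.End.one_apply]
      simpa only [B, Module.End.mul_apply, LinearEquiv.conj_apply_apply, LinearEquiv.symm_symm,
        LinearEquiv.apply_symm_apply, h1, map_smul] using h
    have hconj : ψ.twist σ m = c • β.toLinearEquiv.conj (ψ m) := LinearMap.ext fun w => by
      obtain ⟨v, rfl⟩ := β.toLinearEquiv.surjective w
      rw [hcomm, LinearMap.smul_apply, LinearEquiv.conj_apply_apply, LinearEquiv.symm_apply_apply]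
    have hcd : c ^ p ^ a = 1 := by
      have h1 := det_twist σ ψ m
      rw [hσ _ (pow_eq_one_mem_Qfield (hdet m)), hconj, LinearMap.det_smul, ha,
        LinearEquiv.conj_apply, LinearMap.comp_assoc, LinearMap.det_conj] at h1
      have h0 : LinearMap.det (ψ m) ≠ 0 := fun h => by
        have := hdet m
        rw [h, zero_pow (pow_ne_zero _ hp.ne_zero)] at this
        exact zero_ne_one this
      exact mul_right_cancel₀ h0 (h1.trans (one_mul _).symm)
    have hpow : ∀ (i : ℕ) v, ψ.twist σ (m ^ i) (β.toLinearEquiv v) =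
        c ^ i • β.toLinearEquiv (ψ (m ^ i) v) := by
      intro i
      induction i with
      | zero => intro v; simp
      | succ i ih =>
        intro v
        rw [pow_succ, map_mul, map_mul, Module.End.mul_apply, Module.End.mul_apply, hcomm, map_smul,
          ih, smul_smul, pow_succ']
    obtain ⟨j, n, hjn⟩ := hquot m
    have hcq : c ^ q ^ j = 1 := by
      obtain ⟨v, hv⟩ := exists_ne (0 : Fin d → ℂ)
      have h := hpow (q ^ j) (ρ n⁻¹ v)
      rw [← hjn, htw, ← hβ, hψι, ← Module.End.mul_apply (ρ n), ← map_mul, mul_inv_cancel, map_one,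
        Module.End.one_apply] at h
      have h0 : β.toLinearEquiv v ≠ 0 := fun h0 => hv (β.toLinearEquiv.map_eq_zero_iff.1 h0)
      exact smul_left_injective ℂ h0 (h.symm.trans (one_smul _ _).symm)
    have hc1 : c = 1 := by
      rw [← orderOf_eq_one_iff]
      exact Nat.eq_one_of_dvd_coprimes (Nat.Coprime.pow a j ((Nat.coprime_primes hp hq).2 hpq))
        (orderOf_dvd_of_pow_eq_one hcd) (orderOf_dvd_of_pow_eq_one hcq)
    rw [hc1, one_smul] at hconj
    rw [← character_twist]
    exact (congrArg _ hconj).trans (LinearMap.trace_conj' _ _)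
  · refine ⟨⟨LinearMap.id, fun n => LinearMap.ext fun v => ?_⟩, fun h => ?_⟩
    · exact (LinearMap.congr_fun (hψι n) v).symm
    · obtain ⟨v, hv⟩ := exists_ne (0 : Fin d → ℂ)
      exact hv (congrArg (fun f : IntertwiningMap ρ (ψ.comp ι) => f v) h)

end Extension

section Main

variable {N T : Type} [Group N] [Group T]

/-- The stabilizer in `T` of the character of a representation of a normal subgroup. -/
def characterStabilizer {V : Type} [AddCommGroup V] [Module ℂ V] (ι : N →* T)
    (hι : Function.Injective ι) (hn : ι.range.Normal)
    (ρ : Representation ℂ N V) : Subgroup T where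
  carrier := {t | ∀ n n', ι n' = t * ι n * t⁻¹ → ρ.character n' = ρ.character n}
  one_mem' := fun n n' h => by rw [hι (by simpa using h : ι n' = ι n)]
  mul_mem' := by
    intro x y hx hy n n' h
    obtain ⟨n₁, h₁⟩ := hn.conj_mem (ι n) ⟨n, rfl⟩ y
    exact (hx n₁ n' (by rw [h, h₁]; simp [mul_assoc])).trans (hy n n₁ h₁)
  inv_mem' := by
    intro x hx n n' h
    exact (hx n' n (by rw [h]; simp [mul_assoc])).symm

theorem Special.exists_over_fixedBy {p : ℕ} (hp : p.Prime) (k : ℕ) :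
    ∀ {N T : Type} [Group N] [Group T] [Finite N] [Finite T] [Group.IsSolvable T] (ι : N →* T)
      (_ : Function.Injective ι) (_ : ι.range.Normal) {d : ℕ} {ρ : Representation ℂ N (Fin d → ℂ)}
      (_ : Special p ρ) (_ : Nat.card T ≤ Nat.card N + k),
      ∃ (d' : ℕ) (τ : Representation ℂ T (Fin d' → ℂ)),
        IsIrreducible τ ∧ Over ι ρ τ ∧ FixedBy p τ.character := by
  induction k with
  | zero =>
    intro N T _ _ _ _ _ ι hι hn d ρ hρ hcard
    have hbij : Function.Bijective ι := (Nat.bijective_iff_injective_and_card ι).2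
      ⟨hι, le_antisymm (Nat.card_le_card_of_injective ι hι) hcard⟩
    let e := MulEquiv.ofBijective ι hbij
    have hirr : IsIrreducible (ρ.comp (e.symm : T →* N)) :=
      IsIrreducible.of_character (RingEquiv.refl ℂ) e.symm hρ.irreducible _ fun n => rfl
    refine ⟨d, _, hirr, ⟨⟨LinearMap.id, fun n => LinearMap.ext fun v => ?_⟩, fun h => ?_⟩,
      fun s hs t => hρ.fixed s hs (e.symm t)⟩
    · have : e.symm (ι n) = n := e.symm_apply_apply n
      change ρ n v = ρ (e.symm (ι n)) v
      rw [this]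
    · have := IsIrreducible.nontrivial_space hρ.irreducible
      obtain ⟨v, hv⟩ := exists_ne (0 : Fin d → ℂ)
      exact hv (congrArg (fun f : IntertwiningMap ρ ((ρ.comp (e.symm : T →* N)).comp ι) => f v) h)
  | succ k ih =>
    intro N T _ _ _ _ _ ι hι hn d ρ hρ hcard
    by_cases hk : Nat.card T ≤ Nat.card N + k
    · exact ih ι hι hn hρ hk
    let I := characterStabilizer ι hι hn ρ
    by_cases hI : I = ⊤
    · have hinv : ∀ t n n', ι n' = t * ι n * t⁻¹ → ρ.character n' = ρ.character n := fun t =>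
        (hI ▸ Subgroup.mem_top t : t ∈ I)
      have hbot : (⊤ : Subgroup (T ⧸ ι.range)) ≠ ⊥ := fun h => by
        have hsurj : Function.Surjective ι := fun t => by
          have : (t : T ⧸ ι.range) ∈ (⊥ : Subgroup (T ⧸ ι.range)) := h ▸ trivial
          exact (QuotientGroup.eq_one_iff t).1 this
        exact hk ((Nat.card_le_card_of_surjective ι hsurj).trans (Nat.le_add_right _ _))
      obtain ⟨q, hq, Q, hQ, hQbot, -, hQq⟩ := exists_normal_isPGroup_le _ hbot
      let M : Subgroup T := Q.comap (QuotientGroup.mk' ι.range)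
      have hM : M.Normal := hQ.comap _
      have hιM : ∀ n, ι n ∈ M := fun n => by
        have : ((ι n : T) : T ⧸ ι.range) = 1 := (QuotientGroup.eq_one_iff _).2 ⟨n, rfl⟩
        exact (congrArg (· ∈ Q) this).mpr Q.one_mem
      let ι' : N →* M := ι.codRestrict M hιM
      have hι' : Function.Injective ι' := fun a b h => hι (congrArg Subtype.val h)
      have hn' : ι'.range.Normal := ⟨by
        rintro _ ⟨n, rfl⟩ x
        obtain ⟨n', h⟩ := hn.conj_mem (ι n) ⟨n, rfl⟩ (x : T)
        exact ⟨n', Subtype.ext h⟩⟩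
      have hinv' : ∀ m n n', ι' n' = m * ι' n * m⁻¹ → ρ.character n' = ρ.character n :=
        fun m n n' h => hinv m n n' (congrArg Subtype.val h)
      have hquot : ∀ m : M, ∃ (j : ℕ) (n : N), ι' n = m ^ q ^ j := by
        intro m
        obtain ⟨j, hj⟩ := hQq ⟨_, m.2⟩
        have h1 : (((m : T) ^ q ^ j : T) : T ⧸ ι.range) = 1 := congrArg Subtype.val hj
        obtain ⟨n, h⟩ := (QuotientGroup.eq_one_iff _).1 h1
        exact ⟨j, n, Subtype.ext h⟩
      have hlt : Nat.card N < Nat.card M := by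
        refine lt_of_le_of_ne (Nat.card_le_card_of_injective ι' hι') fun h => hQbot ?_
        have hsurj := ((Nat.bijective_iff_injective_and_card ι').2 ⟨hι', h⟩).2
        refine (Subgroup.eq_bot_iff_forall _).2 fun x hx => ?_
        obtain ⟨t, rfl⟩ := QuotientGroup.mk'_surjective ι.range x
        obtain ⟨n, h⟩ := hsurj ⟨t, hx⟩
        exact (QuotientGroup.eq_one_iff _).2 ⟨n, congrArg Subtype.val h⟩
      obtain ⟨d', ψ, hψ, hover⟩ : ∃ (d' : ℕ) (ψ : Representation ℂ M (Fin d' → ℂ)),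
          Special p ψ ∧ Over ι' ρ ψ := by
        by_cases hpq : p = q
        · subst hpq
          exact hρ.exists_of_pow hp ι' hι' hn' hinv' hquot
        · exact ⟨d, hρ.exists_extension hp hq hpq ι' hι' hn' hinv' hquot⟩
      obtain ⟨e, τ, hτ, hover', hfix⟩ := ih M.subtype M.subtype_injective
        (by rwa [Subgroup.range_subtype]) hψ (by omega)
      exact ⟨e, τ, hτ, hover.trans hψ.irreducible hover', hfix⟩
    · have hιI : ∀ n, ι n ∈ I := fun n n₁ n₂ h => by
        have : n₂ = n * n₁ * n⁻¹ := hι (by simpa using h)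
        rw [this, char_conj]
      let j : N →* I := ι.codRestrict I hιI
      have hj : Function.Injective j := fun a b h => hι (congrArg Subtype.val h)
      have hjn : j.range.Normal := ⟨by
        rintro _ ⟨n, rfl⟩ x
        obtain ⟨n', h⟩ := hn.conj_mem (ι n) ⟨n, rfl⟩ (x : T)
        exact ⟨n', Subtype.ext h⟩⟩
      have hlt : Nat.card I < Nat.card T := by
        refine lt_of_le_of_ne (Subgroup.card_le_card_group I) fun h => hI ?_
        exact Subgroup.eq_top_of_card_eq I h
      obtain ⟨d₁, σ, hσ, hρσ, hfix⟩ := ih j hj hjn hρ (by omega)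
      obtain ⟨d₂, τ, hτ, hστ⟩ := exists_over I.subtype I.subtype_injective hσ
      refine ⟨d₂, τ, hτ, hρσ.trans hσ hστ, fun s hs t => ?_⟩
      obtain ⟨β⟩ := nonempty_equiv_of_over_stabilizer j hj hn hρ.irreducible (fun t => Iff.rfl) hσ
        hρσ hτ hστ (IsIrreducible.twist hτ s) (hστ.twist s (hfix s hs))
      rw [← character_twist]
      exact (congrFun (char_iso β) t).symm

/-- A nontrivial normal subgroup `K` of a solvable group is not contained in the kernel of some
irreducible representation whose character values lie in `Qfield p` for some prime `p`. -/
theorem exists_isIrreducible_character_mem_Qfield {G : Type} [Group G] [Finite G]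
    [Group.IsSolvable G] (K : Subgroup G) [K.Normal] (hK : K ≠ ⊥) :
    ∃ p : ℕ, p.Prime ∧ ∃ (d : ℕ) (τ : Representation ℂ G (Fin d → ℂ)), IsIrreducible τ ∧
      (∀ g, τ.character g ∈ Qfield p) ∧ ∃ x ∈ K, τ x ≠ 1 := by
  obtain ⟨p, hp, Q, hQ, hQbot, hQK, hQp⟩ := exists_normal_isPGroup_le K hK
  obtain ⟨x, hx1⟩ := Subgroup.ne_bot_iff_exists_ne_one.1 hQbot
  let φ : (Q → ℂ) →ₗ[ℂ] (Q → ℂ) := translationRep Q ℂ x - 1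
  have hφ : φ ≠ 0 := fun h => by
    have h1 : (Pi.single 1 1 : Q → ℂ) (x⁻¹ * 1) - (Pi.single 1 1 : Q → ℂ) 1 = 0 :=
      congrFun (LinearMap.congr_fun h (Pi.single 1 1)) 1
    simp [hx1] at h1
  obtain ⟨d, ρ, f, hρ, hf⟩ := exists_isIrreducible_comp_ne_zero (translationRep Q ℂ) φ hφ
  have hρx : ρ x ≠ 1 := fun h => hf <| LinearMap.ext fun v => by
    have h1 : f (ρ x v) = translationRep Q ℂ x (f v) := IntertwiningMap.isIntertwining _ _ f x v
    rw [h] at h1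
    exact sub_eq_zero.2 h1.symm
  have hspec : Special p ρ := by
    refine ⟨hρ, exists_forall_pow_eq_one _ fun n => ?_, ⟨⊤, fun n => ?_, ?_⟩, fun s hs n => ?_⟩
    · obtain ⟨k, hk⟩ := hQp n
      exact ⟨k, by rw [← map_pow, ← map_pow, hk, map_one, map_one]⟩
    · obtain ⟨k, hk⟩ := hQp n
      exact ⟨k, Subtype.ext hk⟩
    · exact IsIrreducible.of_character (RingEquiv.refl ℂ) Subgroup.topEquiv hρ _ fun n => rfl
    · obtain ⟨k, hk⟩ := hQp n
      exact hs _ (character_mem_Qfield ρ hk)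
  obtain ⟨e, τ, hτ, ⟨g, hg⟩, hfix⟩ := hspec.exists_over_fixedBy hp (Nat.card G) Q.subtype
    Q.subtype_injective (by rwa [Subgroup.range_subtype]) (Nat.le_add_left _ _)
  refine ⟨p, hp, e, τ, hτ, fun y => mem_of_fixed _ _ (isIntegral_character τ y) fun s hs =>
    hfix s hs y, x, hQK x.2, fun h => hρx ?_⟩
  have hinj := (IsIrreducible.injective_or_eq_zero g).resolve_right hg
  refine LinearMap.ext fun v => hinj ?_
  have h1 : g (ρ x v) = τ x (g v) := IntertwiningMap.isIntertwining _ _ g x v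
  rw [h1, h]
  rfl

end Main

section Count

variable {G H : Type} [Group G] [Group H]
variable {V W : Type} [AddCommGroup V] [Module ℂ V] [FiniteDimensional ℂ V]
  [AddCommGroup W] [Module ℂ W] [FiniteDimensional ℂ W]

theorem isIrreducibleCharacter_character [Finite G] {ρ : Representation ℂ G V}
    (hρ : IsIrreducible ρ) : IsIrreducibleCharacter G ρ.character := by
  cases nonempty_fintype G
  refine ⟨FDRep.of ρ, (FDRep.simple_iff_char_is_norm_one _).2 ?_, rfl⟩
  have h := finrank_intertwiningMap_eq ρ ρ
  rw [(isIrreducible_iff_finrank_end ρ).1 hρ, Nat.cast_one] at h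
  have hG : (Nat.card G : ℂ) ≠ 0 := Nat.cast_ne_zero.mpr Nat.card_pos.ne'
  exact (((inv_mul_eq_one₀ hG).1 h.symm).symm :)

theorem finite_setOf_isIrreducibleCharacter [Finite G] :
    {χ : G → ℂ | IsIrreducibleCharacter G χ}.Finite := by
  cases nonempty_fintype G
  have : Invertible (Nat.card G : ℂ) :=
    invertibleOfNonzero (Nat.cast_ne_zero.mpr Nat.card_pos.ne')
  refine LinearIndependent.setFinite (R := ℂ) (linearIndependent_iff'.2 fun s c hc χ hχ => ?_)
  obtain ⟨V, hV, hχV⟩ := χ.2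
  have h1 : ∀ ψ : {χ : G → ℂ | IsIrreducibleCharacter G χ},
      (Nat.card G : ℂ)⁻¹ * ∑ g : G, ψ.1 g * χ.1 g⁻¹ = if ψ = χ then 1 else 0 := by
    intro ψ
    obtain ⟨W, hW, hψW⟩ := ψ.2
    have h := FDRep.char_orthonormal W V
    have hiff : Nonempty (W ≅ V) ↔ ψ = χ := by
      refine ⟨fun ⟨i⟩ => Subtype.ext ?_, fun hψχ => ?_⟩
      · rw [hψW, hχV, FDRep.char_iso i]
      · by_contra hne
        rw [if_neg hne] at h
        have h' := FDRep.char_orthonormal V V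
        rw [if_pos ⟨CategoryTheory.Iso.refl V⟩] at h'
        have hWV : W.character = V.character :=
          hψW.symm.trans ((congrArg Subtype.val hψχ).trans hχV)
        rw [hWV] at h
        exact one_ne_zero (h'.symm.trans h)
    simp only [hiff] at h
    rw [hψW, hχV]
    exact h
  have h2 : ∑ ψ ∈ s, c ψ * ((Nat.card G : ℂ)⁻¹ * ∑ g : G, ψ.1 g * χ.1 g⁻¹) = 0 := by
    have h3 : ∀ g, ∑ ψ ∈ s, c ψ * ψ.1 g = 0 := fun g => by
      simpa [Finset.sum_apply] using congrFun hc g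
    calc _ = (Nat.card G : ℂ)⁻¹ * ∑ g : G, (∑ ψ ∈ s, c ψ * ψ.1 g) * χ.1 g⁻¹ := by
          simp only [Finset.sum_mul, Finset.mul_sum]
          rw [Finset.sum_comm]
          exact Finset.sum_congr rfl fun g _ => Finset.sum_congr rfl fun ψ _ => by ring
      _ = 0 := by simp [h3]
  simp only [h1] at h2
  simpa [hχ] using h2

omit [FiniteDimensional ℂ V] in
theorem IsIrreducible.comp_surjective {ρ : Representation ℂ H V} (hρ : IsIrreducible ρ)
    (π : G →* H) (hπ : Function.Surjective π) : IsIrreducible (ρ.comp π) := by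
  have hnt := IsIrreducible.nontrivial_space hρ
  refine { exists_pair_ne := ⟨⊥, ⊤, fun h => ?_⟩, eq_bot_or_eq_top := fun U => ?_ }
  · exact bot_ne_top (congrArg Subrepresentation.toSubmodule h)
  · let U' : Subrepresentation ρ := ⟨U.toSubmodule, fun m w hw => by
      obtain ⟨g, rfl⟩ := hπ m
      exact U.apply_mem_toSubmodule g hw⟩
    rcases IsSimpleOrder.eq_bot_or_eq_top (self := hρ) U' with h | h
    · have h' : U'.toSubmodule = ⊥ := congrArg Subrepresentation.toSubmodule h
      exact .inl (Subrepresentation.toSubmodule_injective h')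
    · have h' : U'.toSubmodule = ⊤ := congrArg Subrepresentation.toSubmodule h
      exact .inr (Subrepresentation.toSubmodule_injective h')

theorem apply_eq_one_of_character_eq [Finite G] {ρ : Representation ℂ G V}
    {σ : Representation ℂ G W} (hρ : IsIrreducible ρ) (hσ : IsIrreducible σ)
    (h : ρ.character = σ.character) {x : G} (hx : σ x = 1) : ρ x = 1 := by
  obtain ⟨β⟩ := nonempty_equiv_of_character_eq hρ hσ (congrFun h)
  refine LinearMap.ext fun v => β.toLinearEquiv.injective ?_
  have h1 : β.toLinearEquiv (ρ x v) = σ x (β.toLinearEquiv v) :=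
    IntertwiningMap.isIntertwining _ _ β.toIntertwiningMap x v
  rw [h1, hx]
  rfl

theorem isIrreducible_trivial [Finite G] : IsIrreducible (Representation.trivial ℂ G ℂ) := by
  cases nonempty_fintype G
  have hG : (Nat.card G : ℂ) ≠ 0 := Nat.cast_ne_zero.mpr Nat.card_pos.ne'
  rw [isIrreducible_iff_finrank_end, ← Nat.cast_inj (R := ℂ), finrank_intertwiningMap_eq]
  simp [Representation.character]

/-- Representations that separate consecutive normal subgroups. -/
theorem exists_isIrreducible_of_lt [Finite G] [Group.IsSolvable G] (A B : Subgroup G)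
    [A.Normal] [B.Normal] (h : A < B) :
    ∃ p : ℕ, p.Prime ∧ ∃ (d : ℕ) (τ : Representation ℂ G (Fin d → ℂ)), IsIrreducible τ ∧
      (∀ g, τ.character g ∈ Qfield p) ∧ (∀ x ∈ A, τ x = 1) ∧ ∃ x ∈ B, τ x ≠ 1 := by
  have hsurj := QuotientGroup.mk'_surjective A
  have hnormal : (B.map (QuotientGroup.mk' A)).Normal := Subgroup.Normal.map inferInstance _ hsurj
  have hne : B.map (QuotientGroup.mk' A) ≠ ⊥ := fun hb => by
    rw [Subgroup.map_eq_bot_iff, QuotientGroup.ker_mk'] at hb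
    exact not_le_of_gt h hb
  obtain ⟨p, hp, d, τ, hτ, hchar, _, ⟨x, hx, rfl⟩, hx1⟩ :=
    exists_isIrreducible_character_mem_Qfield _ hne
  refine ⟨p, hp, d, τ.comp (QuotientGroup.mk' A), IsIrreducible.comp_surjective hτ _ hsurj,
    fun g => hchar _, fun y hy => ?_, x, hx, hx1⟩
  have : QuotientGroup.mk' A y = 1 := (QuotientGroup.eq_one_iff y).2 hy
  rw [MonoidHom.comp_apply, this, map_one]

end Count

/-- Let `G` be a finite solvable group.  For any chief series
`⊥ = N 0 < N 1 < ⋯ < N r = ⊤` of `G` (each term normal in `G`, with no normal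
subgroup of `G` strictly between consecutive terms), the number `r` of factors is
at most the number of nonprincipal `Q_pp`-valued irreducible characters of `G`. -/
theorem chiefSeries_length_le_nonprincipal_Qpp_chars
    (G : Type) [Group G] [Fintype G] (hG : IsSolvable G)
    (r : ℕ) (N : ℕ → Subgroup G)
    (h0 : N 0 = ⊥) (hr : N r = ⊤)
    (hnorm : ∀ i, (N i).Normal)
    (hlt : ∀ i, i < r → N i < N (i + 1))
    (hchief : ∀ i, i < r → ∀ M : Subgroup G, M.Normal → N i ≤ M → M ≤ N (i + 1) →
      M = N i ∨ M = N (i + 1)) :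
    r ≤ {χ : G → ℂ | IsIrreducibleCharacter G χ ∧
        (∃ p : ℕ, p.Prime ∧ ∀ g, χ g ∈ Qfield p) ∧ χ ≠ fun _ => 1}.ncard := by
  have hG' : Group.IsSolvable G := hG
  choose p hp d τ hτ hchar hone x hx hx1 using fun i : Fin r =>
    exists_isIrreducible_of_lt (N i) (N (i + 1)) (hlt i i.2)
  have hmono : ∀ i j, i ≤ j → j ≤ r → N i ≤ N j := by
    intro i j hij
    induction j, hij using Nat.le_induction with
    | base => exact fun _ => le_rfl
    | succ j _ ih => exact fun hj => (ih (by omega)).trans (hlt j hj).le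
  have hne : ∀ i j : Fin r, i < j → (τ i).character ≠ (τ j).character := fun i j hij h =>
    hx1 i (apply_eq_one_of_character_eq (hτ i) (hτ j) h
      (hone j _ (hmono _ _ (Nat.succ_le_of_lt hij) j.2.le (hx i))))
  let S := {χ : G → ℂ | IsIrreducibleCharacter G χ ∧
    (∃ p : ℕ, p.Prime ∧ ∀ g, χ g ∈ Qfield p) ∧ χ ≠ fun _ => 1}
  have hfin : Finite S := (finite_setOf_isIrreducibleCharacter.subset fun χ hχ => hχ.1).to_subtype
  let f : Fin r → S := fun i => ⟨(τ i).character, isIrreducibleCharacter_character (hτ i),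
    ⟨p i, hp i, hchar i⟩, fun h => hx1 i <|
      apply_eq_one_of_character_eq (hτ i) isIrreducible_trivial
        (h.trans (funext fun g => by simp [Representation.character])) rfl⟩
  have hf : Function.Injective f := fun i j h => by
    have h' : (τ i).character = (τ j).character := congrArg Subtype.val h
    rcases lt_trichotomy i j with hij | hij | hij
    · exact (hne i j hij h').elim
    · exact hij
    · exact (hne j i hij h'.symm).elim
  calc r = Nat.card (Fin r) := (Nat.card_fin r).symm
    _ ≤ Nat.card S := Nat.card_le_card_of_injective f hf
end
end

section
/- There exists a function f : ℕ → ℕ such that for every finite solvable group G, the total number of irreducible characters of G is at most f(k), where k is the number of Q_pp-valued irreducible characters of G. -/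
open scoped Classical

noncomputable section

/-- The set of `Q_pp`-valued irreducible characters of `G`: irreducible characters all
of whose values lie in `Qfield p` for some prime `p`. -/
def QppValuedIrrChars (G : Type) [Group G] : Set (G → ℂ) :=
  {χ | IsIrreducibleCharacter G χ ∧ ∃ p : ℕ, p.Prime ∧ ∀ g, χ g ∈ Qfield p}

namespace Representation

section Schurian

variable {K G V : Type*} [Field K] [Group G] [AddCommGroup V] [Module K V]

/-- A representation is *Schurian* if its only equivariant endomorphisms are the scalars. -/
def IsSchurian (ρ : Representation K G V) : Prop :=
  ∀ f : Module.End K V, (∀ g, f * ρ g = ρ g * f) → ∃ c : K, f = c • 1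

theorem IsSchurian.finrank_smul_sum [Fintype G] [FiniteDimensional K V]
    {ρ : Representation K G V} (hρ : ρ.IsSchurian) (φ : Module.Dual K V) (v w : V) :
    (Module.finrank K V : K) • ∑ g, φ (ρ g⁻¹ w) • ρ g v = ((Fintype.card G : K) * φ v) • w := by
  let Z : Module.End K V := ∑ g, ρ g * φ.smulRight v * ρ g⁻¹
  have hZ : ∀ h, Z * ρ h = ρ h * Z := by
    intro h
    simp only [Z, Finset.sum_mul, Finset.mul_sum]
    refine Fintype.sum_equiv (Equiv.mulLeft h⁻¹) _ _ fun g => ?_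
    simp only [Equiv.coe_mulLeft, mul_inv_rev, inv_inv, map_mul, mul_assoc]
    rw [← mul_assoc (ρ h) (ρ h⁻¹), ← map_mul ρ h h⁻¹]
    simp
  obtain ⟨c, hc⟩ := hρ Z hZ
  have htr : (Fintype.card G : K) * φ v = c * Module.finrank K V := by
    have h1 : LinearMap.trace K V Z = c * Module.finrank K V := by rw [hc]; simp
    rw [← h1]
    simp only [Z, map_sum]
    have : ∀ g, LinearMap.trace K V (ρ g * φ.smulRight v * ρ g⁻¹) = φ v := by
      intro g
      rw [LinearMap.trace_mul_comm, ← mul_assoc, ← map_mul]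
      simp
    simp [this]
  have hw : Z w = c • w := by rw [hc]; rfl
  have hw' : Z w = ∑ g, φ (ρ g⁻¹ w) • ρ g v := by
    simp [Z, LinearMap.sum_apply]
  rw [← hw', hw, htr, smul_smul, mul_comm]

variable [CharZero K] [FiniteDimensional K V]

theorem IsSchurian.eq_zero_of_trace_mul_eq_zero [Finite G] {ρ : Representation K G V}
    (hρ : ρ.IsSchurian) {X : Module.End K V}
    (hX : ∀ g, LinearMap.trace K V (X * ρ g) = 0) : X = 0 := by
  have := Fintype.ofFinite G
  have key : ∀ (φ : Module.Dual K V) (w : V), (Fintype.card G : K) * φ (X w) = 0 := by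
    intro φ w
    have h : (Module.finrank K V : K) • ∑ g, φ (ρ g⁻¹ w) • ρ g
        = (Fintype.card G : K) • φ.smulRight w := by
      ext v
      have := hρ.finrank_smul_sum φ v w
      simpa [LinearMap.sum_apply, smul_smul] using this
    have h2 := congrArg (fun Y => LinearMap.trace K V (X * Y)) h
    simp only [mul_smul_comm, map_smul, Finset.mul_sum, map_sum, hX, smul_zero,
      Finset.sum_const_zero] at h2
    have h3 : LinearMap.trace K V (X * φ.smulRight w) = φ (X w) := by
      have : X * φ.smulRight w = φ.smulRight (X w) := by ext; simp
      rw [this]; simp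
    rw [h3] at h2
    simpa using h2.symm
  ext w
  refine (Module.forall_dual_apply_eq_zero_iff K _).1 fun φ => ?_
  simpa using key φ w

theorem IsSchurian.sum_trace [Fintype G] [Nontrivial V] {ρ : Representation K G V}
    (hρ : ρ.IsSchurian) :
    ∑ g, LinearMap.trace K V (ρ g) * LinearMap.trace K V (ρ g⁻¹) = Fintype.card G := by
  let b := Module.finBasis K V
  have hd : (Module.finrank K V : K) ≠ 0 := by
    exact_mod_cast (Module.finrank_pos (R := K) (M := V)).ne'
  have key : ∀ i, (Module.finrank K V : K) * ∑ g, b.coord i (ρ g⁻¹ (b i)) *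
      LinearMap.trace K V (ρ g) = Fintype.card G := by
    intro i
    have h : (Module.finrank K V : K) • ∑ g, b.coord i (ρ g⁻¹ (b i)) • ρ g
        = (Fintype.card G : K) • (b.coord i).smulRight (b i) := by
      ext v
      have := hρ.finrank_smul_sum (b.coord i) v (b i)
      simpa [LinearMap.sum_apply, smul_smul] using this
    have h2 := congrArg (LinearMap.trace K V) h
    simpa using h2
  have htr : ∀ g, LinearMap.trace K V (ρ g⁻¹) = ∑ i, b.coord i (ρ g⁻¹ (b i)) := by
    intro g
    rw [LinearMap.trace_eq_matrix_trace K b, Matrix.trace]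
    simp [LinearMap.toMatrix_apply]
  apply mul_left_cancel₀ hd
  simp_rw [htr, Finset.mul_sum]
  rw [Finset.sum_comm]
  have : ∀ i, ∑ g, (Module.finrank K V : K) * (LinearMap.trace K V (ρ g) *
      b.coord i (ρ g⁻¹ (b i))) = Fintype.card G := by
    intro i
    rw [← key i, Finset.mul_sum]
    simp_rw [mul_comm]
  simp only [this]
  simp

theorem IsSchurian.injective_of_intertwines [Finite G] {V' : Type*} [AddCommGroup V']
    [Module K V'] {ρ : Representation K G V} (hρ : ρ.IsSchurian)
    {ρ' : G → Module.End K V'} {h : V →ₗ[K] V'} (hh : ∀ g v, h (ρ g v) = ρ' g (h v))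
    (h0 : h ≠ 0) : Function.Injective h := by
  have := Fintype.ofFinite G
  rw [injective_iff_map_eq_zero]
  intro v hv
  refine (Module.forall_dual_apply_eq_zero_iff K _).1 fun φ => ?_
  by_contra hφ
  apply h0
  ext w
  have h1 := congrArg h (hρ.finrank_smul_sum φ v w)
  simp only [map_smul, map_sum, hh, hv, map_zero, smul_zero, Finset.sum_const_zero] at h1
  simpa [hφ, Fintype.card_ne_zero] using h1.symm

end Schurian

section Coinduced

variable {K G W : Type*} [Field K] [Group G] [AddCommGroup W] [Module K W]
  (T : Subgroup G) (ψ : Representation K T W)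

/-- The element of the coinduced representation supported on the subgroup `T` with
value `w` at the identity. -/
def coindSingle (w : W) : coindV T.subtype ψ :=
  ⟨fun g => if h : g ∈ T then ψ ⟨g, h⟩ w else 0, by
    intro t g
    by_cases h : g ∈ T
    · have h' : T.subtype t * g ∈ T := T.mul_mem t.2 h
      change dite _ _ _ = ψ t (dite _ _ _)
      rw [dif_pos h, dif_pos h', ← Module.End.mul_apply, ← map_mul]
      rfl
    · have h' : (t : G) * g ∉ T := fun h' => h ((T.mul_mem_cancel_left t.2).1 h')
      simp [h, h']⟩

theorem coindSingle_apply_of_mem {g : G} (h : g ∈ T) (w : W) :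
    (coindSingle T ψ w).1 g = ψ ⟨g, h⟩ w := by simp [coindSingle, h]

theorem coindSingle_apply_of_notMem {g : G} (h : g ∉ T) (w : W) :
    (coindSingle T ψ w).1 g = 0 := by simp [coindSingle, h]

theorem coindSingle_one (w : W) : (coindSingle T ψ w).1 1 = w := by
  rw [coindSingle_apply_of_mem T ψ T.one_mem]
  exact congrArg (fun f => f w) (map_one ψ)

theorem coind_coindSingle (t : T) (w : W) :
    coind T.subtype ψ t (coindSingle T ψ w) = coindSingle T ψ (ψ t w) := by
  ext g
  change (coindSingle T ψ w).1 (g * t) = (coindSingle T ψ (ψ t w)).1 g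
  by_cases h : g ∈ T
  · rw [coindSingle_apply_of_mem T ψ h, coindSingle_apply_of_mem T ψ (T.mul_mem h t.2),
      ← Module.End.mul_apply, ← map_mul]
    rfl
  · rw [coindSingle_apply_of_notMem T ψ h, coindSingle_apply_of_notMem T ψ
      fun h' => h ((T.mul_mem_cancel_right t.2).1 h')]

theorem coind_apply_val (x : G) (f : coindV T.subtype ψ) (g : G) :
    (coind T.subtype ψ x f).1 g = f.1 (g * x) := rfl

theorem coindV_val_mul (f : coindV T.subtype ψ) {t : G} (ht : t ∈ T) (g : G) :
    f.1 (t * g) = ψ ⟨t, ht⟩ (f.1 g) := f.2 ⟨t, ht⟩ g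

/-- `coindSingle` as a linear map. -/
def coindSingleHom : W →ₗ[K] coindV T.subtype ψ where
  toFun := coindSingle T ψ
  map_add' v w := by
    ext g
    by_cases h : g ∈ T
    · simp [coindSingle_apply_of_mem T ψ h]
    · simp [coindSingle_apply_of_notMem T ψ h]
  map_smul' c w := by
    ext g
    by_cases h : g ∈ T
    · simp [coindSingle_apply_of_mem T ψ h]
    · simp [coindSingle_apply_of_notMem T ψ h]

theorem sum_coind_coindSingle [Fintype G] (f : coindV T.subtype ψ) :
    ∑ g, coind T.subtype ψ g⁻¹ (coindSingle T ψ (f.1 g)) = Nat.card T • f := by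
  ext h
  have hval : (∑ g, coind T.subtype ψ g⁻¹ (coindSingle T ψ (f.1 g))).1 h =
      ∑ g, if h * g⁻¹ ∈ T then f.1 h else 0 := by
    rw [AddSubmonoidClass.coe_finsetSum, Finset.sum_apply]
    refine Finset.sum_congr rfl fun g _ => ?_
    rw [coind_apply_val]
    split_ifs with hg
    · rw [coindSingle_apply_of_mem T ψ hg, ← coindV_val_mul]
      simp
    · rw [coindSingle_apply_of_notMem T ψ hg]
  rw [hval, ← Finset.sum_filter, Finset.sum_const]
  have : (Finset.univ.filter fun g => h * g⁻¹ ∈ T).card = Nat.card T := by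
    rw [Nat.card_eq_fintype_card, Fintype.card_subtype]
    refine Finset.card_bij (fun g _ => h * g⁻¹) (by simp) (by simp) fun b hb => ⟨b⁻¹ * h, ?_, ?_⟩
    · simpa using hb
    · simp
  rw [this]
  rfl

/-- Clifford's criterion: a Schurian representation of `T` whose restriction to a normal subgroup
`N` has no nonzero intertwiner with its conjugates by elements outside `T` coinduces
to a Schurian representation. -/
theorem IsSchurian.coind [Finite G] [CharZero K] {T : Subgroup G} {ψ : Representation K T W}
    (hψ : ψ.IsSchurian) {N : Subgroup G} [hN : N.Normal] (hNT : N ≤ T)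
    (h : ∀ g ∉ T, ∀ f : Module.End K W,
      (∀ n (hn : n ∈ N), f * ψ ⟨n, hNT hn⟩ = ψ ⟨g * n * g⁻¹, hNT (hN.conj_mem n hn g)⟩ * f) →
      f = 0) :
    (Representation.coind T.subtype ψ).IsSchurian := by
  have := Fintype.ofFinite G
  intro F hF
  have hF' : ∀ g v, F (Representation.coind T.subtype ψ g v) =
      Representation.coind T.subtype ψ g (F v) := fun g v =>
    LinearMap.congr_fun (hF g) v
  let c (g : G) : Module.End K W :=
    { toFun := fun w => (F (coindSingleHom T ψ w)).1 g
      map_add' := by intros; simp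
      map_smul' := by intros; simp }
  have hc : ∀ g w, c g w = (F (coindSingle T ψ w)).1 g := fun _ _ => rfl
  have hc0 : ∀ g ∉ T, c g = 0 := by
    intro g hg
    refine h g hg _ fun n hn => ?_
    ext w
    rw [Module.End.mul_apply, Module.End.mul_apply, hc, hc, ← coind_coindSingle, hF',
      coind_apply_val, ← coindV_val_mul]
    simp
  obtain ⟨a, ha⟩ := hψ (c 1) (by
    intro t
    ext w
    rw [Module.End.mul_apply, Module.End.mul_apply, hc, hc, ← coind_coindSingle, hF',
      coind_apply_val, one_mul]
    have := coindV_val_mul T ψ (F (coindSingle T ψ w)) t.2 1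
    rw [mul_one] at this
    exact this)
  have hs : ∀ w, F (coindSingle T ψ w) = a • coindSingle T ψ w := by
    intro w
    ext g
    by_cases hg : g ∈ T
    · have h1 := coindV_val_mul T ψ (F (coindSingle T ψ w)) hg 1
      have h2 := coindV_val_mul T ψ (a • coindSingle T ψ w) hg 1
      rw [mul_one] at h1 h2
      rw [h1, h2]
      congr 1
      rw [← hc, ha]
      simp [coindSingle_one]
    · rw [← hc, hc0 g hg]
      simp [coindSingle_apply_of_notMem T ψ hg]
  refine ⟨a, ?_⟩
  ext1 f
  have hT : (Nat.card T : K) ≠ 0 := by exact_mod_cast Nat.card_pos.ne'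
  have h1 := congrArg F (sum_coind_coindSingle T ψ f)
  rw [map_sum] at h1
  simp only [hF', hs, map_smul] at h1
  rw [← Finset.smul_sum, sum_coind_coindSingle, map_nsmul, ← Nat.cast_smul_eq_nsmul K,
    ← Nat.cast_smul_eq_nsmul K, smul_comm] at h1
  exact (smul_right_injective _ hT h1).symm

instance [Nontrivial W] : Nontrivial (coindV T.subtype ψ) := by
  obtain ⟨w, hw⟩ := exists_ne (0 : W)
  refine ⟨coindSingle T ψ w, 0, fun h => hw ?_⟩
  rw [← coindSingle_one T ψ w, h]
  rfl

theorem finrank_coindV [Finite G] [FiniteDimensional K W] :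
    Module.finrank K (coindV T.subtype ψ) = T.index * Module.finrank K W := by
  have hmem : ∀ g : G,
      g * (Quotient.out (Quotient.mk (QuotientGroup.rightRel T) g))⁻¹ ∈ T := fun g =>
    QuotientGroup.rightRel_apply.1 (Quotient.mk_out (s := QuotientGroup.rightRel T) g)
  let e : coindV T.subtype ψ ≃ₗ[K] (Quotient (QuotientGroup.rightRel T) → W) :=
    { toFun := fun f q => f.1 q.out
      map_add' := fun _ _ => rfl
      map_smul' := fun _ _ => rfl
      invFun := fun F => ⟨fun g => ψ ⟨_, hmem g⟩ (F (Quotient.mk _ g)), by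
        intro t g
        have hq : Quotient.mk (QuotientGroup.rightRel T) (t * g) = Quotient.mk _ g :=
          Quotient.sound (QuotientGroup.rightRel_apply.2 (by simp))
        rw [← Module.End.mul_apply, ← map_mul]
        simp only [Subgroup.coe_subtype, hq]
        congr 2
        ext
        simp [mul_assoc]⟩
      left_inv := fun f => by
        ext g
        change ψ ⟨_, hmem g⟩ (f.1 _) = f.1 g
        rw [← coindV_val_mul]
        simp
      right_inv := fun F => by
        ext q
        change ψ ⟨_, hmem _⟩ (F (Quotient.mk _ q.out)) = F q
        have : (⟨_, hmem q.out⟩ : T) = 1 := by ext; simp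
        rw [this, map_one]
        simp }
  have := Fintype.ofFinite G
  rw [e.finrank_eq, Module.finrank_pi_fintype, Finset.sum_const, Finset.card_univ, smul_eq_mul,
    Fintype.card_congr (QuotientGroup.quotientRightRelEquivQuotientLeftRel T),
    ← Nat.card_eq_fintype_card]
  rfl

end Coinduced

end Representation

theorem Module.End.exists_pow_eq_of_pow_eq_smul_one {K V : Type*} [Field K] [AddCommGroup V]
    [Module K V] [FiniteDimensional K V] {q : ℕ} [NeZero q] {ζ : K} (hζ : IsPrimitiveRoot ζ q)
    {Y : Module.End K V} {c : K} (hY : Y ^ q = c • 1) (htr : LinearMap.trace K V Y ≠ 0) :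
    ∃ γ : K, γ ^ q = c := by
  by_cases hc : c = 0
  · exact ⟨0, by rw [hc, zero_pow (NeZero.ne q)]⟩
  let L := AlgebraicClosure K
  let f : Module.End L (TensorProduct K L V) := Y.baseChange L
  have hf : f ^ q = algebraMap K L c • 1 := by
    have h1 : f ^ q = (Y ^ q).baseChange L := (LinearMap.baseChange_pow ..).symm
    rw [h1, hY]
    ext v
    simp [TensorProduct.smul_tmul', Algebra.smul_def, TensorProduct.tmul_smul]
  obtain ⟨γ₀, hγ₀⟩ := IsAlgClosed.exists_pow_nat_eq (algebraMap K L c) (NeZero.pos q)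
  have hc' : algebraMap K L c ≠ 0 := by simpa using hc
  have hγ0 : γ₀ ≠ 0 := by
    rintro rfl
    rw [zero_pow (NeZero.ne q)] at hγ₀
    exact hc' hγ₀.symm
  have hroot : ∀ μ ∈ f.charpoly.roots, ∃ k : K, μ = γ₀ * algebraMap K L k := by
    intro μ hμ
    have hev : f.HasEigenvalue μ :=
      (Module.End.hasEigenvalue_iff_isRoot_charpoly f μ).2 (Polynomial.isRoot_of_mem_roots hμ)
    obtain ⟨v, hv⟩ := hev.exists_hasEigenvector
    have h1 : μ ^ q • v = algebraMap K L c • v := by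
      rw [← hv.pow_apply, hf]
      rfl
    have h2 : μ ^ q = algebraMap K L c := smul_left_injective L hv.2 h1
    have h3 : (μ / γ₀) ^ q = 1 := by
      rw [div_pow, h2, hγ₀, div_self hc']
    obtain ⟨i, -, hi⟩ := (hζ.map_of_injective (algebraMap K L).injective).eq_pow_of_pow_eq_one h3
    exact ⟨ζ ^ i, by rw [map_pow, hi, mul_div_cancel₀ _ hγ0]⟩
  have hsum : ∃ k : K, f.charpoly.roots.sum = γ₀ * algebraMap K L k := by
    revert hroot
    induction f.charpoly.roots using Multiset.induction_on with
    | empty => exact fun _ => ⟨0, by simp⟩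
    | cons a s ih =>
      intro h
      obtain ⟨k, hk⟩ := ih fun μ hμ => h μ (Multiset.mem_cons_of_mem hμ)
      obtain ⟨l, hl⟩ := h a (Multiset.mem_cons_self a s)
      exact ⟨l + k, by rw [Multiset.sum_cons, hk, hl, map_add, mul_add]⟩
  obtain ⟨k, hk⟩ := hsum
  rw [← Module.End.trace_eq_sum_roots_charpoly_of_splits (IsAlgClosed.splits _),
    LinearMap.trace_baseChange] at hk
  have hk0 : algebraMap K L k ≠ 0 := by
    intro h
    rw [h, mul_zero] at hk
    exact htr (by simpa using hk)
  refine ⟨LinearMap.trace K V Y / k, (algebraMap K L).injective ?_⟩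
  rw [map_pow, map_div₀, hk, mul_div_cancel_right₀ _ hk0, hγ₀]

namespace Representation

section ConjExtension

variable {K G V : Type*} [Field K] [Group G] [AddCommGroup V] [Module K V]

/-- Nonzero scalars as invertible endomorphisms. -/
def scalarUnit (K V : Type*) [Field K] [AddCommGroup V] [Module K V] :
    Kˣ →* (Module.End K V)ˣ :=
  Units.map (algebraMap K (Module.End K V) : K →* Module.End K V)

theorem scalarUnit_mul_comm (a : Kˣ) (X : (Module.End K V)ˣ) :
    scalarUnit K V a * X = X * scalarUnit K V a :=
  Units.ext (Algebra.commutes (a : K) (X : Module.End K V))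

theorem val_scalarUnit (a : Kˣ) : (scalarUnit K V a : Module.End K V) = (a : K) • 1 :=
  Algebra.algebraMap_eq_smul_one (a : K)

theorem scalarUnit_injective [Nontrivial V] : Function.Injective (scalarUnit K V) :=
  Units.map_injective (algebraMap K (Module.End K V)).injective

/-- The determinant of an invertible endomorphism. -/
abbrev detUnit (K V : Type*) [Field K] [AddCommGroup V] [Module K V] :
    (Module.End K V)ˣ →* Kˣ :=
  Units.map LinearMap.det

theorem detUnit_scalarUnit [FiniteDimensional K V] (a : Kˣ) :
    detUnit K V (scalarUnit K V a) = a ^ Module.finrank K V := by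
  ext
  simp [val_scalarUnit]

variable {M : Subgroup G} [M.Normal] (θ : Representation K M V)

/-- The group of pairs `(g, X)` where `X` intertwines `θ` with its conjugate by `g` and
`det X` lies in the given group of scalars. -/
def conjExtension (D : Subgroup Kˣ) : Subgroup (G × (Module.End K V)ˣ) where
  carrier := {x | (∀ n, x.2 * θ.toHomUnits n = θ.toHomUnits (MulAut.conjNormal x.1 n) * x.2) ∧
    detUnit K V x.2 ∈ D}
  one_mem' := by
    refine ⟨fun n => ?_, ?_⟩
    · simp
    · rw [Prod.snd_one, map_one]
      exact D.one_mem
  mul_mem' := by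
    rintro ⟨g, X⟩ ⟨h, Y⟩ ⟨hX, hX'⟩ ⟨hY, hY'⟩
    refine ⟨fun n => ?_, ?_⟩
    · dsimp only [Prod.mk_mul_mk] at *
      rw [mul_assoc, hY, ← mul_assoc, hX, mul_assoc, map_mul, MulAut.mul_apply]
    · rw [Prod.snd_mul, map_mul]
      exact D.mul_mem hX' hY'
  inv_mem' := by
    rintro ⟨g, X⟩ ⟨hX, hX'⟩
    refine ⟨fun n => ?_, ?_⟩
    · dsimp only [Prod.inv_mk] at *
      rw [inv_mul_eq_iff_eq_mul, ← mul_assoc, hX, mul_assoc, mul_inv_cancel, mul_one,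
        ← MulAut.mul_apply, ← map_mul, mul_inv_cancel, map_one]
      rfl
    · rw [Prod.snd_inv, map_inv]
      exact D.inv_mem hX'

variable {θ}

theorem conjExtension_mono {D E : Subgroup Kˣ} (h : D ≤ E) :
    conjExtension θ D ≤ conjExtension θ E := fun _ hx => ⟨hx.1, h hx.2⟩

theorem mk_toHomUnits_mem_conjExtension {D : Subgroup Kˣ} (m : M)
    (hD : detUnit K V (θ.toHomUnits m) ∈ D) :
    ((m : G), θ.toHomUnits m) ∈ conjExtension θ D := by
  refine ⟨fun n => ?_, hD⟩
  dsimp only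
  rw [← map_mul, ← map_mul, MulAut.conjNormal_val]
  simp

theorem IsSchurian.exists_eq_scalarUnit_mul [Nontrivial V] (hθ : θ.IsSchurian)
    {D E : Subgroup Kˣ} {g : G} {X Y : (Module.End K V)ˣ} (hX : (g, X) ∈ conjExtension θ D)
    (hY : (g, Y) ∈ conjExtension θ E) : ∃ a, X = scalarUnit K V a * Y := by
  have hcomm : ∀ n, (Y⁻¹ * X) * θ.toHomUnits n = θ.toHomUnits n * (Y⁻¹ * X) := by
    intro n
    have h1 := hX.1 n
    have h2 := hY.1 n
    dsimp only at h1 h2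
    rw [mul_assoc, h1, ← mul_assoc, ← mul_assoc]
    congr 1
    rw [inv_mul_eq_iff_eq_mul, ← mul_assoc, h2, mul_assoc, mul_inv_cancel, mul_one]
  obtain ⟨c, hc⟩ := hθ ((Y⁻¹ * X : (Module.End K V)ˣ) : Module.End K V) fun n => by
    exact congrArg Units.val (hcomm n)
  have hc0 : c ≠ 0 := by
    rintro rfl
    rw [zero_smul] at hc
    exact (Y⁻¹ * X).ne_zero hc
  refine ⟨Units.mk0 c hc0, ?_⟩
  rw [scalarUnit_mul_comm, ← inv_mul_eq_iff_eq_mul]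
  ext1
  rw [hc, val_scalarUnit]
  rfl

end ConjExtension

section Lift

variable {K G V : Type*} [Field K] [Group G] [AddCommGroup V] [Module K V]
  {M : Subgroup G} [M.Normal] {θ : Representation K M V}

theorem scalarUnit_mul_mem_conjExtension {D E : Subgroup Kˣ} {g : G} {X : (Module.End K V)ˣ}
    (hX : (g, X) ∈ conjExtension θ E) {a : Kˣ} (ha : detUnit K V (scalarUnit K V a * X) ∈ D) :
    (g, scalarUnit K V a * X) ∈ conjExtension θ D := by
  refine ⟨fun n => ?_, ha⟩
  dsimp only
  rw [mul_assoc, hX.1 n, ← mul_assoc, ← mul_assoc, scalarUnit_mul_comm]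

theorem le_map_fst_conjExtension {D : Subgroup Kˣ}
    (hD : ∀ m, detUnit K V (θ.toHomUnits m) ∈ D) :
    M ≤ (conjExtension θ D).map (MonoidHom.fst _ _) :=
  fun m hm => ⟨_, mk_toHomUnits_mem_conjExtension ⟨m, hm⟩ (hD _), rfl⟩

theorem toHomUnits_pow_eq_one {H : Type*} [Group H] {θ : Representation K H V} {q : ℕ}
    (he : ∀ m, θ m ^ q = 1) (m : H) :
    θ.toHomUnits m ^ q = 1 := Units.ext (he m)

theorem detUnit_toHomUnits_mem {p e : ℕ} {H : Type*} [Group H] {θ : Representation K H V}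
    (he : ∀ m, θ m ^ p ^ e = 1) (m : H) :
    detUnit K V (θ.toHomUnits m) ∈ CommGroup.primaryComponent Kˣ p :=
  CommGroup.mem_primaryComponent.2 ⟨e, by rw [← map_pow, toHomUnits_pow_eq_one he, map_one]⟩

variable [FiniteDimensional K V] [Nontrivial V] {p : ℕ}

theorem IsSchurian.mem_map_conjExtension_of_pow_coprime_mem (hθ : θ.IsSchurian)
    {j : ℕ} (hd : Module.finrank K V = p ^ j) {e : ℕ} (he : ∀ m, θ m ^ p ^ e = 1)
    {x : G} (hx : x ∈ (conjExtension θ ⊤).map (MonoidHom.fst _ _)) {m : ℕ}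
    (hm : m.Coprime p) (hxm : x ^ m ∈ M) :
    x ∈ (conjExtension θ (CommGroup.primaryComponent Kˣ p)).map (MonoidHom.fst _ _) := by
  obtain ⟨⟨x, X⟩, hX, rfl⟩ := hx
  dsimp only [MonoidHom.coe_fst] at hxm ⊢
  obtain ⟨c, hc⟩ := hθ.exists_eq_scalarUnit_mul (pow_mem hX m)
    (mk_toHomUnits_mem_conjExtension (θ := θ) (D := ⊤) ⟨_, hxm⟩ (Subgroup.mem_top _))
  replace hc : X ^ m = _ := hc
  set η := detUnit K V (θ.toHomUnits ⟨_, hxm⟩) with hη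
  have hη1 : η ∈ CommGroup.primaryComponent Kˣ p := detUnit_toHomUnits_mem he _
  have hdet : detUnit K V X ^ m = c ^ p ^ j * η := by
    rw [← map_pow, hc, map_mul, detUnit_scalarUnit, hd]
  obtain ⟨u, v, huv⟩ : ∃ u v : ℤ, u * m + v * (p ^ j : ℕ) = 1 :=
    Nat.isCoprime_iff_coprime.2 (hm.pow_right j)
  set δ := detUnit K V X with hδ
  have hkey : δ = (c ^ u * δ ^ v) ^ p ^ j * η ^ u := by
    calc δ = δ ^ (u * m + v * (p ^ j : ℕ)) := by rw [huv, zpow_one]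
      _ = (δ ^ m) ^ u * (δ ^ v) ^ p ^ j := by
        rw [zpow_add, mul_comm u, zpow_mul, zpow_natCast, zpow_mul, zpow_natCast]
      _ = _ := by
        rw [hdet, mul_zpow, mul_pow, ← zpow_natCast (c ^ u), ← zpow_natCast c, ← zpow_mul,
          ← zpow_mul, mul_comm u, mul_right_comm]
  refine ⟨_, scalarUnit_mul_mem_conjExtension hX (a := (c ^ u * δ ^ v)⁻¹) ?_, rfl⟩
  rw [map_mul, detUnit_scalarUnit, hd, ← hδ, inv_pow]
  nth_rewrite 2 [hkey]
  rw [inv_mul_cancel_left]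
  exact zpow_mem hη1 u

theorem IsSchurian.exists_eq_scalarUnit_of_mk_one_mem (hθ : θ.IsSchurian)
    {j : ℕ} (hd : Module.finrank K V = p ^ j) {s : ℕ} {X : (Module.End K V)ˣ}
    (hX : (1, X) ∈ conjExtension θ (rootsOfUnity (p ^ s) K)) :
    ∃ a ∈ rootsOfUnity (p ^ (j + s)) K, X = scalarUnit K V a := by
  obtain ⟨a, ha⟩ := hθ.exists_eq_scalarUnit_mul hX (one_mem (conjExtension θ ⊤))
  rw [mul_one] at ha
  refine ⟨a, ?_, ha⟩
  have h := hX.2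
  dsimp only at h
  rwa [ha, detUnit_scalarUnit, hd, mem_rootsOfUnity, ← pow_mul, ← pow_add] at h

theorem IsSchurian.isSolvable_conjExtension [Group.IsSolvable G] (hθ : θ.IsSchurian)
    {j : ℕ} (hd : Module.finrank K V = p ^ j) (s : ℕ) :
    Group.IsSolvable (conjExtension θ (rootsOfUnity (p ^ s) K)) := by
  let f := (MonoidHom.fst G (Module.End K V)ˣ).comp
    (conjExtension θ (rootsOfUnity (p ^ s) K)).subtype
  suffices Group.IsSolvable f.ker from
    Group.isSolvable_of_ker_le_range f.ker.subtype f (by simp)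
  refine Group.isSolvable_of_comm ?_
  rintro ⟨⟨⟨g, X⟩, hX⟩, rfl : g = 1⟩ ⟨⟨⟨h, Y⟩, hY⟩, rfl : h = 1⟩
  obtain ⟨a, -, ha⟩ := hθ.exists_eq_scalarUnit_of_mk_one_mem hd hX
  refine Subtype.ext (Subtype.ext (Prod.ext rfl ?_))
  change X * Y = Y * X
  rw [ha, scalarUnit_mul_comm]

variable [Fact p.Prime]

theorem IsSchurian.finite_conjExtension [Finite G] (hθ : θ.IsSchurian)
    {j : ℕ} (hd : Module.finrank K V = p ^ j) (s : ℕ) :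
    Finite (conjExtension θ (rootsOfUnity (p ^ s) K)) := by
  let f := (MonoidHom.fst G (Module.End K V)ˣ).comp
    (conjExtension θ (rootsOfUnity (p ^ s) K)).subtype
  have : NeZero (p ^ (j + s)) := ⟨pow_ne_zero _ (Fact.out : p.Prime).ne_zero⟩
  have hk : Finite f.ker := by
    have key : ∀ x : f.ker, ∃ a : rootsOfUnity (p ^ (j + s)) K, x.1.1.2 = scalarUnit K V a := by
      rintro ⟨⟨⟨g, X⟩, hX⟩, rfl : g = 1⟩
      obtain ⟨a, ha, h⟩ := hθ.exists_eq_scalarUnit_of_mk_one_mem hd hX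
      exact ⟨⟨a, ha⟩, h⟩
    choose a ha using key
    refine Finite.of_injective a fun x y hxy => ?_
    have hx : x.1.1.1 = 1 := x.2
    have hy : y.1.1.1 = 1 := y.2
    exact Subtype.ext (Subtype.ext (Prod.ext (hx.trans hy.symm) (by rw [ha, ha, hxy])))
  have : Finite f.range := inferInstance
  exact f.finite_iff_finite_ker_range.2 ⟨hk, this⟩

variable [CharZero K]

theorem IsSchurian.mem_map_conjExtension_of_pow_prime_pow_mem [Finite G] (hθ : θ.IsSchurian)
    (hK : ∀ r, ∃ ζ : K, IsPrimitiveRoot ζ (p ^ r)) {e : ℕ} (he : ∀ m, θ m ^ p ^ e = 1)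
    {x : G} (hx : x ∈ (conjExtension θ ⊤).map (MonoidHom.fst _ _)) {r : ℕ}
    (hr : x ^ p ^ r ∈ M) :
    x ∈ (conjExtension θ (CommGroup.primaryComponent Kˣ p)).map (MonoidHom.fst _ _) := by
  obtain ⟨⟨x, X⟩, hX, rfl⟩ := hx
  dsimp only [MonoidHom.coe_fst] at hr ⊢
  obtain ⟨y, hy⟩ : ∃ y, LinearMap.trace K V (X * θ y) ≠ 0 := by
    by_contra! h
    exact X.ne_zero (hθ.eq_zero_of_trace_mul_eq_zero h)
  set Y := X * θ.toHomUnits y with hYdef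
  have hY : (x * y, Y) ∈ conjExtension θ ⊤ :=
    mul_mem hX (mk_toHomUnits_mem_conjExtension y (Subgroup.mem_top _))
  have hz : (x * y) ^ p ^ r ∈ M := by
    rw [← QuotientGroup.eq_one_iff] at hr ⊢
    simpa [(QuotientGroup.eq_one_iff (y : G)).2 y.2] using hr
  obtain ⟨c, hc⟩ := hθ.exists_eq_scalarUnit_mul (pow_mem hY (p ^ r))
    (mk_toHomUnits_mem_conjExtension (θ := θ) (D := ⊤) ⟨_, hz⟩ (Subgroup.mem_top _))
  have hYp : Y ^ p ^ (r + e) = scalarUnit K V (c ^ p ^ e) := by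
    rw [pow_add, pow_mul]
    have hc' : Y ^ p ^ r = _ := hc
    rw [hc', (show Commute _ _ from scalarUnit_mul_comm c _).mul_pow,
      toHomUnits_pow_eq_one he, mul_one, map_pow]
  obtain ⟨ζ, hζ⟩ := hK (r + e)
  have : NeZero (p ^ (r + e)) := ⟨pow_ne_zero _ (Fact.out : p.Prime).ne_zero⟩
  obtain ⟨γ, hγ⟩ := Module.End.exists_pow_eq_of_pow_eq_smul_one hζ
    (Y := (Y : Module.End K V)) (c := ((c ^ p ^ e : Kˣ) : K)) (by
      rw [← val_scalarUnit, ← hYp, Units.val_pow_eq_pow_val]) hy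
  have hγ0 : γ ≠ 0 := by
    rintro rfl
    rw [zero_pow (NeZero.ne _)] at hγ
    exact (c ^ p ^ e).ne_zero hγ.symm
  have hγ' : (Units.mk0 γ hγ0) ^ p ^ (r + e) = c ^ p ^ e := Units.ext hγ
  have hY' : (x * y, scalarUnit K V (Units.mk0 γ hγ0)⁻¹ * Y) ∈
      conjExtension θ (CommGroup.primaryComponent Kˣ p) := by
    refine scalarUnit_mul_mem_conjExtension hY (CommGroup.mem_primaryComponent.2 ⟨r + e, ?_⟩)
    rw [← map_pow, (show Commute _ _ from scalarUnit_mul_comm _ _).mul_pow, hYp, ← map_pow,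
      inv_pow, hγ', ← map_mul, inv_mul_cancel, map_one, map_one]
  have hxy : x * y ∈ (conjExtension θ (CommGroup.primaryComponent Kˣ p)).map
      (MonoidHom.fst _ _) := ⟨_, hY', rfl⟩
  exact (Subgroup.mul_mem_cancel_right _
    (le_map_fst_conjExtension (detUnit_toHomUnits_mem he) y.2)).1 hxy

theorem IsSchurian.exists_conjExtension_map_eq_top [Finite G] (hθ : θ.IsSchurian)
    (hK : ∀ r, ∃ ζ : K, IsPrimitiveRoot ζ (p ^ r)) {j : ℕ} (hd : Module.finrank K V = p ^ j)
    {e : ℕ} (he : ∀ m, θ m ^ p ^ e = 1)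
    (hG : (conjExtension θ ⊤).map (MonoidHom.fst _ _) = ⊤) :
    ∃ s, e ≤ s ∧ (conjExtension θ (rootsOfUnity (p ^ s) K)).map (MonoidHom.fst _ _) = ⊤ := by
  have hp : p.Prime := Fact.out
  have h1 : ∀ x : G,
      x ∈ (conjExtension θ (CommGroup.primaryComponent Kˣ p)).map (MonoidHom.fst _ _) := by
    intro x
    obtain ⟨r, m, hm, hcard⟩ := Nat.exists_eq_pow_mul_and_not_dvd
      (Nat.card_pos (α := G)).ne' p hp.ne_one
    have hmp : m.Coprime p := ((hp.coprime_iff_not_dvd).2 hm).symm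
    have h2 : x ^ m ∈ _ := hθ.mem_map_conjExtension_of_pow_prime_pow_mem (x := x ^ m) hK he
      (hG ▸ Subgroup.mem_top _) (r := r) (by
        rw [← pow_mul, mul_comm, ← hcard, pow_card_eq_one']; exact M.one_mem)
    have h3 : x ^ p ^ r ∈ _ := hθ.mem_map_conjExtension_of_pow_coprime_mem (x := x ^ p ^ r) hd he
      (hG ▸ Subgroup.mem_top _) hmp (by
        rw [← pow_mul, ← hcard, pow_card_eq_one']; exact M.one_mem)
    obtain ⟨u, v, huv⟩ : ∃ u v : ℤ, u * m + v * (p ^ r : ℕ) = 1 :=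
      Nat.isCoprime_iff_coprime.2 (hmp.pow_right r)
    have h4 : x = (x ^ m) ^ u * (x ^ p ^ r) ^ v := by
      rw [← zpow_natCast x m, ← zpow_natCast x (p ^ r), ← zpow_mul, ← zpow_mul, ← zpow_add,
        mul_comm _ u, mul_comm _ v, huv, zpow_one]
    rw [h4]
    exact mul_mem (zpow_mem h2 u) (zpow_mem h3 v)
  have h5 : ∀ x : G, ∃ s, x ∈ (conjExtension θ (rootsOfUnity (p ^ s) K)).map
      (MonoidHom.fst _ _) := by
    intro x
    obtain ⟨⟨x, X⟩, hX, rfl⟩ := h1 x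
    obtain ⟨s, hs⟩ := CommGroup.mem_primaryComponent.1 hX.2
    exact ⟨s, _, ⟨hX.1, hs⟩, rfl⟩
  choose s hs using h5
  have := Fintype.ofFinite G
  refine ⟨e + Finset.univ.sup s, Nat.le_add_right _ _, ?_⟩
  refine eq_top_iff.2 fun x _ => Subgroup.map_mono (conjExtension_mono ?_) (hs x)
  exact rootsOfUnity_le_of_dvd (pow_dvd_pow p
    ((Finset.le_sup (f := s) (Finset.mem_univ x)).trans (Nat.le_add_left _ _)))

end Lift

section HomSpace

variable {K H V U : Type*} [Field K] [Group H] [AddCommGroup V] [Module K V] [AddCommGroup U]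
  [Module K U] [FiniteDimensional K U]

omit [FiniteDimensional K U] in
theorem eq_sum_smulRight {ι : Type*} [Fintype ι] (b : Module.Basis ι K U) (f : U →ₗ[K] V) :
    f = ∑ i, (b.coord i).smulRight (f (b i)) := by
  refine b.ext fun j => ?_
  simp [Finsupp.single_apply, ite_smul]

theorem exists_smulRight_ne_zero {F : Module.End K (U →ₗ[K] V)} (hF : F ≠ 0) :
    ∃ (φ : Module.Dual K U) (u : U),
      (LinearMap.applyₗ u ∘ₗ F ∘ₗ LinearMap.smulRightₗ φ : V →ₗ[K] V) ≠ 0 := by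
  by_contra! h
  refine hF (LinearMap.ext fun f => LinearMap.ext fun u => ?_)
  let b := Module.finBasis K U
  have hf : f = ∑ i, (b.coord i).smulRight (f (b i)) :=
    eq_sum_smulRight b f
  rw [hf, map_sum, LinearMap.sum_apply]
  exact Finset.sum_eq_zero fun i _ => LinearMap.congr_fun (h (b.coord i) u) (f (b i))

theorem IsSchurian.exists_eq_comp [Nontrivial V] {θ : Representation K H V} (hθ : θ.IsSchurian)
    {F : Module.End K (U →ₗ[K] V)} (hF : ∀ m f, F (θ m ∘ₗ f) = θ m ∘ₗ F f) :
    ∃ f' : Module.End K U, ∀ f, F f = f ∘ₗ f' := by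
  have h : ∀ (φ : Module.Dual K U) (u : U), ∃ c : K, ∀ v, F (φ.smulRight v) u = c • v := by
    intro φ u
    obtain ⟨c, hc⟩ := hθ (LinearMap.applyₗ u ∘ₗ F ∘ₗ LinearMap.smulRightₗ φ) fun m => by
      ext v
      have h1 : φ.smulRight (θ m v) = θ m ∘ₗ φ.smulRight v := by
        ext; simp
      simpa [h1] using LinearMap.congr_fun (hF m (φ.smulRight v)) u
    exact ⟨c, fun v => LinearMap.congr_fun hc v⟩
  obtain ⟨v₀, hv₀⟩ := exists_ne (0 : V)
  obtain ⟨ν, hν⟩ := Module.Projective.exists_dual_eq_one K hv₀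
  let b := Module.finBasis K U
  let f' : Module.End K U :=
    ∑ i, (ν ∘ₗ F ((b.coord i).smulRight v₀)).smulRight (b i)
  refine ⟨f', fun f => LinearMap.ext fun u => ?_⟩
  have hf : f = ∑ i, (b.coord i).smulRight (f (b i)) :=
    eq_sum_smulRight b f
  conv_lhs => rw [hf]
  rw [map_sum, LinearMap.sum_apply, LinearMap.comp_apply, LinearMap.sum_apply, map_sum]
  refine Finset.sum_congr rfl fun i _ => ?_
  obtain ⟨c, hc⟩ := h (b.coord i) u
  simp [hc, hν]

end HomSpace

/-- The linear character `ζ` of a subgroup of `G` lies under a Schurian representation of `G`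
in which the subgroup acts through the scalars given by `ζ`. -/
def HasScalarLift {K G : Type} [Field K] [Group G] {N : Subgroup G} (ζ : N →* Kˣ) : Prop :=
  ∃ (U : Type) (_ : AddCommGroup U) (_ : Module K U) (_ : FiniteDimensional K U)
    (_ : Nontrivial U) (τ : Representation K G U),
    τ.IsSchurian ∧ ∀ x : N, τ x = (ζ x : K) • 1

/-- Every invariant linear character of `p`-power order of a normal subgroup of index `n` of a
finite solvable group has a scalar lift over `K`. -/
def ScalarLiftsOfIndex (K : Type) [Field K] (p n : ℕ) : Prop :=
  ∀ (G : Type) [Group G] [Finite G] [Group.IsSolvable G] (N : Subgroup G) [N.Normal]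
    (ζ : N →* Kˣ), N.index = n → (∃ s, ∀ x, ζ x ^ p ^ s = 1) →
    (∀ g x, ζ (MulAut.conjNormal g x) = ζ x) → HasScalarLift ζ

section ScalarPart

variable {K G V : Type} [Field K] [Group G] [AddCommGroup V] [Module K V] [Nontrivial V]
  {M : Subgroup G} [M.Normal] {θ : Representation K M V}

theorem IsSchurian.exists_scalarPart (hθ : θ.IsSchurian) (D : Subgroup Kˣ) :
    ∃ ζ : M.comap ((MonoidHom.fst G (Module.End K V)ˣ).comp (conjExtension θ D).subtype) →* Kˣ,
      ∀ x, x.1.1.2 = scalarUnit K V (ζ x) * θ.toHomUnits ⟨x.1.1.1, x.2⟩ := by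
  have h : ∀ x : M.comap ((MonoidHom.fst G (Module.End K V)ˣ).comp (conjExtension θ D).subtype),
      ∃ a, x.1.1.2 = scalarUnit K V a * θ.toHomUnits ⟨x.1.1.1, x.2⟩ := fun x =>
    hθ.exists_eq_scalarUnit_mul x.1.2
      (mk_toHomUnits_mem_conjExtension (θ := θ) (D := ⊤) ⟨_, x.2⟩ (Subgroup.mem_top _))
  choose a ha using h
  refine ⟨MonoidHom.mk' a fun x y => scalarUnit_injective (V := V) ?_, ha⟩
  refine mul_right_cancel (b := θ.toHomUnits ⟨(x * y).1.1.1, (x * y).2⟩) ?_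
  rw [← ha, map_mul, mul_assoc]
  have h1 : θ.toHomUnits ⟨(x * y).1.1.1, (x * y).2⟩ =
      θ.toHomUnits ⟨x.1.1.1, x.2⟩ * θ.toHomUnits ⟨y.1.1.1, y.2⟩ := 
    map_mul θ.toHomUnits (⟨x.1.1.1, x.2⟩ : M) ⟨y.1.1.1, y.2⟩
  rw [h1, ← mul_assoc (scalarUnit K V (a y)), scalarUnit_mul_comm (a y), mul_assoc,
    ← mul_assoc, ← ha,
    ← ha]
  rfl

end ScalarPart

theorem exists_descent {K Γ G W : Type*} [Field K] [Group Γ] [Group G] [AddCommGroup W]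
    [Module K W] {f : Γ →* G} (hf : Function.Surjective f) (R : Representation K Γ W)
    (hR : ∀ x, f x = 1 → R x = 1) : ∃ ψ : Representation K G W, ∀ x, ψ (f x) = R x := by
  let φ : G →* (Module.End K W)ˣ := f.liftOfRightInverse (Function.surjInv hf)
    (Function.rightInverse_surjInv hf) ⟨R.toHomUnits, fun x hx => Units.ext (hR x hx)⟩
  refine ⟨(Units.coeHom _).comp φ, fun x => ?_⟩
  exact congrArg Units.val (f.liftOfRightInverse_comp_apply (Function.surjInv hf)
    (Function.rightInverse_surjInv hf) ⟨R.toHomUnits, fun x hx => Units.ext (hR x hx)⟩ x)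

theorem IsSchurian.exists_extension {K G V : Type} [Field K] [CharZero K] [Group G] [Finite G]
    [Group.IsSolvable G] [AddCommGroup V] [Module K V] [FiniteDimensional K V] [Nontrivial V]
    {p : ℕ} [Fact p.Prime] (hK : ∀ r, ∃ ζ : K, IsPrimitiveRoot ζ (p ^ r))
    {M : Subgroup G} [M.Normal] {θ : Representation K M V} (hθ : θ.IsSchurian) {j : ℕ}
    (hd : Module.finrank K V = p ^ j) {e : ℕ} (he : ∀ m, θ m ^ p ^ e = 1)
    (hG : (conjExtension θ ⊤).map (MonoidHom.fst _ _) = ⊤)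
    (IH : ScalarLiftsOfIndex K p M.index) :
    ∃ (U : Type) (_ : AddCommGroup U) (_ : Module K U) (_ : FiniteDimensional K U)
      (_ : Nontrivial U) (ψ : Representation K G (U →ₗ[K] V)),
      ψ.IsSchurian ∧ ∀ (m : M) f, ψ m f = θ m ∘ₗ f := by
  obtain ⟨s, hes, hs⟩ := hθ.exists_conjExtension_map_eq_top hK hd he hG
  let Γ := conjExtension θ (rootsOfUnity (p ^ s) K)
  have : Finite Γ := hθ.finite_conjExtension hd s
  have : Group.IsSolvable Γ := hθ.isSolvable_conjExtension hd s
  let π : Γ →* G := (MonoidHom.fst G (Module.End K V)ˣ).comp Γ.subtype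
  have hπ : Function.Surjective π := by
    intro g
    obtain ⟨x, hx, rfl⟩ : g ∈ Γ.map (MonoidHom.fst _ _) := hs ▸ Subgroup.mem_top g
    exact ⟨⟨x, hx⟩, rfl⟩
  obtain ⟨ζ, hζ⟩ := hθ.exists_scalarPart (rootsOfUnity (p ^ s) K)
  obtain ⟨U, _, _, _, _, τ, hτ, hτζ⟩ := IH Γ (M.comap π) ζ (M.index_comap_of_surjective hπ)
    ⟨j + s, fun x => by
      have h1 : detUnit K V x.1.1.2 ^ p ^ s = 1 := x.1.2.2
      rw [hζ, map_mul, mul_pow, detUnit_scalarUnit, hd, ← map_pow _ (θ.toHomUnits _),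
        (toHomUnits_pow_eq_one (q := p ^ s) fun m => ?_), map_one, mul_one, ← pow_mul,
        ← pow_add] at h1
      · exact h1
      · obtain ⟨t, rfl⟩ := Nat.exists_eq_add_of_le hes
        rw [pow_add, pow_mul, he, one_pow]⟩
    fun g x => by
      refine scalarUnit_injective (V := V) (mul_right_cancel
        (b := θ.toHomUnits (MulAut.conjNormal g.1.1 ⟨x.1.1.1, x.2⟩)) ?_)
      have h1 : g.1.2 * x.1.1.2 * g.1.2⁻¹ = scalarUnit K V (ζ (MulAut.conjNormal g x)) *
        θ.toHomUnits (MulAut.conjNormal g.1.1 ⟨x.1.1.1, x.2⟩) := hζ (MulAut.conjNormal g x)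
      rw [← h1, hζ x, ← mul_assoc, ← scalarUnit_mul_comm, mul_assoc, mul_assoc, ← mul_assoc g.1.2,
        g.2.1, mul_inv_cancel_right]
  let R : Representation K Γ (U →ₗ[K] V) :=
    linHom τ ((Units.coeHom _).comp ((MonoidHom.snd G (Module.End K V)ˣ).comp Γ.subtype))
  have hRM : ∀ (x : M.comap π) (f : U →ₗ[K] V), R x f = θ ⟨π x, x.2⟩ ∘ₗ f := by
    intro x f
    have h1 : τ (x : Γ)⁻¹ = ((ζ x)⁻¹ : Kˣ).val • 1 := by rw [← map_inv, ← hτζ]; rfl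
    have h2 : (x.1.1.2 : Module.End K V) = (ζ x : K) • θ ⟨π x, x.2⟩ := by
      rw [hζ x, Units.val_mul, val_scalarUnit, smul_mul_assoc, one_mul]
      rfl
    have h3 : R x f = (x.1.1.2 : Module.End K V) ∘ₗ f ∘ₗ τ (x : Γ)⁻¹ := rfl
    ext u
    simp [h3, h2, h1, smul_smul]
  have hR : ∀ x : Γ, π x = 1 → R x = 1 := by
    intro x hx
    refine LinearMap.ext fun f => ?_
    rw [hRM ⟨x, by rw [Subgroup.mem_comap, hx]; exact M.one_mem⟩ f]
    have h1 : (⟨π x, by rw [hx]; exact M.one_mem⟩ : M) = 1 := Subtype.ext hx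
    change θ ⟨π x, _⟩ ∘ₗ f = f
    rw [h1, map_one]
    rfl
  obtain ⟨ψ, hψ⟩ := exists_descent hπ R hR
  have hψM : ∀ (m : M) f, ψ m f = θ m ∘ₗ f := by
    rintro ⟨m, hm⟩ f
    obtain ⟨x, rfl⟩ := hπ m
    rw [hψ]
    exact hRM ⟨x, hm⟩ f
  refine ⟨U, _, _, inferInstance, inferInstance, ψ, fun F hF => ?_, hψM⟩
  obtain ⟨f', hf'⟩ := hθ.exists_eq_comp (F := F) fun m f => by
    rw [← hψM, ← hψM]
    exact LinearMap.congr_fun (hF m) f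
  obtain ⟨c, hc⟩ := hτ f' fun x => by
    obtain ⟨v₀, hv₀⟩ := exists_ne (0 : V)
    refine LinearMap.ext fun u => ?_
    rw [← sub_eq_zero, ← Module.forall_dual_apply_eq_zero_iff K]
    intro φ
    have h1 : R x⁻¹ (φ.smulRight v₀) ∘ₗ f' = R x⁻¹ (φ.smulRight v₀ ∘ₗ f') := by
      rw [← hf', ← hf', ← hψ]
      exact LinearMap.congr_fun (hF (π x⁻¹)) (φ.smulRight v₀)
    have h2 : (x⁻¹.1.2 : Module.End K V) (φ (τ x⁻¹⁻¹ (f' u)) • v₀) =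
      (x⁻¹.1.2 : Module.End K V) (φ (f' (τ x⁻¹⁻¹ u)) • v₀) := LinearMap.congr_fun h1 u
    have h3 := smul_left_injective K hv₀ ((Module.End.isUnit_iff _).1 (x⁻¹.1.2.isUnit) |>.1 h2)
    rw [inv_inv] at h3
    rw [map_sub, Module.End.mul_apply, Module.End.mul_apply, h3, sub_self]
  refine ⟨c, LinearMap.ext fun f => ?_⟩
  rw [hf', hc]
  ext u
  simp

end Representation

theorem Subgroup.exists_normal_commute_prime_exponent (G : Type*) [Group G] [Finite G]
    [Group.IsSolvable G] [Nontrivial G] :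
    ∃ r : ℕ, r.Prime ∧ ∃ A : Subgroup G, A.Normal ∧ A ≠ ⊥ ∧ (∀ x ∈ A, x ^ r = 1) ∧
      ∀ x ∈ A, ∀ y ∈ A, x * y = y * x := by
  have hex : ∃ n, derivedSeries G n = ⊥ := Group.IsSolvable.solvable
  obtain ⟨n, hn, hmin⟩ : ∃ n, derivedSeries G (n + 1) = ⊥ ∧ derivedSeries G n ≠ ⊥ := by
    have h0 : Nat.find hex ≠ 0 := fun h => by
      have h1 := Nat.find_spec hex
      rw [h, derivedSeries_zero] at h1
      exact top_ne_bot h1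
    obtain ⟨n, hn⟩ := Nat.exists_eq_succ_of_ne_zero h0
    exact ⟨n, by rw [← Nat.succ_eq_add_one, ← hn]; exact Nat.find_spec hex,
      Nat.find_min hex (by omega)⟩
  set B := derivedSeries G n with hB
  have hBn : B.Normal := derivedSeries_normal G n
  have hcomm : ∀ x ∈ B, ∀ y ∈ B, x * y = y * x := by
    intro x hx y hy
    have h1 : _ ∈ derivedSeries G (n + 1) := Subgroup.commutator_mem_commutator hx hy
    rw [hn, Subgroup.mem_bot] at h1
    exact commutatorElement_eq_one_iff_mul_comm.1 h1
  have hcard : Nat.card B ≠ 1 := fun h => hmin (Subgroup.card_eq_one.1 h)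
  obtain ⟨r, hr, hdvd⟩ := Nat.exists_prime_and_dvd hcard
  have := Fact.mk hr
  obtain ⟨b, hb⟩ := exists_prime_orderOf_dvd_card' r hdvd
  refine ⟨r, hr,
    { carrier := {x | x ∈ B ∧ x ^ r = 1}
      one_mem' := ⟨B.one_mem, one_pow r⟩
      mul_mem' := fun {x y} hx hy => ⟨B.mul_mem hx.1 hy.1, by
        rw [(show Commute x y from hcomm x hx.1 y hy.1).mul_pow, hx.2, hy.2, one_mul]⟩
      inv_mem' := fun {x} hx => ⟨B.inv_mem hx.1, by rw [inv_pow, hx.2, inv_one]⟩ },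
    ⟨fun x hx g => ⟨hBn.conj_mem x hx.1 g, by rw [conj_pow, hx.2, mul_one, mul_inv_cancel]⟩⟩,
    fun h => ?_, fun x hx => hx.2, fun x hx y hy => hcomm x hx.1 y hy.1⟩
  have hmem : (b : G) ∈ (⊥ : Subgroup G) := by
    rw [← h]
    exact ⟨b.2, by rw [← Subgroup.coe_pow, ← hb, pow_orderOf_eq_one, Subgroup.coe_one]⟩
  rw [Subgroup.mem_bot] at hmem
  rw [(Subtype.ext hmem : b = 1), orderOf_one] at hb
  exact hr.one_lt.ne hb

theorem Subgroup.exists_normal_gt_of_isSolvable {G : Type*} [Group G] [Finite G]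
    [Group.IsSolvable G] (N : Subgroup G) [N.Normal] (hN : N ≠ ⊤) :
    ∃ r : ℕ, r.Prime ∧ ∃ M : Subgroup G, M.Normal ∧ N < M ∧ (∀ x ∈ M, x ^ r ∈ N) ∧
      ∀ x ∈ M, ∀ y ∈ M, x * y * x⁻¹ * y⁻¹ ∈ N := by
  have : Nontrivial (G ⧸ N) := QuotientGroup.nontrivial_iff.2 hN
  obtain ⟨r, hr, A, hA, hA0, hexp, hcomm⟩ :=
    Subgroup.exists_normal_commute_prime_exponent (G ⧸ N)
  refine ⟨r, hr, A.comap (QuotientGroup.mk' N), inferInstance, ⟨?_, fun h => hA0 ?_⟩,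
    fun x hx => ?_, fun x hx y hy => ?_⟩
  · intro x hx
    rw [Subgroup.mem_comap, QuotientGroup.mk'_apply, (QuotientGroup.eq_one_iff x).2 hx]
    exact A.one_mem
  · rw [eq_bot_iff]
    intro x hx
    obtain ⟨x, rfl⟩ := QuotientGroup.mk'_surjective N x
    exact (QuotientGroup.eq_one_iff x).2 (h hx)
  · exact (QuotientGroup.eq_one_iff _).1 (hexp _ hx)
  · rw [← QuotientGroup.eq_one_iff]
    exact commutatorElement_eq_one_iff_mul_comm.2 (hcomm _ hx _ hy)

theorem Subgroup.exists_commute_forall_mem (G : Type*) [Group G] [Finite G] :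
    ∃ A : Subgroup G, (∀ x ∈ A, ∀ y ∈ A, x * y = y * x) ∧
      ∀ x, (∀ a ∈ A, x * a = a * x) → x ∈ A := by
  obtain ⟨A, hA⟩ := Set.Finite.exists_maximal
    (Set.toFinite {A : Subgroup G | ∀ x ∈ A, ∀ y ∈ A, x * y = y * x})
    ⟨⊥, fun x hx y hy => by rw [Subgroup.mem_bot.1 hx, Subgroup.mem_bot.1 hy]⟩
  refine ⟨A, hA.1, fun x hx => ?_⟩
  have hcl : IsMulCommutative (Subgroup.closure (insert x (A : Set G))) := by
    refine Subgroup.isMulCommutative_closure ?_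
    rintro a (rfl | ha) b (rfl | hb)
    · rfl
    · exact hx b hb
    · exact (hx a ha).symm
    · exact hA.1 a ha b hb
  refine hA.2 (y := Subgroup.closure (insert x (A : Set G))) (fun a ha b hb => ?_) ?_ ?_
  · exact congrArg Subtype.val (hcl.is_comm.comm ⟨a, ha⟩ ⟨b, hb⟩)
  · exact fun a ha => Subgroup.subset_closure (Set.mem_insert_of_mem _ ha)
  · exact Subgroup.subset_closure (Set.mem_insert _ _)

theorem hasEnoughRootsOfUnity_of_pow_eq_one {K A : Type*} [Field K] [CommGroup A] [Finite A]
    {p : ℕ} (hp : p.Prime) (hK : ∀ r, ∃ ζ : K, IsPrimitiveRoot ζ (p ^ r)) {t : ℕ}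
    (ht : ∀ a : A, a ^ p ^ t = 1) : HasEnoughRootsOfUnity K (Monoid.exponent A) := by
  obtain ⟨r, -, hr⟩ := (Nat.dvd_prime_pow hp).1 (Monoid.exponent_dvd_of_forall_pow_eq_one ht)
  rw [hr]
  have : NeZero (p ^ r) := ⟨pow_ne_zero _ hp.ne_zero⟩
  exact ⟨hK r, rootsOfUnity.isCyclic K (p ^ r)⟩

theorem MonoidHom.exists_extension_of_pow_eq_one {K A : Type*} [Field K] [Group A] [Finite A]
    (hA : ∀ a b : A, a * b = b * a) {p : ℕ} (hp : p.Prime)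
    (hK : ∀ r, ∃ ζ : K, IsPrimitiveRoot ζ (p ^ r)) {t : ℕ}
    (ht : ∀ a : A, a ^ p ^ t = 1) {B : Subgroup A} (ζ : B →* Kˣ) :
    ∃ α : A →* Kˣ, ∀ b : B, α b = ζ b := by
  let _ : CommGroup A := { (inferInstance : Group A) with mul_comm := hA }
  have := hasEnoughRootsOfUnity_of_pow_eq_one hp hK ht
  obtain ⟨α, hα⟩ := MonoidHom.domRestrict_surjective K B ζ
  exact ⟨α, fun b => DFunLike.congr_fun hα b⟩

theorem MonoidHom.exists_descent {Γ G A : Type*} [Group Γ] [Group G] [Group A] {f : Γ →* G}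
    (hf : Function.Surjective f) (g : Γ →* A) (hg : f.ker ≤ g.ker) :
    ∃ h : G →* A, ∀ x, h (f x) = g x :=
  ⟨f.liftOfRightInverse (Function.surjInv hf) (Function.rightInverse_surjInv hf) ⟨g, hg⟩,
    f.liftOfRightInverse_comp_apply (Function.surjInv hf) (Function.rightInverse_surjInv hf)
      ⟨g, hg⟩⟩

namespace Representation

/-- If the subgroup `N` acts through the invariant linear character `ζ` on `ψ`, it does so on the
representation coinduced from `ψ`. -/
theorem coind_apply_of_scalar {K G W : Type*} [Field K] [Group G] [AddCommGroup W] [Module K W]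
    {T : Subgroup G} {ψ : Representation K T W} {N : Subgroup G} [N.Normal] (hNT : N ≤ T)
    {ζ : N →* Kˣ} (hζ : ∀ g x, ζ (MulAut.conjNormal g x) = ζ x)
    (h : ∀ x : N, ψ ⟨x, hNT x.2⟩ = (ζ x : K) • 1) (x : N) :
    coind T.subtype ψ x = (ζ x : K) • 1 := by
  ext F g
  have h1 : g * (x : G) = (MulAut.conjNormal g x : N) * g := by
    simp
  rw [coind_apply_val, h1, coindV_val_mul T ψ F (hNT (MulAut.conjNormal g x).2),
    h (MulAut.conjNormal g x), hζ]
  rfl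

theorem IsSchurian.mem_map_conjExtension_of_ne_zero {K G V U : Type*} [Field K] [CharZero K]
    [Group G] [Finite G] [AddCommGroup V] [Module K V] [FiniteDimensional K V]
    [AddCommGroup U] [Module K U] [FiniteDimensional K U] {M : Subgroup G} [M.Normal]
    {θ : Representation K M V} (hθ : θ.IsSchurian) {g : G} {F : Module.End K (U →ₗ[K] V)}
    (hF : ∀ m f, F (θ m ∘ₗ f) = θ (MulAut.conjNormal g m) ∘ₗ F f) (hF0 : F ≠ 0) :
    g ∈ (conjExtension θ ⊤).map (MonoidHom.fst _ _) := by
  obtain ⟨φ, u, hφu⟩ := exists_smulRight_ne_zero hF0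
  set h : Module.End K V := LinearMap.applyₗ u ∘ₗ F ∘ₗ LinearMap.smulRightₗ φ with hh
  have hint : ∀ m v, h (θ m v) = θ (MulAut.conjNormal g m) (h v) := by
    intro m v
    have h1 : φ.smulRight (θ m v) = θ m ∘ₗ φ.smulRight v := by
      ext; simp
    simpa [hh, h1] using LinearMap.congr_fun (hF m (φ.smulRight v)) u
  have hinj := hθ.injective_of_intertwines (ρ' := fun m => θ (MulAut.conjNormal g m)) hint hφu
  have hu : IsUnit h := (Module.End.isUnit_iff _).2
    ⟨hinj, LinearMap.injective_iff_surjective.1 hinj⟩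
  obtain ⟨X, hX⟩ := hu
  refine ⟨(g, X), ⟨fun m => Units.ext (LinearMap.ext fun v => ?_), Subgroup.mem_top _⟩, rfl⟩
  have h2 := hint m v
  rw [← hX] at h2
  exact h2

theorem IsSchurian.hasScalarLift {K G V : Type} [Field K] [CharZero K] [Group G] [Finite G]
    [Group.IsSolvable G] [AddCommGroup V] [Module K V] [FiniteDimensional K V] [Nontrivial V]
    {p : ℕ} [Fact p.Prime] (hK : ∀ r, ∃ ζ : K, IsPrimitiveRoot ζ (p ^ r))
    {M : Subgroup G} [M.Normal] {θ : Representation K M V} (hθ : θ.IsSchurian) {j : ℕ}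
    (hd : Module.finrank K V = p ^ j) {e : ℕ} (he : ∀ m, θ m ^ p ^ e = 1)
    (IH : ∀ m ≤ M.index, ScalarLiftsOfIndex K p m)
    {N : Subgroup G} [N.Normal] (hNM : N ≤ M) {ζ : N →* Kˣ}
    (hζ : ∀ g x, ζ (MulAut.conjNormal g x) = ζ x)
    (hθζ : ∀ x : N, θ ⟨x, hNM x.2⟩ = (ζ x : K) • 1) : HasScalarLift ζ := by
  set T := (conjExtension θ ⊤).map (MonoidHom.fst _ _) with hT
  have hMT : M ≤ T := le_map_fst_conjExtension fun _ => Subgroup.mem_top _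
  let ι : M.subgroupOf T ≃* M := Subgroup.subgroupOfEquivOfLe hMT
  let θT : Representation K (M.subgroupOf T) V := θ.comp ι.toMonoidHom
  have hθT : θT.IsSchurian := fun f hf => hθ f fun m => by
    have := hf (ι.symm m)
    simpa [θT] using this
  have hconj : ∀ (t : T) (n : M.subgroupOf T),
      ι (MulAut.conjNormal t n) = MulAut.conjNormal (t : G) (ι n) := fun t n => Subtype.ext rfl
  have htop : (conjExtension θT ⊤).map (MonoidHom.fst _ _) = ⊤ := by
    refine eq_top_iff.2 fun t _ => ?_
    obtain ⟨⟨g, X⟩, hX, hg⟩ := t.2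
    refine ⟨(t, X), ⟨fun n => ?_, Subgroup.mem_top _⟩, rfl⟩
    have h1 := hX.1 (ι n)
    dsimp only [MonoidHom.coe_fst] at hg h1
    rw [hg, ← hconj] at h1
    exact h1
  obtain ⟨U, _, _, _, _, ψ, hψ, hψM⟩ := hθT.exists_extension hK hd (fun m => he (ι m)) htop
    (IH _ (Nat.le_of_dvd (Nat.pos_of_ne_zero Subgroup.index_ne_zero_of_finite)
      (Subgroup.relIndex_dvd_index_of_normal M T)))
  have hψM' : ∀ (m : M) f, ψ ⟨m, hMT m.2⟩ f = θ m ∘ₗ f := fun m f =>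
    hψM ⟨⟨m, hMT m.2⟩, m.2⟩ f
  refine ⟨coindV T.subtype ψ, _, _, inferInstance, inferInstance,
    Representation.coind T.subtype ψ,
    hψ.coind (N := M) hMT fun g hg F hF => ?_, fun x => ?_⟩
  · by_contra hF0
    refine hg (hθ.mem_map_conjExtension_of_ne_zero (fun m f => ?_) hF0)
    have h1 := LinearMap.congr_fun (hF m m.2) f
    rw [Module.End.mul_apply, hψM' m] at h1
    exact h1.trans (hψM' (MulAut.conjNormal g m) (F f))
  · refine coind_apply_of_scalar (hNM.trans hMT) hζ (fun x => ?_) x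
    ext1 f
    rw [hψM' ⟨x, hNM x.2⟩, hθζ]
    rfl

/-- The representation on `V` through the scalars given by a linear character. -/
def scalarRep {K H : Type*} [Field K] [Group H] (α : H →* Kˣ) (V : Type*) [AddCommGroup V]
    [Module K V] : Representation K H V :=
  (Units.coeHom _).comp ((scalarUnit K V).comp α)

theorem scalarRep_apply {K H V : Type*} [Field K] [Group H] [AddCommGroup V] [Module K V]
    (α : H →* Kˣ) (h : H) : scalarRep α V h = (α h : K) • 1 :=
  val_scalarUnit (α h)

theorem isSchurian_self {K H : Type*} [Field K] [Group H] (ρ : Representation K H K) :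
    ρ.IsSchurian := fun f _ => ⟨f 1, by ext; simp⟩

theorem HasScalarLift.of_surjective {K G G' : Type} [Field K] [Group G] [Group G']
    {f : G →* G'} (hf : Function.Surjective f) {N : Subgroup G} {N' : Subgroup G'}
    {ζ : N →* Kˣ} {ζ' : N' →* Kˣ} (h : ∀ x : N, ∃ y : N', (y : G') = f x ∧ ζ' y = ζ x)
    (hζ' : HasScalarLift ζ') : HasScalarLift ζ := by
  obtain ⟨U, _, _, _, _, τ, hτ, hτζ⟩ := hζ'
  refine ⟨U, _, _, inferInstance, inferInstance, τ.comp f, fun F hF => hτ F fun g => ?_,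
    fun x => ?_⟩
  · obtain ⟨g, rfl⟩ := hf g
    exact hF g
  · obtain ⟨y, hy, hyx⟩ := h x
    rw [MonoidHom.comp_apply, ← hy, hτζ, hyx]

theorem HasScalarLift.mono {K G : Type} [Field K] [Group G] {N M : Subgroup G} (hNM : N ≤ M)
    {ζ : N →* Kˣ} {ζ' : M →* Kˣ} (h : ∀ x : N, ζ' ⟨x, hNM x.2⟩ = ζ x)
    (hζ' : HasScalarLift ζ') : HasScalarLift ζ :=
  hζ'.of_surjective (f := MonoidHom.id G) Function.surjective_id fun x => ⟨⟨x, hNM x.2⟩, rfl, h x⟩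

theorem hasScalarLift_of_eq_top {K G : Type} [Field K] [Group G] {N : Subgroup G} (hN : N = ⊤)
    (ζ : N →* Kˣ) : HasScalarLift ζ := by
  subst hN
  refine ⟨K, _, _, inferInstance, inferInstance,
    scalarRep (ζ.comp Subgroup.topEquiv.symm.toMonoidHom) K, isSchurian_self _, fun x => ?_⟩
  rw [scalarRep_apply]
  rfl

section Faithful

variable {K G : Type} [Field K] [Group G] {p : ℕ} {N M : Subgroup G} [N.Normal]
  [M.Normal] (hNM : N ≤ M)
  {ζ : N →* Kˣ} (hinj : Function.Injective ζ)
  {s : ℕ} (hs : ∀ x, ζ x ^ p ^ s = 1) (hζ : ∀ g x, ζ (MulAut.conjNormal g x) = ζ x)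
  {r : ℕ} (hM : ∀ x ∈ M, x ^ r ∈ N) (hcomm : ∀ x ∈ M, ∀ y ∈ M, x * y * x⁻¹ * y⁻¹ ∈ N)

include hNM hinj hs hζ hM hcomm

theorem hasScalarLift_of_coprime (hr : r.Coprime p)
    (IH : ∀ ζ' : M →* Kˣ, (∃ s, ∀ x, ζ' x ^ p ^ s = 1) →
      (∀ g x, ζ' (MulAut.conjNormal g x) = ζ' x) → HasScalarLift ζ') : HasScalarLift ζ := by
  have hcen : ∀ g, ∀ n ∈ N, g * n * g⁻¹ = n := fun g n hn =>
    congrArg Subtype.val (hinj (hζ g ⟨n, hn⟩))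
  have hN : ∀ n ∈ N, n ^ p ^ s = 1 := fun n hn => by
    have h1 : (⟨n, hn⟩ : N) ^ p ^ s = 1 := hinj (by rw [map_pow, hs, map_one])
    exact congrArg Subtype.val h1
  have hMcomm : ∀ x y : M, x * y = y * x := by
    rintro ⟨x, hx⟩ ⟨y, hy⟩
    set c := x * y * x⁻¹ * y⁻¹ with hc
    have hcN : c ∈ N := hcomm x hx y hy
    have h1 : x * y * x⁻¹ = c * y := by rw [hc]; group
    have h2 : c * y = y * c := (mul_inv_eq_iff_eq_mul.1 (hcen y c hcN)).symm
    have h3 : c ^ r = 1 := by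
      have h4 : (x * y * x⁻¹) ^ r = y ^ r := by rw [conj_pow, hcen x _ (hM y hy)]
      rw [h1, (show Commute c y from h2).mul_pow] at h4
      exact mul_eq_right.1 h4
    have h4 : c = 1 := by
      have := pow_gcd_eq_one.2 ⟨h3, hN c hcN⟩
      rwa [(hr.pow_right s).gcd_eq_one, pow_one] at this
    refine Subtype.ext ?_
    rw [h4, one_mul] at h1
    exact mul_inv_eq_iff_eq_mul.1 h1
  obtain ⟨w, hw⟩ : ∃ w : ℤ, ∀ x : N, (ζ x ^ r) ^ w = ζ x := by
    obtain ⟨u, v, huv⟩ := Nat.isCoprime_iff_coprime.2 (hr.pow_right s)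
    refine ⟨u, fun x => ?_⟩
    calc (ζ x ^ r) ^ u = (ζ x ^ r) ^ u * (ζ x ^ p ^ s) ^ v := by rw [hs, one_zpow, mul_one]
      _ = ζ x ^ (u * r + v * (p ^ s : ℕ)) := by
        rw [← zpow_natCast, ← zpow_natCast, ← zpow_mul, ← zpow_mul, ← zpow_add, mul_comm u,
          mul_comm v]
      _ = ζ x := by rw [huv, zpow_one]
  let ζ' : M →* Kˣ := MonoidHom.mk' (fun x => ζ ⟨(x : G) ^ r, hM x x.2⟩ ^ w) fun x y => by
    rw [← mul_zpow, ← map_mul]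
    congr 2
    refine Subtype.ext ?_
    exact (show Commute (x : G) y from congrArg Subtype.val (hMcomm x y)).mul_pow r
  refine HasScalarLift.mono hNM (ζ' := ζ') (fun x => ?_) (IH ζ' ⟨s, fun x => ?_⟩ fun g x => ?_)
  · exact (congrArg (· ^ w) (map_pow ζ x r)).trans (hw x)
  · change (ζ _ ^ w) ^ _ = 1
    rw [← zpow_natCast, zpow_comm, zpow_natCast, hs, one_zpow]
  · change ζ _ ^ w = ζ _ ^ w
    rw [← hζ g ⟨(x : G) ^ r, hM x x.2⟩]
    congr 2
    refine Subtype.ext ?_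
    exact conj_pow

theorem hasScalarLift_of_prime_exponent [Fact p.Prime] [CharZero K] [Finite G] [Group.IsSolvable G]
    (hK : ∀ r, ∃ ζ : K, IsPrimitiveRoot ζ (p ^ r)) (hr : r = p)
    (IH : ∀ m ≤ M.index, ScalarLiftsOfIndex K p m) : HasScalarLift ζ := by
  subst hr
  have hcen : ∀ g, ∀ n ∈ N, g * n * g⁻¹ = n := fun g n hn =>
    congrArg Subtype.val (hinj (hζ g ⟨n, hn⟩))
  have hN : ∀ n ∈ N, n ^ r ^ s = 1 := fun n hn => by
    have h1 : (⟨n, hn⟩ : N) ^ r ^ s = 1 := hinj (by rw [map_pow, hs, map_one])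
    exact congrArg Subtype.val h1
  have hMp : ∀ x : M, x ^ r ^ (s + 1) = 1 := fun x => Subtype.ext (by
    rw [Subgroup.coe_pow, pow_succ', pow_mul]
    exact hN _ (hM x x.2))
  obtain ⟨A, hA, hmax⟩ := Subgroup.exists_commute_forall_mem M
  have hNA : N.subgroupOf M ≤ A := fun n hn => hmax n fun a _ => Subtype.ext
    (mul_inv_eq_iff_eq_mul.1 (hcen a n hn)).symm
  have hAn : A.Normal := ⟨fun a ha g => by
    have h1 : g * a * g⁻¹ * a⁻¹ ∈ A := hNA (hcomm g g.2 a a.2)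
    exact (Subgroup.mul_mem_cancel_right A (A.inv_mem ha)).1 h1⟩
  let ζA : (N.subgroupOf M).subgroupOf A →* Kˣ := MonoidHom.mk' (fun x => ζ ⟨x, x.2⟩)
    fun x y => map_mul ζ (⟨x, x.2⟩ : N) ⟨y, y.2⟩
  obtain ⟨α, hα⟩ := MonoidHom.exists_extension_of_pow_eq_one
    (fun a b : A => Subtype.ext (hA a a.2 b b.2)) Fact.out hK
    (fun a => Subtype.ext (hMp a)) ζA
  have hαN : ∀ (x : M) (hx : (x : G) ∈ N), α ⟨x, hNA hx⟩ = ζ ⟨x, hx⟩ := fun x hx =>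
    hα ⟨⟨x, hNA hx⟩, hx⟩
  have hθ : (Representation.coind A.subtype (scalarRep α K)).IsSchurian := by
    refine (isSchurian_self _).coind (N := A) le_rfl fun g hg f hf => ?_
    by_contra hf0
    refine hg (hmax g fun a ha => ?_)
    have h1 := hf a ha
    rw [scalarRep_apply, scalarRep_apply, mul_smul_comm, smul_mul_assoc, mul_one, one_mul] at h1
    have h2 : α ⟨a, ha⟩ = α ⟨g * a * g⁻¹, hAn.conj_mem a ha g⟩ :=
      Units.ext (smul_left_injective K hf0 h1)
    have hc : ((g * a * g⁻¹ * a⁻¹ : M) : G) ∈ N := hcomm g g.2 a a.2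
    have h3 : (⟨g * a * g⁻¹, hAn.conj_mem a ha g⟩ : A) =
        ⟨g * a * g⁻¹ * a⁻¹, hNA hc⟩ * ⟨a, ha⟩ := Subtype.ext (by simp)
    rw [h3, map_mul] at h2
    have h5 : ζ ⟨_, hc⟩ = ζ 1 := (hαN _ hc).symm.trans ((right_eq_mul.1 h2).trans (map_one ζ).symm)
    have h6 : ((g * a * g⁻¹ * a⁻¹ : M) : G) = 1 := congrArg Subtype.val (hinj h5)
    have h4 : g * a * g⁻¹ * a⁻¹ = 1 := Subtype.ext h6
    exact mul_inv_eq_iff_eq_mul.1 (mul_inv_eq_one.1 h4)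
  obtain ⟨j, hj⟩ := (show IsPGroup r M from fun x => ⟨s + 1, hMp x⟩).index A
  refine hθ.hasScalarLift hK (j := j) ?_ (e := s + 1) (fun m => ?_) IH hNM hζ fun x => ?_
  · rw [finrank_coindV, Module.finrank_self, mul_one, hj]
  · rw [← map_pow, hMp, map_one]
  · let ζM : N.subgroupOf M →* Kˣ := MonoidHom.mk' (fun x => ζ ⟨x, x.2⟩)
      fun x y => map_mul ζ (⟨x, x.2⟩ : N) ⟨y, y.2⟩
    exact coind_apply_of_scalar (ζ := ζM) hNA (fun g x => hζ g ⟨x, x.2⟩)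
      (fun y => (scalarRep_apply α _).trans (by rw [hαN _ y.2]; rfl)) ⟨⟨x, hNM x.2⟩, x.2⟩

end Faithful

theorem HasScalarLift.of_injective {K G : Type} [Field K] [Group G] {N : Subgroup G} [N.Normal]
    {ζ : N →* Kˣ} {m : ℕ} (hs : ∀ x, ζ x ^ m = 1) (hζ : ∀ g x, ζ (MulAut.conjNormal g x) = ζ x)
    (H : ∀ (L : Subgroup G) [L.Normal] (N' : Subgroup (G ⧸ L)) [N'.Normal] (ζ' : N' →* Kˣ),
      N'.index = N.index → Function.Injective ζ' → (∀ x, ζ' x ^ m = 1) →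
      (∀ g x, ζ' (MulAut.conjNormal g x) = ζ' x) → HasScalarLift ζ') : HasScalarLift ζ := by
  set L : Subgroup G := ζ.ker.map N.subtype with hL
  have hLN : L ≤ N := by
    rintro _ ⟨x, -, rfl⟩
    exact x.2
  have hmem : ∀ x : N, (x : G) ∈ L ↔ ζ x = 1 := fun x => by
    rw [hL, ← MonoidHom.mem_ker]
    exact Subgroup.mem_map_iff_mem N.subtype_injective
  have hLn : L.Normal := ⟨by
    rintro _ ⟨x, hx, rfl⟩ g
    refine (hmem (MulAut.conjNormal g x)).2 ?_
    rw [hζ]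
    exact hx⟩
  have hN' : (N.map (QuotientGroup.mk' L)).Normal :=
    Subgroup.Normal.map inferInstance _ (QuotientGroup.mk'_surjective L)
  have hsurj := (QuotientGroup.mk' L).subgroupMap_surjective N
  have hker : ((QuotientGroup.mk' L).subgroupMap N).ker ≤ ζ.ker := fun x hx => by
    have h1 : QuotientGroup.mk' L x = 1 := congrArg Subtype.val hx
    exact (hmem x).1 ((QuotientGroup.eq_one_iff _).1 h1)
  obtain ⟨ζ', hζ'⟩ := MonoidHom.exists_descent hsurj ζ hker
  refine HasScalarLift.of_surjective (QuotientGroup.mk'_surjective L) (ζ' := ζ')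
    (fun x => ⟨_, rfl, hζ' x⟩) (H L _ ζ' ?_ ?_ ?_ ?_)
  · rw [Subgroup.index_map_eq _ (QuotientGroup.mk'_surjective L)]
    rwa [QuotientGroup.ker_mk']
  · refine (injective_iff_map_eq_one ζ').2 fun y hy => ?_
    obtain ⟨x, rfl⟩ := hsurj y
    rw [hζ'] at hy
    exact Subtype.ext ((QuotientGroup.eq_one_iff _).2 ((hmem x).2 hy))
  · intro y
    obtain ⟨x, rfl⟩ := hsurj y
    rw [hζ', hs]
  · intro g y
    obtain ⟨x, rfl⟩ := hsurj y
    obtain ⟨g, rfl⟩ := QuotientGroup.mk'_surjective L g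
    rw [hζ', ← hζ g x, ← hζ']
    rfl

theorem scalarLiftsOfIndex {K : Type} [Field K] [CharZero K] {p : ℕ} [Fact p.Prime]
    (hK : ∀ r, ∃ ζ : K, IsPrimitiveRoot ζ (p ^ r)) (n : ℕ) : ScalarLiftsOfIndex K p n := by
  induction n using Nat.strong_induction_on with
  | _ n IH =>
    intro G _ _ _ N _ ζ hn ⟨s, hs⟩ hζ
    refine HasScalarLift.of_injective hs hζ fun L _ N' _ ζ' hN' hinj hs' hζ' => ?_
    by_cases htop : N' = ⊤
    · exact hasScalarLift_of_eq_top htop ζ'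
    · obtain ⟨r, hr, M, hMn, hNM, hM, hcomm⟩ := N'.exists_normal_gt_of_isSolvable htop
      have hlt : M.index < n := by
        rw [← hn, ← hN']
        exact Subgroup.index_strictAnti hNM
      by_cases hrp : r = p
      · exact hasScalarLift_of_prime_exponent hNM.le hinj hs' hζ' hM hcomm hK hrp
          fun m hm => IH m (hm.trans_lt hlt)
      · exact hasScalarLift_of_coprime hNM.le hinj hs' hζ' hM hcomm
          ((Nat.coprime_primes hr Fact.out).2 hrp) fun ξ hξ hξ' => IH _ hlt _ M ξ rfl hξ hξ'

/-- The subgroup of those elements fixing the linear character `l` of a normal subgroup. -/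
def characterStabilizer {G A : Type*} [Group G] [Monoid A] {N : Subgroup G} [N.Normal]
    (l : N →* A) : Subgroup G where
  carrier := {g | ∀ n, l (MulAut.conjNormal g n) = l n}
  one_mem' n := by rw [map_one, MulAut.one_apply]
  mul_mem' {a b} ha hb n := by rw [map_mul, MulAut.mul_apply, ha, hb]
  inv_mem' {a} ha n := by rw [← ha, ← MulAut.mul_apply, ← map_mul, mul_inv_cancel, map_one,
    MulAut.one_apply]

theorem le_characterStabilizer {G A : Type*} [Group G] [CommGroup A] {N : Subgroup G} [N.Normal]
    (l : N →* A) : N ≤ characterStabilizer l := fun m hm n => by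
  have h1 : MulAut.conjNormal m n = (⟨m, hm⟩ : N) * n * (⟨m, hm⟩ : N)⁻¹ := Subtype.ext rfl
  rw [h1, map_mul, map_mul, map_inv, mul_inv_cancel_comm]

theorem exists_isSchurian_forall_conj {K G : Type} [Field K] [CharZero K] [Group G] [Finite G]
    [Group.IsSolvable G] {p : ℕ} [Fact p.Prime] (hK : ∀ r, ∃ ζ : K, IsPrimitiveRoot ζ (p ^ r))
    {N : Subgroup G} [N.Normal] {s : ℕ} (hN : ∀ x : N, x ^ p ^ s = 1) (l : N →* Kˣ) :
    ∃ (V : Type) (_ : AddCommGroup V) (_ : Module K V) (_ : FiniteDimensional K V)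
      (_ : Nontrivial V) (ρ : Representation K G V), ρ.IsSchurian ∧
      (∃ v ≠ 0, ∀ n : N, ρ n v = (l n : K) • v) ∧
      ∀ m : N →* Kˣ, (∃ v ≠ 0, ∀ n : N, ρ n v = (m n : K) • v) →
        ∃ g, ∀ n, m n = l (MulAut.conjNormal g n) := by
  set T := characterStabilizer l
  have hNT : N ≤ T := le_characterStabilizer l
  let lT : N.subgroupOf T →* Kˣ := MonoidHom.mk' (fun x => l ⟨x, x.2⟩)
    fun x y => map_mul l (⟨x, x.2⟩ : N) ⟨y, y.2⟩
  obtain ⟨U, _, _, _, _, τ, hτ, hτl⟩ : HasScalarLift lT :=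
    scalarLiftsOfIndex hK _ T (N.subgroupOf T) lT rfl
      ⟨s, fun x => (map_pow l ⟨x, x.2⟩ _).symm.trans (by rw [hN, map_one])⟩
      fun g x => g.2 ⟨x, x.2⟩
  have hτN : ∀ n : N, τ ⟨n, hNT n.2⟩ = (l n : K) • 1 := fun n => hτl ⟨⟨n, hNT n.2⟩, n.2⟩
  refine ⟨coindV T.subtype τ, inferInstance, inferInstance, inferInstance, inferInstance,
    Representation.coind T.subtype τ, hτ.coind hNT fun g hg f hf => ?_, ?_, ?_⟩
  · by_contra hf0
    refine hg fun n => Units.ext (smul_left_injective K hf0 ?_).symm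
    have h1 : f * τ ⟨n, hNT n.2⟩ =
      τ ⟨MulAut.conjNormal g n, hNT (MulAut.conjNormal g n).2⟩ * f := hf n n.2
    rw [hτN n, hτN (MulAut.conjNormal g n), mul_smul_comm, smul_mul_assoc, mul_one, one_mul] at h1
    exact h1
  · obtain ⟨w, hw⟩ := exists_ne (0 : U)
    refine ⟨coindSingleHom T τ w, fun h => hw ?_, fun n => ?_⟩
    · rw [← coindSingle_one T τ w]
      exact congrArg (fun f : coindV T.subtype τ => f.1 1) h
    · rw [← map_smul]
      exact (coind_coindSingle T τ ⟨n, hNT n.2⟩ w).trans (by rw [hτN]; rfl)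
  · rintro m ⟨u, hu, hum⟩
    obtain ⟨g, hg⟩ : ∃ g, u.1 g ≠ 0 := by
      by_contra! h
      exact hu (Subtype.ext (funext h))
    refine ⟨g, fun n => Units.ext (smul_left_injective K hg ?_)⟩
    have h1 : g * (n : G) = (MulAut.conjNormal g n : N) * g := by simp
    have h2 := congrArg (fun f : coindV T.subtype τ => f.1 g) (hum n)
    beta_reduce at h2
    rw [coind_apply_val, h1, coindV_val_mul T τ u (hNT (MulAut.conjNormal g n).2),
      hτN (MulAut.conjNormal g n)] at h2
    exact h2.symm

theorem sum_inv_mul_trace_ne_zero_iff {K H V : Type*} [Field K] [CharZero K] [Group H] [Fintype H]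
    [AddCommGroup V] [Module K V] [FiniteDimensional K V] (ρ : Representation K H V)
    (l : H →* Kˣ) :
    ∑ h, (l h : K)⁻¹ * LinearMap.trace K V (ρ h) ≠ 0 ↔
      ∃ v ≠ 0, ∀ h, ρ h v = (l h : K) • v := by
  let σ : Representation K H V :=
    { toFun := fun h => (l h : K)⁻¹ • ρ h
      map_one' := by simp
      map_mul' := fun x y => by
        rw [map_mul, map_mul, Units.val_mul, mul_inv, smul_mul_smul_comm] }
  have hc : (Nat.card H : K) ≠ 0 := Nat.cast_ne_zero.2 Nat.card_pos.ne'
  have := invertibleOfNonzero hc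
  have h1 := card_inv_mul_sum_char_eq_finrank σ
  have h2 : ∀ h, σ.character h = (l h : K)⁻¹ * LinearMap.trace K V (ρ h) := fun h =>
    map_smul _ _ _
  simp_rw [h2] at h1
  rw [inv_mul_eq_iff_eq_mul₀ hc] at h1
  rw [h1, mul_ne_zero_iff_left hc, Nat.cast_ne_zero, ← Nat.pos_iff_ne_zero,
    Module.finrank_pos_iff_exists_ne_zero]
  have h3 : ∀ v, v ∈ invariants σ ↔ ∀ h, ρ h v = (l h : K) • v := fun v =>
    forall_congr' fun h => inv_smul_eq_iff₀ (l h).ne_zero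
  constructor
  · rintro ⟨v, hv⟩
    exact ⟨v, fun h => hv (Subtype.ext h), (h3 v).1 v.2⟩
  · rintro ⟨v, hv, hv'⟩
    exact ⟨⟨v, (h3 v).2 hv'⟩, fun h => hv (congrArg Subtype.val h)⟩

end Representation

theorem exists_isPrimitiveRoot_Qfield {p : ℕ} (hp : p.Prime) (r : ℕ) :
    ∃ ζ : Qfield p, IsPrimitiveRoot ζ (p ^ r) := by
  have h1 := Complex.isPrimitiveRoot_exp (p ^ (r + 1)) (pow_ne_zero _ hp.ne_zero)
  have h2 : IsPrimitiveRoot (⟨_, Subfield.subset_closure ⟨r + 1, r.succ_pos, h1.pow_eq_one⟩⟩ :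
      Qfield p) (p ^ (r + 1)) :=
    IsPrimitiveRoot.of_map_of_injective (f := (Qfield p).subtype) h1 Subtype.val_injective
  exact ⟨_, h2.pow (pow_pos hp.pos _) (pow_succ' p r)⟩

theorem Representation.isIrreducibleCharacter_of_sum {G V : Type} [Group G] [Fintype G]
    [AddCommGroup V] [Module ℂ V] [FiniteDimensional ℂ V] (ρ : Representation ℂ G V)
    (h : ∑ g, ρ.character g * ρ.character g⁻¹ = Nat.card G) :
    IsIrreducibleCharacter G ρ.character :=
  ⟨FDRep.of ρ, (FDRep.simple_iff_char_is_norm_one _).2 h, rfl⟩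

theorem IsIrreducibleCharacter.sum_eq {G : Type} [Group G] [Fintype G] {χ : G → ℂ}
    (h : IsIrreducibleCharacter G χ) : ∑ g, χ g * χ g⁻¹ = Nat.card G := by
  obtain ⟨V, hV, rfl⟩ := h
  exact (FDRep.simple_iff_char_is_norm_one V).1 hV

theorem Representation.IsSchurian.isIrreducibleCharacter {K : Subfield ℂ} {G V : Type} [Group G]
    [Finite G] [AddCommGroup V] [Module K V] [FiniteDimensional K V] [Nontrivial V]
    {ρ : Representation K G V} (hρ : ρ.IsSchurian) :
    IsIrreducibleCharacter G fun g => (LinearMap.trace K V (ρ g) : ℂ) := by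
  have := Fintype.ofFinite G
  let σ : Representation ℂ G (TensorProduct K ℂ V) :=
    (Module.End.baseChangeHom K ℂ V : Module.End K V →* _).comp ρ
  have h1 : ∀ g, σ.character g = (LinearMap.trace K V (ρ g) : ℂ) := fun g =>
    LinearMap.trace_baseChange (ρ g) ℂ
  have h2 := σ.isIrreducibleCharacter_of_sum (by
    simp_rw [h1, ← Subfield.coe_mul]
    rw [Nat.card_eq_fintype_card]
    have := congrArg (Subtype.val : K → ℂ) hρ.sum_trace
    simpa using this)
  rwa [funext h1] at h2

theorem IsIrreducibleCharacter.comp_mk {G : Type} [Group G] [Finite G] {N : Subgroup G}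
    [N.Normal] {χ : G ⧸ N → ℂ} (h : IsIrreducibleCharacter (G ⧸ N) χ) :
    IsIrreducibleCharacter G fun g => χ g := by
  have := Fintype.ofFinite G
  have h1 := h.sum_eq
  obtain ⟨V, hV, rfl⟩ := h
  let σ : Representation ℂ G V := MonoidHom.comp V.ρ (QuotientGroup.mk' N)
  refine σ.isIrreducibleCharacter_of_sum ?_
  have h2 : ∀ φ : G ⧸ N → ℂ, ∑ g : G, φ g = Nat.card N * ∑ q, φ q := fun φ => by
    rw [Fintype.sum_equiv Subgroup.groupEquivQuotientProdSubgroup (fun g : G => φ g)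
      (fun x => φ x.1) fun g => rfl, Fintype.sum_prod_type]
    simp [Finset.mul_sum]
  refine (h2 fun q => V.character q * V.character q⁻¹).trans ?_
  rw [h1, ← Nat.cast_mul, mul_comm, ← Subgroup.card_eq_card_quotient_mul_card_subgroup]

theorem linearIndependent_isIrreducibleCharacter (G : Type) [Group G] [Finite G] :
    LinearIndependent ℂ (Subtype.val : {χ : G → ℂ | IsIrreducibleCharacter G χ} → G → ℂ) := by
  have := Fintype.ofFinite G
  have hc : (Nat.card G : ℂ) ≠ 0 := Nat.cast_ne_zero.2 Nat.card_pos.ne'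
  have := invertibleOfNonzero hc
  let φ (χ : G → ℂ) : Module.Dual ℂ (G → ℂ) :=
    (Nat.card G : ℂ)⁻¹ • ∑ g, χ g⁻¹ • LinearMap.proj g
  have hφ : ∀ χ ψ, φ χ ψ = (Nat.card G : ℂ)⁻¹ * ∑ g, ψ g * χ g⁻¹ := fun χ ψ => by
    simp [φ, mul_comm]
  refine LinearIndependent.of_pairwise_dual_eq_zero_one _ (fun χ => φ χ.1) ?_ ?_
  · rintro ⟨_, V, hV, rfl⟩ ⟨_, W, hW, rfl⟩ hne
    refine (hφ _ _).trans ((FDRep.char_orthonormal W V).trans (if_neg ?_))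
    rintro ⟨i⟩
    exact hne (Subtype.ext (FDRep.char_iso i).symm)
  · rintro ⟨_, V, hV, rfl⟩
    exact (hφ _ _).trans ((FDRep.char_orthonormal V V).trans (if_pos ⟨CategoryTheory.Iso.refl V⟩))

theorem finite_isIrreducibleCharacter (G : Type) [Group G] [Finite G] :
    {χ : G → ℂ | IsIrreducibleCharacter G χ}.Finite :=
  (linearIndependent_isIrreducibleCharacter G).set_finite_of_isNoetherian

theorem ncard_isIrreducibleCharacter_le (G : Type) [Group G] [Finite G] :
    {χ : G → ℂ | IsIrreducibleCharacter G χ}.ncard ≤ Nat.card G := by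
  have := Fintype.ofFinite G
  have := (finite_isIrreducibleCharacter G).fintype
  have h1 := (linearIndependent_isIrreducibleCharacter G).fintype_card_le_finrank
  rwa [Module.finrank_fintype_fun_eq_card, ← Nat.card_eq_fintype_card,
    ← Nat.card_eq_fintype_card, Nat.card_coe_set_eq] at h1

theorem QppValuedIrrChars_finite (G : Type) [Group G] [Finite G] : (QppValuedIrrChars G).Finite :=
  (finite_isIrreducibleCharacter G).subset fun _ h => h.1

theorem exists_forall_mem_QppValuedIrrChars {G : Type} [Group G] [Finite G]
    [Group.IsSolvable G] {p : ℕ} (hp : p.Prime) {N : Subgroup G} [N.Normal] {s : ℕ}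
    (hN : ∀ x : N, x ^ p ^ s = 1) :
    ∃ Φ : (N →* (Qfield p)ˣ) → G → ℂ, (∀ l, Φ l ∈ QppValuedIrrChars G) ∧
      (∀ l m, Φ l = Φ m → ∃ g, ∀ n, m n = l (MulAut.conjNormal g n)) ∧
      ∀ l, (∀ n : N, Φ l n = Φ l 1) → l = 1 := by
  have := Fact.mk hp
  have := Fintype.ofFinite N
  choose V _ _ _ _ ρ hρ hv hm using fun l : N →* (Qfield p)ˣ =>
    Representation.exists_isSchurian_forall_conj (exists_isPrimitiveRoot_Qfield hp) hN l
  refine ⟨fun l g => (LinearMap.trace (Qfield p) (V l) (ρ l g) : ℂ),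
    fun l => ⟨(hρ l).isIrreducibleCharacter, p, hp, fun g => Subtype.prop _⟩,
    fun l m hlm => hm l m ?_, fun l hl => ?_⟩
  · have h1 := (Representation.sum_inv_mul_trace_ne_zero_iff ((ρ m).comp N.subtype) m).2 (hv m)
    refine (Representation.sum_inv_mul_trace_ne_zero_iff ((ρ l).comp N.subtype) m).1 ?_
    convert h1 using 3 with n
    exact Subtype.ext (congrFun hlm n)
  · have h1 := (Representation.sum_inv_mul_trace_ne_zero_iff ((ρ l).comp N.subtype) 1).1 (by
      have h2 : ∀ n : N, LinearMap.trace _ (V l) (ρ l n) = Module.finrank (Qfield p) (V l) :=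
        fun n => (Subtype.ext (hl n)).trans (by rw [map_one, LinearMap.trace_one])
      have h3 : Module.finrank (Qfield p) (V l) ≠ 0 := Module.finrank_pos.ne'
      simpa [h2] using h3)
    obtain ⟨g, hg⟩ := hm l 1 h1
    ext n
    have h2 := hg (MulAut.conjNormal g⁻¹ n)
    rw [← MulAut.mul_apply, ← map_mul, mul_inv_cancel, map_one, MulAut.one_apply] at h2
    rw [← h2]
    rfl

theorem ncard_QppValuedIrrChars_quotient_lt {G : Type} [Group G] [Finite G] {N : Subgroup G}
    [N.Normal] {χ : G → ℂ} (hχ : χ ∈ QppValuedIrrChars G) (h : ∃ n : N, χ n ≠ χ 1) :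
    (QppValuedIrrChars (G ⧸ N)).ncard < (QppValuedIrrChars G).ncard := by
  let f : (G ⧸ N → ℂ) → G → ℂ := fun φ g => φ g
  have hf : Function.Injective f := fun φ ψ hφψ => funext fun q => by
    obtain ⟨g, rfl⟩ := QuotientGroup.mk_surjective q
    exact congrFun hφψ g
  rw [← Set.ncard_image_of_injective _ hf]
  refine Set.ncard_lt_ncard (ssubset_of_subset_not_subset ?_ fun hsub => ?_)
    (QppValuedIrrChars_finite G)
  · rintro _ ⟨φ, ⟨hφ, p, hp, hφp⟩, rfl⟩
    exact ⟨hφ.comp_mk, p, hp, fun g => hφp g⟩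
  · obtain ⟨φ, -, rfl⟩ := hsub hχ
    obtain ⟨n, hn⟩ := h
    exact hn (congrArg φ ((QuotientGroup.eq_one_iff _).2 n.2))

theorem ncard_quotient_lt_and_card_le {G : Type} [Group G] [Finite G] [Group.IsSolvable G] {p : ℕ}
    (hp : p.Prime) {N : Subgroup G} [N.Normal] {s : ℕ} (hN : ∀ x : N, x ^ p ^ s = 1)
    (hcomm : ∀ x y : N, x * y = y * x) (hbot : N ≠ ⊥) :
    (QppValuedIrrChars (G ⧸ N)).ncard < (QppValuedIrrChars G).ncard ∧
      Nat.card N ≤ (QppValuedIrrChars G).ncard * Nat.card (G ⧸ N) := by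
  obtain ⟨Φ, hΦ, hconj, hone⟩ := exists_forall_mem_QppValuedIrrChars hp hN
  have hcard : Nat.card (N →* (Qfield p)ˣ) = Nat.card N := by
    let _ : CommGroup N := { mul_comm := hcomm }
    have := hasEnoughRootsOfUnity_of_pow_eq_one hp (exists_isPrimitiveRoot_Qfield hp) hN
    exact CommGroup.card_monoidHom_of_hasEnoughRootsOfUnity N (Qfield p)
  constructor
  · have : Nontrivial (N →* (Qfield p)ˣ) := by
      rw [← Finite.one_lt_card_iff_nontrivial, hcard]
      exact N.one_lt_card_iff_ne_bot.2 hbot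
    obtain ⟨l, hl⟩ := exists_ne (1 : N →* (Qfield p)ˣ)
    refine ncard_QppValuedIrrChars_quotient_lt (hΦ l) ?_
    by_contra! h
    exact hl (hone l h)
  · have : Finite (QppValuedIrrChars G) := (QppValuedIrrChars_finite G).to_subtype
    choose g hg using fun l =>
      hconj (Function.invFun Φ (Φ l)) l (Function.invFun_eq ⟨l, rfl⟩)
    rw [← hcard, ← Nat.card_coe_set_eq, ← Nat.card_prod]
    refine Nat.card_le_card_of_injective
      (fun l => ((⟨Φ l, hΦ l⟩ : QppValuedIrrChars G), (g l : G ⧸ N))) fun l m hlm => ?_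
    obtain ⟨h1, h2⟩ := Prod.ext_iff.1 hlm
    have h1 : Φ l = Φ m := congrArg Subtype.val h1
    have h2 : (g l)⁻¹ * g m ∈ N := QuotientGroup.eq.1 h2
    ext n : 1
    rw [hg l, hg m, h1]
    have h3 : MulAut.conjNormal (g m) n = MulAut.conjNormal (g l) n := by
      rw [← mul_inv_cancel_left (g l) (g m), map_mul, MulAut.mul_apply]
      refine congrArg _ ?_
      have h4 : MulAut.conjNormal ((g l)⁻¹ * g m) n = (⟨_, h2⟩ : N) * n * (⟨_, h2⟩ : N)⁻¹ :=
        Subtype.ext rfl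
      rw [h4, hcomm, inv_mul_cancel_left]
    rw [h3]

/-- A bound for the order of a finite solvable group with at most `k` irreducible characters with
values in some `Qfield p`. -/
def orderBound : ℕ → ℕ
  | 0 => 1
  | k + 1 => (k + 1) * orderBound k ^ 2

theorem orderBound_pos (k : ℕ) : 0 < orderBound k := by
  induction k with
  | zero => exact one_pos
  | succ k ih => exact Nat.mul_pos k.succ_pos (pow_pos ih 2)

theorem card_le_orderBound (k : ℕ) (G : Type) [Group G] [Finite G] [Group.IsSolvable G]
    (hk : (QppValuedIrrChars G).ncard ≤ k) : Nat.card G ≤ orderBound k := by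
  induction k generalizing G with
  | zero =>
    cases subsingleton_or_nontrivial G
    · exact Nat.card_of_subsingleton (1 : G) |>.le
    · obtain ⟨p, hp, N, _, hbot, hN, hcomm⟩ := Subgroup.exists_normal_commute_prime_exponent G
      have h1 := (ncard_quotient_lt_and_card_le hp (N := N) (s := 1)
        (fun x => Subtype.ext (by simpa using hN x x.2))
        (fun x y => Subtype.ext (hcomm x x.2 y y.2)) hbot).1
      omega
  | succ k ih =>
    cases subsingleton_or_nontrivial G
    · rw [Nat.card_of_subsingleton (1 : G)]
      exact orderBound_pos _
    · obtain ⟨p, hp, N, _, hbot, hN, hcomm⟩ := Subgroup.exists_normal_commute_prime_exponent G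
      obtain ⟨h1, h2⟩ := ncard_quotient_lt_and_card_le hp (N := N) (s := 1)
        (fun x => Subtype.ext (by simpa using hN x x.2))
        (fun x y => Subtype.ext (hcomm x x.2 y y.2)) hbot
      have h3 := ih (G ⧸ N) (by omega)
      calc Nat.card G = Nat.card (G ⧸ N) * Nat.card N :=
            Subgroup.card_eq_card_quotient_mul_card_subgroup N
        _ ≤ orderBound k * ((k + 1) * orderBound k) :=
            Nat.mul_le_mul h3 (h2.trans (Nat.mul_le_mul hk h3))
        _ = orderBound (k + 1) := by rw [orderBound]; ring

/-- There is a function `f : ℕ → ℕ` such that every finite solvable group `G` has at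
most `f k` irreducible characters, where `k` is the number of `Q_pp`-valued
irreducible characters of `G`. -/
theorem card_irr_le_of_card_Qpp :
    ∃ f : ℕ → ℕ, ∀ (G : Type) [Group G] [Fintype G], IsSolvable G →
      {χ : G → ℂ | IsIrreducibleCharacter G χ}.ncard ≤ f (QppValuedIrrChars G).ncard := by
  refine ⟨orderBound, fun G _ _ hG => ?_⟩
  have : Group.IsSolvable G := hG
  exact (ncard_isIrreducibleCharacter_le G).trans (card_le_orderBound _ G le_rfl)
end
end

section
/- Let p be a prime, n a positive integer, F the finite field of order p^n, and let G be the semidirect product of the additive group E of F by the multiplicative group C = F^× acting by field multiplication. Then the unique faithful irreducible character of G is Q_p-valued. -/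
open scoped Classical

noncomputable section

/-- **Schur's lemma** for a linear map commuting with the action of the group. -/
theorem FDRep.eq_zero_or_surjective_of_commute {k G : Type} [Field k] [Group G]
    (V : FDRep k G) [CategoryTheory.Simple V] (T : V →ₗ[k] V)
    (hT : ∀ g, T ∘ₗ V.ρ g = V.ρ g ∘ₗ T) :
    T = 0 ∨ Function.Surjective T := by
  let f : V ⟶ V := ⟨CategoryTheory.InducedCategory.homMk (ModuleCat.ofHom T), fun g ↦ by
    ext x
    exact LinearMap.congr_fun (hT g) x⟩
  by_cases hf : f = 0
  · left
    have h : f.hom.hom.hom = (0 : V ⟶ V).hom.hom.hom := by rw [hf]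
    exact h
  · right
    have : CategoryTheory.IsIso f := CategoryTheory.isIso_of_hom_simple hf
    exact (FDRep.isoToLinearEquiv (CategoryTheory.asIso f)).surjective

/-- The trace of an endomorphism `T` with `T ^ p ^ a = 1` is a sum of `p ^ a`-th roots of unity. -/
theorem trace_mem_Qfield {p a : ℕ} (ha : 0 < a) {V : Type*} [AddCommGroup V] [Module ℂ V]
    [Module.Finite ℂ V] (T : Module.End ℂ V) (hT : T ^ p ^ a = 1) :
    LinearMap.trace ℂ V T ∈ Qfield p := by
  rw [Module.End.trace_eq_sum_roots_charpoly_of_splits (IsAlgClosed.splits _)]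
  refine Subfield.multiset_sum_mem _ _ fun μ hμ ↦ Subfield.subset_closure ⟨a, ha, ?_⟩
  obtain ⟨v, hv⟩ := ((Module.End.hasEigenvalue_iff_isRoot_charpoly T μ).2
    (Polynomial.isRoot_of_mem_roots hμ)).exists_hasEigenvector
  have h := hv.pow_apply (p ^ a)
  rw [hT, Module.End.one_apply] at h
  have h' : (μ ^ p ^ a - 1) • v = 0 := by rw [sub_smul, one_smul, ← h, sub_self]
  exact sub_eq_zero.1 ((smul_eq_zero.1 h').resolve_right hv.2)

section SemidirectProduct

variable {N H : Type} [CommGroup N] [Fintype N] [Group H] {φ : H →* MulAut N}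

/-- If the normal factor `N` of `N ⋊[φ] H` acts nontrivially on a simple representation,
then the sum over `N` acts as zero. -/
theorem FDRep.sum_inl_eq_zero (V : FDRep ℂ (N ⋊[φ] H)) [CategoryTheory.Simple V]
    (hV : ∃ x : N, V.ρ (SemidirectProduct.inl x) ≠ 1) :
    ∑ y : N, V.ρ (SemidirectProduct.inl y) = 0 := by
  have hcomm (g : N ⋊[φ] H) : (∑ y : N, V.ρ (SemidirectProduct.inl y)) ∘ₗ V.ρ g =
      V.ρ g ∘ₗ ∑ y : N, V.ρ (SemidirectProduct.inl y) := by
    change (∑ y : N, V.ρ (SemidirectProduct.inl y)) * V.ρ g =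
      V.ρ g * ∑ y : N, V.ρ (SemidirectProduct.inl y)
    rw [Finset.sum_mul, Finset.mul_sum]
    refine (Fintype.sum_equiv (φ g.right).toEquiv _ _ fun y ↦ ?_).symm
    rw [← map_mul, ← map_mul]
    congr 1
    ext <;> simp [mul_comm]
  refine (V.eq_zero_or_surjective_of_commute _ hcomm).resolve_right fun hsurj ↦ ?_
  obtain ⟨x, hx⟩ := hV
  refine hx (LinearMap.ext fun v ↦ ?_)
  obtain ⟨w, rfl⟩ := hsurj v
  have h : V.ρ (SemidirectProduct.inl x) * ∑ y : N, V.ρ (SemidirectProduct.inl y) =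
      ∑ y : N, V.ρ (SemidirectProduct.inl y) := by
    rw [Finset.mul_sum]
    exact Fintype.sum_equiv (Equiv.mulLeft x) _ _ fun y ↦ by simp
  exact LinearMap.congr_fun h w

/-- If `h` acts without fixed points, in the sense that `z ↦ z * φ h z⁻¹` is onto, then the
character of a simple representation that is nontrivial on `N` vanishes on the coset of `h`. -/
theorem FDRep.character_eq_zero_of_surjective (V : FDRep ℂ (N ⋊[φ] H)) [CategoryTheory.Simple V]
    (hV : ∃ x : N, V.ρ (SemidirectProduct.inl x) ≠ 1) (g : N ⋊[φ] H)
    (hg : ∀ y : N, ∃ z : N, z * φ g.right z⁻¹ = y) : V.character g = 0 := by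
  have hconj (y : N) :
      V.character (SemidirectProduct.inl y * g) = V.character g := by
    obtain ⟨z, hz⟩ := hg y
    rw [← V.char_conj g (SemidirectProduct.inl z)]
    congr 1
    ext
    · simp only [← hz, map_inv, SemidirectProduct.mul_left, SemidirectProduct.left_inl,
        SemidirectProduct.right_inl, SemidirectProduct.mul_right, SemidirectProduct.inv_left,
        map_one, MulAut.one_apply, one_mul, inv_one]
      ac_rfl
    · simp
  have hsum : ∑ y : N, V.character (SemidirectProduct.inl y * g) = 0 := by
    simp only [FDRep.character, map_mul]
    rw [← map_sum, ← Finset.sum_mul, V.sum_inl_eq_zero hV, zero_mul, map_zero]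
  simpa [hconj] using hsum

end SemidirectProduct

/-- Let `p` be a prime, `n` a positive integer, `F` the finite field with `p ^ n`
elements, and `G = F⁺ ⋊ Fˣ` the semidirect product of the additive group of `F`
(written multiplicatively) by `Fˣ` acting by field multiplication.  Then the unique
faithful irreducible character of `G` is `Q_p`-valued: every faithful irreducible
character of `G` takes all of its values in `Qfield p`. -/
theorem faithful_irr_char_is_Qp_valued (p n : ℕ) (hp : p.Prime) (hn : 0 < n)
    (F : Type) [Field F] [Fintype F] (hF : Fintype.card F = p ^ n)
    (φ : Fˣ →* MulAut (Multiplicative F))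
    (hφ : ∀ (u : Fˣ) (x : F),
      φ u (Multiplicative.ofAdd x) = Multiplicative.ofAdd ((u : F) * x))
    (χ : (Multiplicative F ⋊[φ] Fˣ) → ℂ)
    (hχ : IsIrreducibleCharacter (Multiplicative F ⋊[φ] Fˣ) χ)
    (hfaithful : ∀ g, χ g = χ 1 → g = 1) :
    ∀ g, χ g ∈ Qfield p := by
  obtain ⟨V, hV, rfl⟩ := hχ
  have hnontriv : ∃ x : Multiplicative F, V.ρ (SemidirectProduct.inl x) ≠ 1 := by
    refine ⟨Multiplicative.ofAdd 1, fun h ↦ ?_⟩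
    have h1 := hfaithful (SemidirectProduct.inl (Multiplicative.ofAdd 1))
      (by simp only [FDRep.character, h, map_one])
    rw [← map_one (SemidirectProduct.inl (φ := φ))] at h1
    exact one_ne_zero (α := F) (Multiplicative.ofAdd.injective (SemidirectProduct.inl_injective h1))
  intro g
  by_cases hg : g.right = 1
  · refine trace_mem_Qfield hn _ ?_
    have hgl : g = SemidirectProduct.inl g.left := by ext <;> simp [hg]
    have hpow : g.left ^ p ^ n = 1 := by
      rw [← hF, ← Fintype.card_multiplicative F]
      exact pow_card_eq_one
    rw [hgl, ← map_pow, ← map_pow, hpow, map_one, map_one]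
  · have h0 : V.character g = 0 := by
      refine V.character_eq_zero_of_surjective hnontriv g fun y ↦ ?_
      have hu : (1 : F) - g.right ≠ 0 := fun h ↦ hg (Units.ext (sub_eq_zero.1 h).symm)
      refine ⟨Multiplicative.ofAdd ((1 - (g.right : F))⁻¹ * y.toAdd), ?_⟩
      rw [← ofAdd_neg, hφ, ← ofAdd_add]
      refine Multiplicative.toAdd.injective ?_
      rw [toAdd_ofAdd]
      field_simp
      ring
    change V.character g ∈ Qfield p
    rw [h0]
    exact zero_mem _
end
end
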